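/- arXiv:2301.06131 — 2 statements merged into one kernel-verified Lean document; each statement's English description precedes it below -/
import Mathlib

section
/- Gao–Hug–Schneider spherical Blaschke–Santaló inequality: let A be a nonempty measurable subset of the sphere S^{n−1} and let C be a spherical cap with σ(A) = σ(C), where σ is the rotation-invariant (Haar) probability measure on S^{n−1}. Then σ(A°) ≤ σ(C°), where A° = {y ∈ S^{n−1} : ⟨x,y⟩ ≤ 0 for all x ∈ A}. If moreover A is closed and σ(A) < 1/2, equality holds if and only if A is a spherical cap. -/
open MeasureTheory Filter
open scoped InnerProductSpace Pointwise NNReal ENNReal Topology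

noncomputable section

/-- The spherical polar of `A ⊆ S^{n-1}`:
`A° = {y ∈ S^{n-1} : ⟨x,y⟩ ≤ 0 for all x ∈ A}`. -/
def sphericalPolar {n : ℕ} (A : Set (EuclideanSpace ℝ (Fin n))) :
    Set (EuclideanSpace ℝ (Fin n)) :=
  {y ∈ Metric.sphere (0 : EuclideanSpace ℝ (Fin n)) 1 | ∀ x ∈ A, ⟪x, y⟫_ℝ ≤ 0}

/-- A spherical cap: a nonempty intersection of the sphere with a closed half-space. -/
def IsSphericalCap {n : ℕ} (C : Set (EuclideanSpace ℝ (Fin n))) : Prop :=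
  C.Nonempty ∧ ∃ (u : EuclideanSpace ℝ (Fin n)) (c : ℝ), u ≠ 0 ∧
    C = Metric.sphere (0 : EuclideanSpace ℝ (Fin n)) 1 ∩ {x | c ≤ ⟪u, x⟫_ℝ}

/-- The rotation invariant (Haar) probability measure on the unit sphere `S^{n-1}`,
realized as the normalized `(n-1)`-dimensional Hausdorff measure on the sphere. -/
def sphereHaar (n : ℕ) : Measure (EuclideanSpace ℝ (Fin n)) :=
  ((μH[(n : ℝ) - 1]) (Metric.sphere (0 : EuclideanSpace ℝ (Fin n)) 1))⁻¹ •
    (μH[(n : ℝ) - 1]).restrict (Metric.sphere (0 : EuclideanSpace ℝ (Fin n)) 1)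

theorem norm_inv_norm_smul_sub_le {F : Type*} [NormedAddCommGroup F] [NormedSpace ℝ F]
    {x y : F} (hx : 1 ≤ ‖x‖) (hy : 1 ≤ ‖y‖) :
    ‖‖x‖⁻¹ • x - ‖y‖⁻¹ • y‖ ≤ 2 * ‖x - y‖ := by
  have hx0 : 0 < ‖x‖ := by linarith
  have hy0 : 0 < ‖y‖ := by linarith
  have key : ‖x‖⁻¹ • x - ‖y‖⁻¹ • y = ‖x‖⁻¹ • (x - y) + (‖x‖⁻¹ - ‖y‖⁻¹) • y := by module
  rw [key]
  refine (norm_add_le _ _).trans ?_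
  rw [norm_smul, norm_smul, norm_inv, norm_norm, Real.norm_eq_abs]
  have h1 : ‖x‖⁻¹ ≤ 1 := inv_le_one_of_one_le₀ hx
  have h2 : |‖x‖⁻¹ - ‖y‖⁻¹| * ‖y‖ = |‖y‖ - ‖x‖| * ‖x‖⁻¹ := by
    rw [inv_sub_inv hx0.ne' hy0.ne', abs_div, abs_of_pos (mul_pos hx0 hy0)]
    field_simp
  have h3 : |‖y‖ - ‖x‖| ≤ ‖x - y‖ := by
    rw [norm_sub_rev]; exact abs_norm_sub_norm_le _ _
  rw [h2]
  have h4 : |‖y‖ - ‖x‖| * ‖x‖⁻¹ ≤ ‖x - y‖ * 1 := by gcongr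
  have h5 : ‖x‖⁻¹ * ‖x - y‖ ≤ 1 * ‖x - y‖ := by gcongr
  linarith

/-- The radial projection to the sphere of the hyperplane `{x | x i = s}`. -/
def facetChart {m : ℕ} (i : Fin (m + 1)) (s : ℝ) (w : Fin m → ℝ) :
    EuclideanSpace ℝ (Fin (m + 1)) :=
  ‖WithLp.toLp 2 (i.insertNth s w : Fin (m + 1) → ℝ)‖⁻¹ •
    WithLp.toLp 2 (i.insertNth s w : Fin (m + 1) → ℝ)

theorem exists_lipschitzWith_facetChart {m : ℕ} (i : Fin (m + 1)) {s : ℝ} (hs : |s| = 1) :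
    ∃ K, LipschitzWith K (facetChart i s : (Fin m → ℝ) → _) := by
  have h1 : ∀ w : Fin m → ℝ, 1 ≤ ‖WithLp.toLp 2 (i.insertNth s w : Fin (m + 1) → ℝ)‖ := by
    intro w
    have := PiLp.norm_apply_le (WithLp.toLp 2 (i.insertNth s w : Fin (m + 1) → ℝ)) i
    simpa [hs] using this
  obtain ⟨K, hK⟩ : ∃ K, LipschitzWith K
      (WithLp.toLp 2 : (Fin (m + 1) → ℝ) → EuclideanSpace ℝ (Fin (m + 1))) :=
    ⟨_, PiLp.lipschitzWith_toLp 2 _⟩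
  refine ⟨2 * K, LipschitzWith.of_dist_le_mul fun v w => ?_⟩
  rw [dist_eq_norm]
  refine (norm_inv_norm_smul_sub_le (h1 v) (h1 w)).trans ?_
  rw [← dist_eq_norm]
  have h2 := hK.dist_le_mul (i.insertNth s v : Fin (m + 1) → ℝ) (i.insertNth s w)
  rw [Fin.dist_insertNth_insertNth, dist_self, max_eq_right dist_nonneg] at h2
  push_cast
  linarith

theorem hausdorffMeasure_facetChart_image_le {m : ℕ} (i : Fin (m + 1)) {s : ℝ} (hs : |s| = 1) :
    ∃ K : ℝ≥0, ∀ T : Set (Fin m → ℝ), μH[((m + 1 : ℕ) : ℝ) - 1] (facetChart i s '' T) ≤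
      (K : ℝ≥0∞) ^ (m : ℝ) * volume T := by
  obtain ⟨K, hK⟩ := exists_lipschitzWith_facetChart i hs
  refine ⟨K, fun T => ?_⟩
  have := hK.hausdorffMeasure_image_le (Nat.cast_nonneg m) T
  have hv : (μH[(m : ℝ)] : Measure (Fin m → ℝ)) = volume := by
    simpa using hausdorffMeasure_pi_real (ι := Fin m)
  rw [hv] at this
  have e : ((m + 1 : ℕ) : ℝ) - 1 = m := by push_cast; ring
  rwa [e]

theorem exists_mem_facetChart {m : ℕ} {x : EuclideanSpace ℝ (Fin (m + 1))} (hx : ‖x‖ = 1) :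
    ∃ (i : Fin (m + 1)) (s : ℝ), (s = 1 ∨ s = -1) ∧
      ∃ w : Fin m → ℝ, (∀ j, w j ∈ Set.Icc (-1 : ℝ) 1) ∧ facetChart i s w = x ∧
        ∃ c : ℝ, WithLp.toLp 2 (i.insertNth s w : Fin (m + 1) → ℝ) = c • x := by
  obtain ⟨i, -, hi⟩ := Finset.exists_max_image Finset.univ (fun i => |x i|) Finset.univ_nonempty
  have hpos : 0 < |x i| := by
    rw [abs_pos]
    intro h0
    have : x = 0 := by
      ext j
      have := hi j (Finset.mem_univ _)
      simp only [h0, abs_zero] at this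
      simpa using abs_nonpos_iff.1 this
    simp [this] at hx
  have hins : WithLp.toLp 2 (i.insertNth (x i / |x i|) (fun j => x (i.succAbove j) / |x i|) :
      Fin (m + 1) → ℝ) = |x i|⁻¹ • x := by
    ext j
    refine Fin.succAboveCases i ?_ (fun k => ?_) j
    · simp [div_eq_inv_mul]
    · simp [div_eq_inv_mul]
  refine ⟨i, x i / |x i|, ?_, fun j => x (i.succAbove j) / |x i|, fun j => ?_, ?_, _, hins⟩
  · rcases abs_cases (x i) with h | h
    · left; rw [h.1]; exact div_self (by rw [← h.1]; exact hpos.ne')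
    · right; rw [h.1, div_neg, div_self (by linarith [h.2])]
  · have := hi (i.succAbove j) (Finset.mem_univ _)
    rw [Set.mem_Icc, ← abs_le, abs_div, abs_abs]
    exact div_le_one_of_le₀ this hpos.le
  · rw [facetChart, hins, norm_smul, hx, norm_inv, Real.norm_eq_abs, abs_abs, smul_smul]
    simp [hpos.ne']

theorem hausdorffMeasure_sphere_lt_top {n : ℕ} (hn : 1 ≤ n) :
    μH[(n : ℝ) - 1] (Metric.sphere (0 : EuclideanSpace ℝ (Fin n)) 1) < ∞ := by
  obtain ⟨m, rfl⟩ := Nat.exists_eq_add_of_le' hn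
  have hsub : Metric.sphere (0 : EuclideanSpace ℝ (Fin (m + 1))) 1 ⊆
      ⋃ i : Fin (m + 1), (facetChart i 1 '' (Set.Icc (-1) 1) ∪
        facetChart i (-1) '' (Set.Icc (-1) 1)) := by
    intro x hx
    obtain ⟨i, s, hs, w, hw, hwx, -⟩ := exists_mem_facetChart (mem_sphere_zero_iff_norm.1 hx)
    refine Set.mem_iUnion.2 ⟨i, ?_⟩
    have hw' : w ∈ Set.Icc (-1 : Fin m → ℝ) 1 := ⟨fun j => (hw j).1, fun j => (hw j).2⟩
    rcases hs with rfl | rfl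
    · exact Or.inl ⟨w, hw', hwx⟩
    · exact Or.inr ⟨w, hw', hwx⟩
  refine (measure_mono hsub).trans_lt ?_
  refine (measure_iUnion_le _).trans_lt ?_
  rw [tsum_fintype, ENNReal.sum_lt_top]
  intro i _
  have fin : ∀ s : ℝ, |s| = 1 →
      μH[((m + 1 : ℕ) : ℝ) - 1] (facetChart i s '' (Set.Icc (-1) 1)) < ∞ := by
    intro s hs
    obtain ⟨K, hK⟩ := hausdorffMeasure_facetChart_image_le i hs
    refine (hK _).trans_lt (ENNReal.mul_lt_top ?_ ?_)
    · exact ENNReal.rpow_lt_top_of_nonneg (Nat.cast_nonneg m) ENNReal.coe_ne_top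
    · exact isCompact_Icc.measure_lt_top
  exact (measure_union_le _ _).trans_lt (ENNReal.add_lt_top.2 ⟨fin 1 (by simp), fin (-1) (by simp)⟩)

theorem hausdorffMeasure_sphere_inter_orthogonal {n : ℕ} {u : EuclideanSpace ℝ (Fin n)}
    (hu : u ≠ 0) :
    μH[(n : ℝ) - 1] (Metric.sphere (0 : EuclideanSpace ℝ (Fin n)) 1 ∩ {x | ⟪u, x⟫_ℝ = 0}) = 0 := by
  obtain _ | m := n
  · exact absurd (Subsingleton.elim _ _) hu
  let Z (i : Fin (m + 1)) (s : ℝ) : Set (Fin m → ℝ) :=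
    {w | ⟪u, WithLp.toLp 2 (i.insertNth s w : Fin (m + 1) → ℝ)⟫_ℝ = 0}
  have hsub : Metric.sphere (0 : EuclideanSpace ℝ (Fin (m + 1))) 1 ∩ {x | ⟪u, x⟫_ℝ = 0} ⊆
      ⋃ i : Fin (m + 1), (facetChart i 1 '' Z i 1 ∪ facetChart i (-1) '' Z i (-1)) := by
    rintro x ⟨hx, hux⟩
    obtain ⟨i, s, hs, w, hw, hwx, c, hc⟩ := exists_mem_facetChart (mem_sphere_zero_iff_norm.1 hx)
    refine Set.mem_iUnion.2 ⟨i, ?_⟩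
    have hw' : w ∈ Z i s := by
      change ⟪u, WithLp.toLp 2 (i.insertNth s w : Fin (m + 1) → ℝ)⟫_ℝ = 0
      have hux' : ⟪u, x⟫_ℝ = 0 := hux
      rw [hc, inner_smul_right, hux', mul_zero]
    rcases hs with rfl | rfl
    · exact Or.inl ⟨w, hw', hwx⟩
    · exact Or.inr ⟨w, hw', hwx⟩
  refine measure_mono_null hsub ?_
  rw [measure_iUnion_null_iff]
  intro i
  have null : ∀ s : ℝ, |s| = 1 →
      μH[((m + 1 : ℕ) : ℝ) - 1] (facetChart i s '' Z i s) = 0 := by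
    intro s hs
    obtain ⟨K, hK⟩ := hausdorffMeasure_facetChart_image_le i hs
    have hform : ∀ w : Fin m → ℝ, ⟪u, WithLp.toLp 2 (i.insertNth s w : Fin (m + 1) → ℝ)⟫_ℝ
        = s * u i + ∑ j, w j * u (i.succAbove j) := by
      intro w
      simp [PiLp.inner_apply, Fin.sum_univ_succAbove _ i]
    have hZ : volume (Z i s) = 0 := by
      by_cases hu' : ∃ j, u (i.succAbove j) ≠ 0
      · obtain ⟨j, hj⟩ := hu'
        let f : (Fin m → ℝ) →ₗ[ℝ] ℝ := ∑ k, u (i.succAbove k) • LinearMap.proj k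
        have hf : ∀ w, f w = ∑ k, w k * u (i.succAbove k) := by
          intro w; simp [f, mul_comm]
        let P : AffineSubspace ℝ (Fin m → ℝ) :=
          (AffineSubspace.mk' (-(s * u i)) ⊥ : AffineSubspace ℝ ℝ).comap f.toAffineMap
        have hP : Z i s = P := by
          ext w
          simp only [Z, Set.mem_ofPred_eq, hform, P, SetLike.mem_coe, AffineSubspace.mem_comap,
            AffineSubspace.mem_mk', LinearMap.coe_toAffineMap, hf, Submodule.mem_bot, vsub_eq_sub]
          constructor <;> intro h <;> linarith
        rw [hP]
        refine Measure.addHaar_affineSubspace _ _ fun htop => ?_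
        have hall : ∀ w, w ∈ Z i s := fun w => by rw [hP, htop]; trivial
        have h0 := hall 0
        have h1 := hall (Pi.single j 1)
        simp only [Z, Set.mem_ofPred_eq, hform] at h0 h1
        simp [Pi.single_apply] at h0 h1
        rw [show s * u i = 0 by rcases h0 with h | h <;> simp [h]] at h1
        exact hj (by linarith)
      · push Not at hu'
        have hui : u i ≠ 0 := by
          intro h0
          apply hu
          ext j
          exact Fin.succAboveCases i (by simpa using h0) (fun k => by simpa using hu' k) j
        have : Z i s = ∅ := by
          ext w
          simp only [Z, Set.mem_ofPred_eq, hform, Set.mem_empty_iff_false, iff_false]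
          simp only [hu', mul_zero, Finset.sum_const_zero, add_zero]
          have : s ≠ 0 := by rintro rfl; simp at hs
          exact mul_ne_zero this hui
        simp [this]
    have := hK (Z i s)
    rw [hZ, mul_zero] at this
    exact le_antisymm this bot_le
  exact measure_union_null (null 1 (by simp)) (null (-1) (by simp))

theorem hausdorffMeasure_sphere_pos {n : ℕ} (hn : 1 ≤ n) :
    0 < μH[(n : ℝ) - 1] (Metric.sphere (0 : EuclideanSpace ℝ (Fin n)) 1) := by
  obtain ⟨m, rfl⟩ := Nat.exists_eq_add_of_le' hn
  let g : EuclideanSpace ℝ (Fin (m + 1)) → (Fin m → ℝ) := fun x j => x j.succ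
  have hg : LipschitzWith 1 g := LipschitzWith.of_dist_le_mul fun x y => by
    rw [NNReal.coe_one, one_mul]
    refine (dist_pi_le_iff dist_nonneg).2 fun j => ?_
    rw [dist_eq_norm, dist_eq_norm]
    exact PiLp.norm_apply_le (x - y) j.succ
  have hsub : {w : Fin m → ℝ | ∑ j, w j ^ 2 < 1} ⊆
      g '' Metric.sphere (0 : EuclideanSpace ℝ (Fin (m + 1))) 1 := by
    intro w hw
    refine ⟨WithLp.toLp 2 (Fin.cons (√(1 - ∑ j, w j ^ 2)) w), ?_, ?_⟩
    · rw [mem_sphere_zero_iff_norm, EuclideanSpace.norm_eq, Real.sqrt_eq_one, Fin.sum_univ_succ]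
      have : (0 : ℝ) ≤ 1 - ∑ j, w j ^ 2 := by
        have : ∑ j, w j ^ 2 < 1 := hw
        linarith
      simp [Real.sq_sqrt this]
    · ext j; simp [g]
  have hopen : IsOpen {w : Fin m → ℝ | ∑ j, w j ^ 2 < 1} :=
    isOpen_lt (by fun_prop) continuous_const
  have hpos : 0 < volume {w : Fin m → ℝ | ∑ j, w j ^ 2 < 1} :=
    hopen.measure_pos _ ⟨0, by simp⟩
  have h := hg.hausdorffMeasure_image_le (Nat.cast_nonneg m)
    (Metric.sphere (0 : EuclideanSpace ℝ (Fin (m + 1))) 1)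
  have hv : (μH[(m : ℝ)] : Measure (Fin m → ℝ)) = volume := by
    simpa using hausdorffMeasure_pi_real (ι := Fin m)
  rw [hv] at h
  have e : ((m + 1 : ℕ) : ℝ) - 1 = m := by push_cast; ring
  rw [e]
  simpa using hpos.trans_le ((measure_mono hsub).trans h)

theorem sphereHaar_apply {n : ℕ} (A : Set (EuclideanSpace ℝ (Fin n))) :
    sphereHaar n A = ((μH[(n : ℝ) - 1]) (Metric.sphere (0 : EuclideanSpace ℝ (Fin n)) 1))⁻¹ *
      μH[(n : ℝ) - 1] (A ∩ Metric.sphere (0 : EuclideanSpace ℝ (Fin n)) 1) := by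
  rw [sphereHaar, Measure.smul_apply, smul_eq_mul,
    Measure.restrict_apply' Metric.isClosed_sphere.measurableSet]

theorem sphereHaar_inter_sphere {n : ℕ} (A : Set (EuclideanSpace ℝ (Fin n))) :
    sphereHaar n (A ∩ Metric.sphere 0 1) = sphereHaar n A := by
  rw [sphereHaar_apply, sphereHaar_apply, Set.inter_assoc, Set.inter_self]

theorem sphereHaar_sphere {n : ℕ} (hn : 1 ≤ n) :
    sphereHaar n (Metric.sphere 0 1) = 1 := by
  rw [sphereHaar_apply, Set.inter_self]
  exact ENNReal.inv_mul_cancel (hausdorffMeasure_sphere_pos hn).ne'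
    (hausdorffMeasure_sphere_lt_top hn).ne

theorem isProbabilityMeasure_sphereHaar {n : ℕ} (hn : 1 ≤ n) :
    IsProbabilityMeasure (sphereHaar n) := by
  constructor
  rw [← sphereHaar_inter_sphere, Set.univ_inter, sphereHaar_sphere hn]

theorem sphereHaar_preimage {n : ℕ}
    (f : EuclideanSpace ℝ (Fin n) ≃ₗᵢ[ℝ] EuclideanSpace ℝ (Fin n))
    (A : Set (EuclideanSpace ℝ (Fin n))) :
    sphereHaar n (f ⁻¹' A) = sphereHaar n A := by
  have hS : f ⁻¹' A ∩ Metric.sphere 0 1 = f ⁻¹' (A ∩ Metric.sphere 0 1) := by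
    ext x; simp
  rw [sphereHaar_apply, sphereHaar_apply, hS]
  congr 1
  exact f.toIsometryEquiv.hausdorffMeasure_preimage _ _

theorem sphereHaar_neg_preimage {n : ℕ} (A : Set (EuclideanSpace ℝ (Fin n))) :
    sphereHaar n {x | -x ∈ A} = sphereHaar n A :=
  sphereHaar_preimage (LinearIsometryEquiv.neg ℝ) A

theorem sphereHaar_orthogonal {n : ℕ} {u : EuclideanSpace ℝ (Fin n)} (hu : u ≠ 0) :
    sphereHaar n {x | ⟪u, x⟫_ℝ = 0} = 0 := by
  rw [sphereHaar_apply, Set.inter_comm, hausdorffMeasure_sphere_inter_orthogonal hu, mul_zero]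

theorem exists_linearIsometryEquiv_apply_eq {n : ℕ} {u v : EuclideanSpace ℝ (Fin n)}
    (h : ‖u‖ = ‖v‖) :
    ∃ f : EuclideanSpace ℝ (Fin n) ≃ₗᵢ[ℝ] EuclideanSpace ℝ (Fin n), f u = v :=
  ⟨_, Submodule.reflection_sub h⟩

theorem sphereHaar_pos_of_isOpen {n : ℕ} {U : Set (EuclideanSpace ℝ (Fin n))} (hU : IsOpen U)
    {x : EuclideanSpace ℝ (Fin n)} (hx : ‖x‖ = 1) (hxU : x ∈ U) : 0 < sphereHaar n U := by
  have hn : 1 ≤ n := by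
    rcases Nat.eq_zero_or_pos n with rfl | h
    · simp [Subsingleton.elim x 0] at hx
    · exact h
  have := isProbabilityMeasure_sphereHaar hn
  by_contra h0
  have h0 : sphereHaar n U = 0 := by simpa using h0
  have key : ∀ y ∈ Metric.sphere (0 : EuclideanSpace ℝ (Fin n)) 1,
      ∃ t ∈ 𝓝[Metric.sphere (0 : EuclideanSpace ℝ (Fin n)) 1] y, sphereHaar n t = 0 := by
    intro y hy
    obtain ⟨f, hf⟩ := exists_linearIsometryEquiv_apply_eq
      (show ‖y‖ = ‖x‖ by rw [hx]; exact mem_sphere_zero_iff_norm.1 hy)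
    refine ⟨f ⁻¹' U, mem_nhdsWithin_of_mem_nhds ?_, by rw [sphereHaar_preimage, h0]⟩
    exact (hU.preimage f.continuous).mem_nhds (by simpa [hf] using hxU)
  have := measure_null_of_locally_null _ key
  rw [sphereHaar_sphere hn] at this
  exact one_ne_zero this

/-- The negative of the spherical polar: points of the sphere in the dual cone of `A`. -/
def sphericalDual {n : ℕ} (A : Set (EuclideanSpace ℝ (Fin n))) :
    Set (EuclideanSpace ℝ (Fin n)) :=
  {y ∈ Metric.sphere (0 : EuclideanSpace ℝ (Fin n)) 1 | ∀ x ∈ A, 0 ≤ ⟪x, y⟫_ℝ}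

theorem sphereHaar_sphericalPolar {n : ℕ} (A : Set (EuclideanSpace ℝ (Fin n))) :
    sphereHaar n (sphericalPolar A) = sphereHaar n (sphericalDual A) := by
  rw [← sphereHaar_neg_preimage (sphericalDual A)]
  congr 1
  ext y
  simp [sphericalPolar, sphericalDual]

theorem isClosed_sphericalDual {n : ℕ} (A : Set (EuclideanSpace ℝ (Fin n))) :
    IsClosed (sphericalDual A) := by
  have : sphericalDual A = Metric.sphere 0 1 ∩ ⋂ x ∈ A, {y | 0 ≤ ⟪x, y⟫_ℝ} := by
    ext y; simp [sphericalDual]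
  rw [this]
  exact Metric.isClosed_sphere.inter
    (isClosed_biInter fun x _ => isClosed_le continuous_const (by fun_prop))

theorem sphericalDual_anti {n : ℕ} {A B : Set (EuclideanSpace ℝ (Fin n))} (h : A ⊆ B) :
    sphericalDual B ⊆ sphericalDual A :=
  fun _ hy => ⟨hy.1, fun x hx => hy.2 x (h hx)⟩

theorem sphericalDual_closure {n : ℕ} (A : Set (EuclideanSpace ℝ (Fin n))) :
    sphericalDual (closure A) = sphericalDual A := by
  refine (sphericalDual_anti subset_closure).antisymm fun y hy => ⟨hy.1, fun x hx => ?_⟩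
  exact closure_minimal (show A ⊆ {x | 0 ≤ ⟪x, y⟫_ℝ} from fun x hx => hy.2 x hx)
    (isClosed_le continuous_const (by fun_prop)) hx

theorem isCompact_of_isClosed_of_subset_sphere {n : ℕ} {A : Set (EuclideanSpace ℝ (Fin n))}
    (hA : A ⊆ Metric.sphere 0 1) (hc : IsClosed A) : IsCompact A :=
  (isCompact_sphere 0 1).of_isClosed_subset hc hA

/-- The barycentre of a non-null dual set pairs strictly positively with the original set. -/
theorem exists_forall_inner_pos {n : ℕ} (hn : 1 ≤ n) {A : Set (EuclideanSpace ℝ (Fin n))}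
    (hA : A ⊆ Metric.sphere 0 1) (hpos : 0 < sphereHaar n (sphericalDual A)) :
    ∃ b : EuclideanSpace ℝ (Fin n), ∀ x ∈ A, 0 < ⟪x, b⟫_ℝ := by
  have := isProbabilityMeasure_sphereHaar hn
  refine ⟨∫ y in sphericalDual A, y ∂sphereHaar n, fun x hx => ?_⟩
  have hB := (isClosed_sphericalDual A).measurableSet
  have hintegrable : Integrable (fun y => y) ((sphereHaar n).restrict (sphericalDual A)) := by
    refine Integrable.of_bound (by fun_prop) 1 ?_
    refine (ae_restrict_iff' hB).2 (Eventually.of_forall fun y hy => ?_)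
    exact (mem_sphere_zero_iff_norm.1 hy.1).le
  rw [← integral_inner hintegrable x, integral_pos_iff_support_of_nonneg_ae]
  · have hx0 : x ≠ 0 := by
      rintro rfl
      simpa using hA hx
    rw [Measure.restrict_apply' hB, pos_iff_ne_zero]
    intro h0
    refine hpos.ne' (measure_mono_null (t := (Function.support (fun y => ⟪x, y⟫_ℝ) ∩
      sphericalDual A) ∪ {y | ⟪x, y⟫_ℝ = 0}) (fun y hy => ?_)
      (measure_union_null h0 (sphereHaar_orthogonal hx0)))
    by_cases h : ⟪x, y⟫_ℝ = 0
    · exact Or.inr h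
    · exact Or.inl ⟨h, hy⟩
  · exact (ae_restrict_iff' hB).2 (Eventually.of_forall fun y hy => hy.2 x hx)
  · exact hintegrable.const_inner x

/-- The reflection in the hyperplane orthogonal to `u`. -/
def hyperplaneReflection {n : ℕ} (u : EuclideanSpace ℝ (Fin n)) :
    EuclideanSpace ℝ (Fin n) ≃ₗᵢ[ℝ] EuclideanSpace ℝ (Fin n) :=
  (ℝ ∙ u)ᗮ.reflection

theorem hyperplaneReflection_apply {n : ℕ} (u x : EuclideanSpace ℝ (Fin n)) :
    hyperplaneReflection u x = x - (2 * ⟪u, x⟫_ℝ / ‖u‖ ^ 2) • u := by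
  rw [hyperplaneReflection, Submodule.reflection_orthogonal_apply,
    Submodule.reflection_singleton_apply]
  simp only [RCLike.ofReal_real_eq_id, id]
  module

theorem hyperplaneReflection_involutive {n : ℕ} (u x : EuclideanSpace ℝ (Fin n)) :
    hyperplaneReflection u (hyperplaneReflection u x) = x :=
  Submodule.reflection_reflection _ x

theorem inner_hyperplaneReflection_left {n : ℕ} (u x y : EuclideanSpace ℝ (Fin n)) :
    ⟪hyperplaneReflection u x, y⟫_ℝ = ⟪x, hyperplaneReflection u y⟫_ℝ := by
  rw [← (hyperplaneReflection u).inner_map_map, hyperplaneReflection_involutive]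

theorem inner_self_hyperplaneReflection {n : ℕ} (u x : EuclideanSpace ℝ (Fin n)) :
    ⟪u, hyperplaneReflection u x⟫_ℝ = -⟪u, x⟫_ℝ := by
  rw [← inner_hyperplaneReflection_left, hyperplaneReflection,
    Submodule.reflection_orthogonalComplement_singleton_eq_neg, inner_neg_left]

theorem inner_hyperplaneReflection_right {n : ℕ} (u x y : EuclideanSpace ℝ (Fin n)) :
    ⟪x, hyperplaneReflection u y⟫_ℝ = ⟪x, y⟫_ℝ - 2 * ⟪u, x⟫_ℝ * ⟪u, y⟫_ℝ / ‖u‖ ^ 2 := by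
  rw [hyperplaneReflection_apply, inner_sub_right, inner_smul_right, real_inner_comm u x]
  ring

theorem hyperplaneReflection_of_inner_eq_zero {n : ℕ} {u x : EuclideanSpace ℝ (Fin n)}
    (h : ⟪u, x⟫_ℝ = 0) : hyperplaneReflection u x = x := by
  simp [hyperplaneReflection_apply, h]

theorem hyperplaneReflection_sub {n : ℕ} {x y : EuclideanSpace ℝ (Fin n)} (h : ‖x‖ = ‖y‖) :
    hyperplaneReflection (x - y) x = y :=
  Submodule.reflection_sub h

/-- The two-point symmetrization of `A` towards the half-space `{x | 0 ≤ ⟪u, x⟫}`. -/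
def polarization {n : ℕ} (u : EuclideanSpace ℝ (Fin n)) (A : Set (EuclideanSpace ℝ (Fin n))) :
    Set (EuclideanSpace ℝ (Fin n)) :=
  {x | (0 ≤ ⟪u, x⟫_ℝ ∧ (x ∈ A ∨ hyperplaneReflection u x ∈ A)) ∨
    (⟪u, x⟫_ℝ ≤ 0 ∧ x ∈ A ∧ hyperplaneReflection u x ∈ A)}

theorem isClosed_polarization {n : ℕ} (u : EuclideanSpace ℝ (Fin n))
    {A : Set (EuclideanSpace ℝ (Fin n))} (hA : IsClosed A) : IsClosed (polarization u A) := by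
  have h1 : IsClosed (hyperplaneReflection u ⁻¹' A) :=
    hA.preimage (hyperplaneReflection u).continuous
  have h2 : IsClosed {x : EuclideanSpace ℝ (Fin n) | 0 ≤ ⟪u, x⟫_ℝ} :=
    isClosed_le continuous_const (by fun_prop)
  have h3 : IsClosed {x : EuclideanSpace ℝ (Fin n) | ⟪u, x⟫_ℝ ≤ 0} :=
    isClosed_le (by fun_prop) continuous_const
  exact (h2.inter (hA.union h1)).union (h3.inter (hA.inter h1))

theorem polarization_subset_sphere {n : ℕ} (u : EuclideanSpace ℝ (Fin n))
    {A : Set (EuclideanSpace ℝ (Fin n))} (hA : A ⊆ Metric.sphere 0 1) :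
    polarization u A ⊆ Metric.sphere 0 1 := by
  rintro x (⟨-, h | h⟩ | ⟨-, h, -⟩)
  · exact hA h
  · simpa using hA h
  · exact hA h

theorem polarization_nonempty {n : ℕ} (u : EuclideanSpace ℝ (Fin n))
    {A : Set (EuclideanSpace ℝ (Fin n))} (hA : A.Nonempty) : (polarization u A).Nonempty := by
  obtain ⟨x, hx⟩ := hA
  rcases le_total 0 ⟪u, x⟫_ℝ with h | h
  · exact ⟨x, Or.inl ⟨h, Or.inl hx⟩⟩
  · refine ⟨hyperplaneReflection u x, Or.inl ⟨?_, Or.inr ?_⟩⟩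
    · rw [inner_self_hyperplaneReflection]; linarith
    · rwa [hyperplaneReflection_involutive]

theorem inner_nonneg_of_mem_polarization {n : ℕ} (u : EuclideanSpace ℝ (Fin n))
    {A B : Set (EuclideanSpace ℝ (Fin n))} (h : ∀ x ∈ A, ∀ y ∈ B, 0 ≤ ⟪x, y⟫_ℝ) :
    ∀ x ∈ polarization u A, ∀ y ∈ polarization u B, 0 ≤ ⟪x, y⟫_ℝ := by
  have key : ∀ {x y : EuclideanSpace ℝ (Fin n)}, 0 ≤ ⟪u, x⟫_ℝ → 0 ≤ ⟪u, y⟫_ℝ →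
      0 ≤ ⟪x, hyperplaneReflection u y⟫_ℝ → 0 ≤ ⟪x, y⟫_ℝ := by
    intro x y hx hy hxy
    rw [inner_hyperplaneReflection_right] at hxy
    have : 0 ≤ 2 * ⟪u, x⟫_ℝ * ⟪u, y⟫_ℝ / ‖u‖ ^ 2 := by positivity
    linarith
  have hmap := fun x y => (hyperplaneReflection u).inner_map_map x y
  rintro x (⟨hx, hx'⟩ | ⟨hx, hx', hx''⟩) y (⟨hy, hy'⟩ | ⟨hy, hy', hy''⟩)
  · rcases hx' with hx' | hx' <;> rcases hy' with hy' | hy'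
    · exact h x hx' y hy'
    · exact key hx hy (h x hx' _ hy')
    · exact key hx hy (by rw [← inner_hyperplaneReflection_left]; exact h _ hx' y hy')
    · rw [← hmap]; exact h _ hx' _ hy'
  · rcases hx' with hx' | hx'
    · exact h x hx' y hy'
    · rw [← hmap]; exact h _ hx' _ hy''
  · rcases hy' with hy' | hy'
    · exact h x hx' y hy'
    · rw [← hmap]; exact h _ hx'' _ hy'
  · exact h x hx' y hy'

theorem sphereHaar_eq_add_halfSpaces {n : ℕ} {u : EuclideanSpace ℝ (Fin n)} (hu : u ≠ 0)
    (A : Set (EuclideanSpace ℝ (Fin n))) :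
    sphereHaar n A = sphereHaar n (A ∩ {x | 0 < ⟪u, x⟫_ℝ}) +
      sphereHaar n (A ∩ {x | ⟪u, x⟫_ℝ < 0}) := by
  have hP : MeasurableSet {x : EuclideanSpace ℝ (Fin n) | 0 < ⟪u, x⟫_ℝ} :=
    (isOpen_lt continuous_const (by fun_prop)).measurableSet
  rw [← measure_inter_add_sdiff A hP]
  congr 1
  refine le_antisymm ?_ (measure_mono fun x hx => ⟨hx.1, fun h => ?_⟩)
  swap
  · rw [Set.mem_ofPred_eq] at h
    exact lt_asymm h hx.2
  calc sphereHaar n (A \ {x | 0 < ⟪u, x⟫_ℝ})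
      ≤ sphereHaar n ((A ∩ {x | ⟪u, x⟫_ℝ < 0}) ∪ {x | ⟪u, x⟫_ℝ = 0}) := by
        refine measure_mono fun x hx => ?_
        have hx' : ¬ 0 < ⟪u, x⟫_ℝ := hx.2
        rcases (not_lt.1 hx').lt_or_eq with h | h
        · exact Or.inl ⟨hx.1, h⟩
        · exact Or.inr h
    _ ≤ _ := (measure_union_le _ _).trans (by rw [sphereHaar_orthogonal hu, add_zero])

theorem sphereHaar_polarization {n : ℕ} {u : EuclideanSpace ℝ (Fin n)} (hu : u ≠ 0)
    {A : Set (EuclideanSpace ℝ (Fin n))} (hA : MeasurableSet A) :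
    sphereHaar n (polarization u A) = sphereHaar n A := by
  have hP : MeasurableSet {x : EuclideanSpace ℝ (Fin n) | 0 < ⟪u, x⟫_ℝ} :=
    (isOpen_lt continuous_const (by fun_prop)).measurableSet
  set R := hyperplaneReflection u
  have hRA : MeasurableSet (R ⁻¹' A) := R.continuous.measurable hA
  have hflip : ∀ x, ⟪u, R x⟫_ℝ = -⟪u, x⟫_ℝ := inner_self_hyperplaneReflection u
  have hinv : ∀ x, R (R x) = x := hyperplaneReflection_involutive u
  rw [sphereHaar_eq_add_halfSpaces hu, sphereHaar_eq_add_halfSpaces hu A]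
  have e1 : polarization u A ∩ {x | 0 < ⟪u, x⟫_ℝ} =
      (A ∩ {x | 0 < ⟪u, x⟫_ℝ}) ∪ (R ⁻¹' A ∩ {x | 0 < ⟪u, x⟫_ℝ}) := by
    ext x
    simp only [polarization, Set.mem_inter_iff, Set.mem_union, Set.mem_ofPred_eq,
      Set.mem_preimage]
    constructor
    · rintro ⟨⟨-, h | h⟩ | ⟨h, -⟩, hx⟩
      · exact Or.inl ⟨h, hx⟩
      · exact Or.inr ⟨h, hx⟩
      · exact absurd hx (not_lt.2 h)
    · rintro (⟨h, hx⟩ | ⟨h, hx⟩)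
      · exact ⟨Or.inl ⟨hx.le, Or.inl h⟩, hx⟩
      · exact ⟨Or.inl ⟨hx.le, Or.inr h⟩, hx⟩
  have e2 : R ⁻¹' (polarization u A ∩ {x | ⟪u, x⟫_ℝ < 0}) =
      (A ∩ {x | 0 < ⟪u, x⟫_ℝ}) ∩ (R ⁻¹' A ∩ {x | 0 < ⟪u, x⟫_ℝ}) := by
    ext x
    have hx' := hflip x
    simp only [polarization, Set.mem_inter_iff, Set.mem_ofPred_eq, Set.mem_preimage]
    rw [hflip, show hyperplaneReflection u (R x) = x from hinv x]
    constructor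
    · rintro ⟨⟨h, -⟩ | ⟨-, h1, h2⟩, hx⟩
      · linarith
      · exact ⟨⟨h2, by linarith⟩, h1, by linarith⟩
    · rintro ⟨⟨h1, hx⟩, h2, -⟩
      exact ⟨Or.inr ⟨by linarith, h2, h1⟩, by linarith⟩
  have e3 : R ⁻¹' (A ∩ {x | ⟪u, x⟫_ℝ < 0}) = R ⁻¹' A ∩ {x | 0 < ⟪u, x⟫_ℝ} := by
    ext x
    simp [hflip]
  rw [← sphereHaar_preimage R (polarization u A ∩ {x | ⟪u, x⟫_ℝ < 0}), e1, e2,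
    measure_union_add_inter _ (hRA.inter hP), ← e3, sphereHaar_preimage]

theorem isOpen_setOf_forall_inner_pos {n : ℕ} {K : Set (EuclideanSpace ℝ (Fin n))}
    (hK : IsCompact K) : IsOpen {w : EuclideanSpace ℝ (Fin n) | ∀ z ∈ K, 0 < ⟪z, w⟫_ℝ} := by
  rw [isOpen_iff_mem_nhds]
  intro w hw
  refine hK.eventually_forall_of_forall_eventually fun z hz => ?_
  have : ContinuousAt (fun p : EuclideanSpace ℝ (Fin n) × EuclideanSpace ℝ (Fin n) =>
      ⟪p.2, p.1⟫_ℝ) (w, z) := by fun_prop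
  exact this.eventually (lt_mem_nhds (hw z hz))

theorem norm_cos_smul_add_sin_smul {n : ℕ} {x y : EuclideanSpace ℝ (Fin n)} (hx : ‖x‖ = 1)
    (hy : ‖y‖ = 1) (hxy : ⟪x, y⟫_ℝ = 0) (t : ℝ) :
    ‖Real.cos t • x + Real.sin t • y‖ = 1 := by
  have : ‖Real.cos t • x + Real.sin t • y‖ ^ 2 = 1 := by
    rw [norm_add_sq_real, norm_smul, norm_smul, inner_smul_left, inner_smul_right, hxy, hx, hy]
    simp
  exact (pow_eq_one_iff_of_nonneg (norm_nonneg _) two_ne_zero).1 this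

/-- A unit vector orthogonal to `x` is a limit of unit vectors pairing negatively with `x`. -/
theorem exists_mem_inner_neg {n : ℕ} {x y : EuclideanSpace ℝ (Fin n)} (hx : ‖x‖ = 1)
    (hy : ‖y‖ = 1) (hxy : ⟪x, y⟫_ℝ = 0) {U : Set (EuclideanSpace ℝ (Fin n))} (hU : IsOpen U)
    (hyU : y ∈ U) : ∃ w ∈ U, ‖w‖ = 1 ∧ ⟪x, w⟫_ℝ < 0 := by
  have hcont : ContinuousAt (fun t : ℝ => Real.cos t • y + Real.sin t • (-x)) 0 := by fun_prop
  have h1 : ∀ᶠ t in 𝓝[>] (0 : ℝ), Real.cos t • y + Real.sin t • (-x) ∈ U :=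
    (hcont.eventually (hU.mem_nhds (by simpa using hyU))).filter_mono nhdsWithin_le_nhds
  have h2 : ∀ᶠ t in 𝓝[>] (0 : ℝ), t ∈ Set.Ioo 0 Real.pi := Ioo_mem_nhdsGT Real.pi_pos
  obtain ⟨t, ht, ht'⟩ := (h1.and h2).exists
  refine ⟨_, ht, norm_cos_smul_add_sin_smul hy (by simpa using hx) ?_ t, ?_⟩
  · rw [inner_neg_right, real_inner_comm, hxy, neg_zero]
  · rw [inner_add_right, inner_smul_right, inner_smul_right, hxy, inner_neg_right,
      real_inner_self_eq_norm_sq, hx]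
    have := Real.sin_pos_of_mem_Ioo ht'
    simpa using this

/-- `A` maximizes the measure of the spherical dual among the nonempty closed subsets of the sphere
having at least the measure of `A`. -/
def IsDualMaximal {n : ℕ} (A : Set (EuclideanSpace ℝ (Fin n))) : Prop :=
  ∀ A' : Set (EuclideanSpace ℝ (Fin n)), A' ⊆ Metric.sphere 0 1 → IsClosed A' → A'.Nonempty →
    sphereHaar n A ≤ sphereHaar n A' →
      sphereHaar n (sphericalDual A') ≤ sphereHaar n (sphericalDual A)

/-- `x` is the only point of `A` orthogonal to the point `y` of the spherical dual of `A`. -/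
structure IsUniqueContact {n : ℕ} (A : Set (EuclideanSpace ℝ (Fin n)))
    (y x : EuclideanSpace ℝ (Fin n)) : Prop where
  mem_dual : y ∈ sphericalDual A
  mem : x ∈ A
  inner_eq_zero : ⟪x, y⟫_ℝ = 0
  unique : ∀ z ∈ A, ⟪z, y⟫_ℝ = 0 → z = x

theorem IsUniqueContact.norm_left {n : ℕ} {A : Set (EuclideanSpace ℝ (Fin n))}
    {y x : EuclideanSpace ℝ (Fin n)} (h : IsUniqueContact A y x) : ‖y‖ = 1 :=
  mem_sphere_zero_iff_norm.1 h.mem_dual.1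

theorem IsDualMaximal.reflection_mem {n : ℕ} {A : Set (EuclideanSpace ℝ (Fin n))}
    (hA : A ⊆ Metric.sphere 0 1) (hc : IsClosed A) (hmax : IsDualMaximal A)
    {y x u : EuclideanSpace ℝ (Fin n)} (h : IsUniqueContact A y x) (huy : 0 < ⟪u, y⟫_ℝ)
    (hux : ⟪u, x⟫_ℝ < 0) :
    hyperplaneReflection u x ∈ A ∨ hyperplaneReflection u y ∈ sphericalDual A := by
  by_contra! hcon
  obtain ⟨hx', hy'⟩ := hcon
  have hu : u ≠ 0 := by rintro rfl; simp at huy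
  have hx1 : ‖x‖ = 1 := mem_sphere_zero_iff_norm.1 (hA h.mem)
  have hy1 := h.norm_left
  have hn : 1 ≤ n := by
    rcases Nat.eq_zero_or_pos n with rfl | h
    · simp [Subsingleton.elim x 0] at hx1
    · exact h
  have := isProbabilityMeasure_sphereHaar hn
  have hc' := isClosed_polarization u hc
  have hA' := polarization_subset_sphere u hA
  have hB := isClosed_sphericalDual A
  have hB' := isClosed_polarization u hB
  have hpair := inner_nonneg_of_mem_polarization u
    (A := A) (B := sphericalDual A) (fun x hx y hy => hy.2 x hx)
  have hpos : ∀ z ∈ polarization u A, 0 < ⟪z, y⟫_ℝ := by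
    intro z hz
    refine lt_of_le_of_ne (hpair z hz y (Or.inl ⟨huy.le, Or.inl h.mem_dual⟩)) fun h0 => ?_
    rcases hz with ⟨hz, hz' | hz'⟩ | ⟨hz, hz', hz''⟩
    · rw [h.unique z hz' h0.symm] at hz
      linarith
    · have h1 := h.mem_dual.2 _ hz'
      rw [inner_hyperplaneReflection_left, inner_hyperplaneReflection_right, ← h0] at h1
      have huz : ⟪u, z⟫_ℝ = 0 := by
        by_contra hne
        have : 0 < ⟪u, z⟫_ℝ := lt_of_le_of_ne hz (Ne.symm hne)
        have : 0 < 2 * ⟪u, z⟫_ℝ * ⟪u, y⟫_ℝ / ‖u‖ ^ 2 := by positivity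
        linarith
      rw [hyperplaneReflection_of_inner_eq_zero huz] at hz'
      rw [h.unique z hz' h0.symm] at huz
      linarith
    · rw [h.unique z hz' h0.symm] at hz''
      exact hx' hz''
  have hV := isOpen_setOf_forall_inner_pos (isCompact_of_isClosed_of_subset_sphere hA' hc')
  obtain ⟨w, ⟨hwV, hwR⟩, hw1, hwx⟩ := exists_mem_inner_neg hx1 hy1 h.inner_eq_zero
    (hV.inter (hB.isOpen_compl.preimage (hyperplaneReflection u).continuous)) ⟨hpos, hy'⟩
  have hwB : w ∉ sphericalDual A := fun hw => absurd (hw.2 x h.mem) (not_le.2 hwx)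
  have hwB' : w ∉ polarization u (sphericalDual A) := by
    rintro (⟨-, h | h⟩ | ⟨-, h, -⟩)
    · exact hwB h
    · exact hwR h
    · exact hwB h
  have hOpos := sphereHaar_pos_of_isOpen (hV.inter hB'.isOpen_compl) hw1 ⟨hwV, hwB'⟩
  have hle : sphereHaar n (polarization u (sphericalDual A)) +
      sphereHaar n ({w | ∀ z ∈ polarization u A, 0 < ⟪z, w⟫_ℝ} ∩
        (polarization u (sphericalDual A))ᶜ) ≤ sphereHaar n (sphericalDual (polarization u A)) := by
    rw [← sphereHaar_inter_sphere (_ ∩ _), ← measure_union' _ hB'.measurableSet]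
    · refine measure_mono ?_
      rintro v (hv | ⟨⟨hv, -⟩, hv'⟩)
      · exact ⟨polarization_subset_sphere u (fun _ h => h.1) hv, fun z hz => hpair z hz v hv⟩
      · exact ⟨hv', fun z hz => (hv z hz).le⟩
    · exact Set.disjoint_left.2 fun v hv hv' => hv'.1.2 hv
  have hm := hmax _ hA' hc' (polarization_nonempty u ⟨x, h.mem⟩)
    (sphereHaar_polarization hu hc.measurableSet).ge
  rw [sphereHaar_polarization hu hB.measurableSet] at hle
  have := (ENNReal.lt_add_right (measure_ne_top (sphereHaar n) (sphericalDual A)) hOpos.ne').trans_le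
    (hle.trans hm)
  exact lt_irrefl _ this

theorem IsDualMaximal.exists_sub_eq_smul {n : ℕ} {A : Set (EuclideanSpace ℝ (Fin n))}
    (hA : A ⊆ Metric.sphere 0 1) (hc : IsClosed A) (hmax : IsDualMaximal A)
    {y₁ x₁ y₂ x₂ : EuclideanSpace ℝ (Fin n)} (h₁ : IsUniqueContact A y₁ x₁)
    (h₂ : IsUniqueContact A y₂ x₂) (hne : y₁ ≠ y₂) :
    ∃ l : ℝ, 0 ≤ l ∧ x₁ - x₂ = l • (y₂ - y₁) := by
  by_cases hx : x₁ = x₂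
  · exact ⟨0, le_rfl, by simp [hx]⟩
  have hpos : 0 < ⟪x₁, y₂⟫_ℝ :=
    lt_of_le_of_ne (h₂.mem_dual.2 x₁ h₁.mem) fun h0 => hx (h₂.unique x₁ h₁.mem h0.symm)
  have hn1 := h₁.norm_left
  have hn2 := h₂.norm_left
  have hsub : y₁ - y₂ ≠ 0 := sub_ne_zero.2 hne
  have hmem : hyperplaneReflection (y₁ - y₂) x₁ ∈ A := by
    by_contra hnot
    have hev1 : ∀ᶠ w in 𝓝 y₂, hyperplaneReflection (y₁ - w) x₁ ∈ Aᶜ := by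
      have hcont : ContinuousAt (fun w => hyperplaneReflection (y₁ - w) x₁) y₂ := by
        simp only [hyperplaneReflection_apply]
        have : ‖y₁ - y₂‖ ^ 2 ≠ 0 := by positivity
        fun_prop (disch := assumption)
      exact hcont.eventually (hc.isOpen_compl.mem_nhds hnot)
    have hev2 : ∀ᶠ w in 𝓝 y₂, 0 < ⟪x₁, w⟫_ℝ :=
      (show ContinuousAt (fun w => ⟪x₁, w⟫_ℝ) y₂ by fun_prop).eventually (lt_mem_nhds hpos)
    have hev3 : ∀ᶠ w in 𝓝 y₂, ⟪y₁, w⟫_ℝ < 1 :=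
      (show ContinuousAt (fun w => ⟪y₁, w⟫_ℝ) y₂ by fun_prop).eventually
        (gt_mem_nhds ((inner_lt_one_iff_real_of_norm_eq_one hn1 hn2).2 hne))
    obtain ⟨U, hU, hUo, hyU⟩ := mem_nhds_iff.1 (hev1.and (hev2.and hev3))
    obtain ⟨w, hwU, hw1, hxw⟩ := exists_mem_inner_neg
      (mem_sphere_zero_iff_norm.1 (hA h₂.mem)) hn2 h₂.inner_eq_zero hUo hyU
    obtain ⟨hw2, hw3, hw4⟩ := hU hwU
    have := hmax.reflection_mem hA hc h₁ (u := y₁ - w)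
      (by rw [inner_sub_left, real_inner_self_eq_norm_sq, hn1, real_inner_comm]; linarith)
      (by rw [inner_sub_left, real_inner_comm, h₁.inner_eq_zero, real_inner_comm]; linarith)
    rcases this with h | h
    · exact hw2 h
    · rw [hyperplaneReflection_sub (by rw [hn1, hw1])] at h
      exact absurd (h.2 x₂ h₂.mem) (not_le.2 hxw)
  have hrefl : hyperplaneReflection (y₁ - y₂) y₂ = y₁ := by
    have := hyperplaneReflection_involutive (y₁ - y₂) y₁
    rwa [hyperplaneReflection_sub (by rw [hn1, hn2])] at this
  have heq := h₂.unique _ hmem (by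
    rw [inner_hyperplaneReflection_left, hrefl, h₁.inner_eq_zero])
  refine ⟨2 * ⟪x₁, y₂⟫_ℝ / ‖y₁ - y₂‖ ^ 2, by positivity, ?_⟩
  rw [← heq, hyperplaneReflection_apply, inner_sub_left, real_inner_comm, h₁.inner_eq_zero,
    real_inner_comm]
  module

theorem eq_zero_of_smul_sub_eq_smul_sub {n : ℕ} {y₁ y₂ y₃ : EuclideanSpace ℝ (Fin n)}
    (h₁ : ‖y₁‖ = 1) (h₂ : ‖y₂‖ = 1) (h₃ : ‖y₃‖ = 1) (h₁₂ : y₁ ≠ y₂) (h₁₃ : y₁ ≠ y₃)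
    (h₂₃ : y₂ ≠ y₃) {a b : ℝ} (h : a • (y₃ - y₁) = b • (y₂ - y₁)) : a = 0 ∧ b = 0 := by
  have hp : y₃ - y₁ ≠ 0 := sub_ne_zero.2 h₁₃.symm
  have hb : b = 0 := by
    by_contra hb
    have hq : y₂ - y₁ = (b⁻¹ * a) • (y₃ - y₁) := by
      rw [mul_smul, h, smul_smul, inv_mul_cancel₀ hb, one_smul]
    set k := b⁻¹ * a
    have e2 : y₂ = y₁ + k • (y₃ - y₁) := by rw [← hq]; abel
    have e3 : y₃ = y₁ + (y₃ - y₁) := by abel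
    have n2 : ‖y₁ + k • (y₃ - y₁)‖ ^ 2 = 1 := by rw [← e2, h₂]; norm_num
    have n3 : ‖y₁ + (y₃ - y₁)‖ ^ 2 = 1 := by rw [← e3, h₃]; norm_num
    rw [norm_add_sq_real, h₁, norm_smul, inner_smul_right, Real.norm_eq_abs, mul_pow, sq_abs] at n2
    rw [norm_add_sq_real, h₁] at n3
    have hpp : ‖y₃ - y₁‖ ^ 2 ≠ 0 := by positivity
    have : k * (k - 1) = 0 := by
      have : k * (k - 1) * ‖y₃ - y₁‖ ^ 2 = 0 := by linear_combination n2 - k * n3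
      exact (mul_eq_zero.1 this).resolve_right hpp
    rcases mul_eq_zero.1 this with hk | hk
    · apply h₁₂; rw [e2, hk]; simp
    · apply h₂₃; rw [e2, show k = 1 by linarith]; simp
  refine ⟨?_, hb⟩
  rw [hb, zero_smul] at h
  exact (smul_eq_zero.1 h).resolve_right hp

theorem IsDualMaximal.exists_centre {n : ℕ} {A : Set (EuclideanSpace ℝ (Fin n))}
    (hA : A ⊆ Metric.sphere 0 1) (hc : IsClosed A) (hmax : IsDualMaximal A) :
    ∃ (e : EuclideanSpace ℝ (Fin n)) (l : ℝ), 0 ≤ l ∧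
      ∀ y x, IsUniqueContact A y x → x = e - l • y := by
  by_cases h : ∃ y₁ x₁ y₂ x₂, IsUniqueContact A y₁ x₁ ∧ IsUniqueContact A y₂ x₂ ∧ y₁ ≠ y₂
  · obtain ⟨y₁, x₁, y₂, x₂, h₁, h₂, h₁₂⟩ := h
    obtain ⟨l, hl, hxl⟩ := hmax.exists_sub_eq_smul hA hc h₁ h₂ h₁₂
    refine ⟨x₁ + l • y₁, l, hl, fun y₃ x₃ h₃ => ?_⟩
    by_cases h₁₃ : y₁ = y₃
    · subst h₁₃
      rw [h₁.unique x₃ h₃.mem h₃.inner_eq_zero]; abel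
    by_cases h₂₃ : y₂ = y₃
    · subst h₂₃
      rw [h₂.unique x₃ h₃.mem h₃.inner_eq_zero, ← sub_eq_zero]
      rw [← sub_eq_zero] at hxl
      rw [← neg_eq_zero, ← hxl]; module
    obtain ⟨r, -, hxr⟩ := hmax.exists_sub_eq_smul hA hc h₁ h₃ h₁₃
    obtain ⟨s, -, hxs⟩ := hmax.exists_sub_eq_smul hA hc h₂ h₃ h₂₃
    have key : (r - s) • (y₃ - y₁) = (l - s) • (y₂ - y₁) := by
      have : r • (y₃ - y₁) = l • (y₂ - y₁) + s • (y₃ - y₂) := by rw [← hxr, ← hxl, ← hxs]; abel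
      rw [sub_smul, this]; module
    obtain ⟨hr, hs⟩ := eq_zero_of_smul_sub_eq_smul_sub h₁.norm_left h₂.norm_left h₃.norm_left
      h₁₂ h₁₃ h₂₃ key
    have hrl : r = l := by linarith
    rw [hrl, ← sub_eq_zero] at hxr
    rw [← sub_eq_zero, ← neg_eq_zero, ← hxr]; module
  · push Not at h
    by_cases h' : ∃ y₁ x₁, IsUniqueContact A y₁ x₁
    · obtain ⟨y₁, x₁, h₁⟩ := h'
      refine ⟨x₁, 0, le_rfl, fun y x hyx => ?_⟩
      obtain rfl := h y₁ x₁ y x h₁ hyx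
      rw [h₁.unique x hyx.mem hyx.inner_eq_zero]; simp
    · push Not at h'
      exact ⟨0, 0, le_rfl, fun y x hyx => absurd hyx (h' y x)⟩

/-- A spherical cap inside an open hemisphere with a common boundary point determines the
centre of the hemisphere. -/
theorem eq_of_forall_inner_pos {n : ℕ} {x y z : EuclideanSpace ℝ (Fin n)} (hx : ‖x‖ = 1)
    (hy : ‖y‖ = 1) (hz : ‖z‖ = 1) (hyz : y ≠ z) (hc : 0 ≤ ⟪y, z⟫_ℝ) (hxy : ⟪x, y⟫_ℝ = 0)
    (h : ∀ w, ⟪y, z⟫_ℝ * ‖w‖ < ⟪w, z⟫_ℝ → 0 < ⟪x, w⟫_ℝ) :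
    x = ‖z - ⟪y, z⟫_ℝ • y‖⁻¹ • (z - ⟪y, z⟫_ℝ • y) := by
  set c := ⟪y, z⟫_ℝ with hcdef
  have hc1 : c < 1 := (inner_lt_one_iff_real_of_norm_eq_one hy hz).2 hyz
  set k := ‖z - c • y‖ with hk
  have hk2 : k ^ 2 = 1 - c ^ 2 := by
    rw [hk, norm_sub_sq_real, norm_smul, inner_smul_right, real_inner_comm, ← hcdef, hz, hy,
      Real.norm_eq_abs, mul_one, sq_abs]
    ring
  have hkpos : 0 < k := by
    refine lt_of_le_of_ne (norm_nonneg _) fun h0 => ?_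
    rw [← h0] at hk2
    nlinarith
  set m := k⁻¹ • (z - c • y) with hm
  have hm1 : ‖m‖ = 1 := by
    rw [hm, norm_smul, norm_inv, Real.norm_eq_abs, abs_of_pos hkpos, ← hk, inv_mul_cancel₀ hkpos.ne']
  have hzm : z = k • m + c • y := by
    rw [hm, smul_smul, mul_inv_cancel₀ hkpos.ne', one_smul]; abel
  have hmy : ⟪m, y⟫_ℝ = 0 := by
    rw [hm, inner_smul_left, inner_sub_left, inner_smul_left, real_inner_comm, ← hcdef,
      real_inner_self_eq_norm_sq, hy]
    simp
  by_contra hne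
  have hd : ⟪x, m⟫_ℝ < 1 := (inner_lt_one_iff_real_of_norm_eq_one hx hm1).2 hne
  have hvv : ‖m - x‖ ^ 2 = 2 * (1 - ⟪x, m⟫_ℝ) := by
    rw [norm_sub_sq_real, hm1, hx, real_inner_comm]; ring
  have hyv : ⟪y, m - x⟫_ℝ = 0 := by
    rw [inner_sub_right, real_inner_comm, hmy, real_inner_comm, hxy, sub_zero]
  have hw := h (y + (k / 2) • (m - x)) ?_
  · rw [inner_add_right, inner_smul_right, inner_sub_right, hxy, real_inner_self_eq_norm_sq, hx] at hw
    nlinarith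
  · have hwz : ⟪y + (k / 2) • (m - x), z⟫_ℝ = c + k / 2 * (k * (1 - ⟪x, m⟫_ℝ)) := by
      have h1 : ⟪m - x, z⟫_ℝ = k * (1 - ⟪x, m⟫_ℝ) := by
        have hmm : ⟪m - x, m⟫_ℝ = 1 - ⟪x, m⟫_ℝ := by
          rw [inner_sub_left, real_inner_self_eq_norm_sq, hm1, one_pow]
        have hmy' : ⟪m - x, y⟫_ℝ = 0 := by rw [real_inner_comm, hyv]
        have : ⟪m - x, z⟫_ℝ = ⟪m - x, k • m + c • y⟫_ℝ := by rw [← hzm]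
        rw [this, inner_add_right, inner_smul_right _ m, inner_smul_right _ y, hmm, hmy']
        ring
      rw [inner_add_left, inner_smul_left, h1]
      simp [hcdef]
    have hwn : ‖y + (k / 2) • (m - x)‖ ≤ 1 + k ^ 2 / 4 * (1 - ⟪x, m⟫_ℝ) := by
      refine abs_le_of_sq_le_sq' ?_ ?_ |>.2
      · rw [norm_add_sq_real, inner_smul_right, hyv, norm_smul, mul_pow, hvv, hy,
          Real.norm_eq_abs, sq_abs]
        nlinarith [sq_nonneg (k ^ 2 / 4 * (1 - ⟪x, m⟫_ℝ))]
      · have : 0 ≤ 1 - ⟪x, m⟫_ℝ := by linarith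
        positivity
    rw [hwz]
    have h2 : 0 < k ^ 2 * (1 - ⟪x, m⟫_ℝ) := by
      have : 0 < 1 - ⟪x, m⟫_ℝ := by linarith
      positivity
    have h3 : c * ‖y + (k / 2) • (m - x)‖ ≤ c * (1 + k ^ 2 / 4 * (1 - ⟪x, m⟫_ℝ)) := by gcongr
    nlinarith

/-- A nearest-point argument: the boundary points of the dual with a unique contact are dense in
the boundary. -/
theorem exists_isUniqueContact_mem {n : ℕ} {A : Set (EuclideanSpace ℝ (Fin n))}
    (hA : A ⊆ Metric.sphere 0 1) (hc : IsClosed A) {b p : EuclideanSpace ℝ (Fin n)}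
    (hb : ∀ x ∈ A, 0 < ⟪x, b⟫_ℝ) (hp : p ∈ sphericalDual A) (hp' : ∃ x ∈ A, ⟪x, p⟫_ℝ = 0)
    {U : Set (EuclideanSpace ℝ (Fin n))} (hU : IsOpen U) (hpU : p ∈ U) :
    ∃ y ∈ U, ∃ x, IsUniqueContact A y x := by
  have hp1 : ‖p‖ = 1 := mem_sphere_zero_iff_norm.1 hp.1
  have hK := isCompact_of_isClosed_of_subset_sphere hA hc
  obtain ⟨ε, hε, hεU⟩ := Metric.isOpen_iff.1 hU p hpU
  obtain ⟨z, hz1, hzA, hzp⟩ : ∃ z : EuclideanSpace ℝ (Fin n), ‖z‖ = 1 ∧ (∀ x ∈ A, 0 < ⟪x, z⟫_ℝ) ∧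
      dist p z < min (ε / 2) 1 := by
    have hcont : ContinuousAt (fun t : ℝ => ‖p + t • b‖⁻¹ • (p + t • b)) 0 := by
      have : ‖p + (0 : ℝ) • b‖ ≠ 0 := by simp [hp1]
      fun_prop (disch := assumption)
    have hne : ContinuousAt (fun t : ℝ => ‖p + t • b‖) 0 := by fun_prop
    have h1 := hcont.eventually (Metric.ball_mem_nhds _ (show 0 < min (ε / 2) 1 by positivity))
    have h2 := hne.eventually (lt_mem_nhds (show 0 < ‖p + (0 : ℝ) • b‖ by simp [hp1]))
    obtain ⟨t, ⟨ht1, ht2⟩, ht3⟩ := ((h1.and h2).filter_mono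
      (nhdsWithin_le_nhds (s := Set.Ioi 0)) |>.and self_mem_nhdsWithin).exists
    refine ⟨‖p + t • b‖⁻¹ • (p + t • b), ?_, fun x hx => ?_, ?_⟩
    · rw [norm_smul, norm_inv, norm_norm, inv_mul_cancel₀ ht2.ne']
    · rw [inner_smul_right, inner_add_right, inner_smul_right]
      have h3 := hb x hx
      have h4 := hp.2 x hx
      have ht3 : 0 < t := ht3
      positivity
    · rw [dist_comm]
      simpa [hp1] using ht1
  obtain ⟨hzp1, hzp2⟩ := lt_min_iff.1 hzp
  set T : Set (EuclideanSpace ℝ (Fin n)) :=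
    Metric.sphere 0 1 ∩ {w | ∀ x ∈ A, 0 < ⟪x, w⟫_ℝ}ᶜ with hT
  have hTc : IsCompact T :=
    (isCompact_sphere 0 1).inter_right (isOpen_setOf_forall_inner_pos hK).isClosed_compl
  have hpT : p ∈ T := by
    refine ⟨hp.1, fun h => ?_⟩
    obtain ⟨x, hx, hx0⟩ := hp'
    exact absurd (h x hx) (by rw [hx0]; exact lt_irrefl _)
  obtain ⟨y, hyT, hymin⟩ := hTc.exists_isMinOn ⟨p, hpT⟩
    (f := fun w => dist w z) (by fun_prop)
  have hyp : dist y z ≤ dist p z := hymin hpT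
  have hy1 : ‖y‖ = 1 := mem_sphere_zero_iff_norm.1 hyT.1
  have hinner : ∀ w : EuclideanSpace ℝ (Fin n), ‖w‖ = 1 → dist w z ^ 2 = 2 - 2 * ⟪w, z⟫_ℝ := by
    intro w hw
    rw [dist_eq_norm, norm_sub_sq_real, hw, hz1]; ring
  have hyz : y ≠ z := by
    rintro rfl
    exact hyT.2 hzA
  have hyzpos : 0 < ⟪y, z⟫_ℝ := by
    have h1 := hinner y hy1
    have h2 : dist y z < 1 := hyp.trans_lt hzp2
    have : dist y z ^ 2 < 1 := by
      have := dist_nonneg (x := y) (y := z)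
      nlinarith
    linarith
  have hdisk : ∀ w, ⟪y, z⟫_ℝ * ‖w‖ < ⟪w, z⟫_ℝ → ∀ x ∈ A, 0 < ⟪x, w⟫_ℝ := by
    intro w hw
    have hw0 : 0 < ‖w‖ := by
      refine norm_pos_iff.2 ?_
      rintro rfl
      simp at hw
    by_contra hcon
    have hmem : ‖w‖⁻¹ • w ∈ T := by
      refine ⟨mem_sphere_zero_iff_norm.2 ?_, fun h => hcon fun x hx => ?_⟩
      · rw [norm_smul, norm_inv, norm_norm, inv_mul_cancel₀ hw0.ne']
      · have := h x hx
        rw [inner_smul_right] at this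
        exact (mul_pos_iff_of_pos_left (inv_pos.2 hw0)).1 this
    have h1 : dist y z ≤ dist (‖w‖⁻¹ • w) z := hymin hmem
    have h2 := hinner y hy1
    have h3 := hinner _ (mem_sphere_zero_iff_norm.1 hmem.1)
    have h4 : dist y z ^ 2 ≤ dist (‖w‖⁻¹ • w) z ^ 2 := by gcongr
    rw [h2, h3, real_inner_smul_left] at h4
    have h5 : ⟪y, z⟫_ℝ < ‖w‖⁻¹ * ⟪w, z⟫_ℝ := by
      rw [inv_mul_eq_div, lt_div_iff₀ hw0]
      exact hw
    linarith
  have hydual : y ∈ sphericalDual A := by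
    refine ⟨hyT.1, fun x hx => ?_⟩
    have hlim : Tendsto (fun s : ℝ => ⟪x, y + s • z⟫_ℝ) (𝓝[>] 0) (𝓝 ⟪x, y⟫_ℝ) := by
      have : ContinuousAt (fun s : ℝ => ⟪x, y + s • z⟫_ℝ) 0 := by fun_prop
      have := this.tendsto
      simp only [zero_smul, add_zero] at this
      exact this.mono_left nhdsWithin_le_nhds
    refine ge_of_tendsto hlim ?_
    filter_upwards [self_mem_nhdsWithin] with s hs
    have hs : 0 < s := hs
    refine (hdisk _ ?_ x hx).le
    have hlt : ⟪y, z⟫_ℝ < 1 := (inner_lt_one_iff_real_of_norm_eq_one hy1 hz1).2 hyz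
    rw [inner_add_left, real_inner_smul_left, real_inner_self_eq_norm_sq, hz1]
    have : ‖y + s • z‖ ≤ 1 + s := by
      refine (norm_add_le _ _).trans ?_
      rw [norm_smul, hy1, hz1, Real.norm_eq_abs, abs_of_pos hs, mul_one]
    nlinarith
  have hyU : y ∈ U := hεU (by
    rw [Metric.mem_ball]
    calc dist y p ≤ dist y z + dist p z := dist_triangle_right y p z
      _ < ε := by linarith)
  obtain ⟨x, hx, hxy⟩ : ∃ x ∈ A, ⟪x, y⟫_ℝ = 0 := by
    by_contra! hcon
    exact hyT.2 fun x hx => lt_of_le_of_ne (hydual.2 x hx) (hcon x hx).symm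
  have huniq : ∀ v ∈ A, ⟪v, y⟫_ℝ = 0 → v = ‖z - ⟪y, z⟫_ℝ • y‖⁻¹ • (z - ⟪y, z⟫_ℝ • y) :=
    fun v hv hvy => eq_of_forall_inner_pos (mem_sphere_zero_iff_norm.1 (hA hv)) hy1 hz1 hyz
      hyzpos.le hvy fun w hw => hdisk w hw v hv
  exact ⟨y, hyU, x, hydual, hx, hxy, fun v hv hvy => (huniq v hv hvy).trans (huniq x hx hxy).symm⟩

theorem IsDualMaximal.exists_centre_boundary {n : ℕ} {A : Set (EuclideanSpace ℝ (Fin n))}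
    (hA : A ⊆ Metric.sphere 0 1) (hc : IsClosed A) (hmax : IsDualMaximal A)
    {b : EuclideanSpace ℝ (Fin n)} (hb : ∀ x ∈ A, 0 < ⟪x, b⟫_ℝ) :
    ∃ (e : EuclideanSpace ℝ (Fin n)) (l : ℝ), 0 ≤ l ∧
      ∀ p ∈ sphericalDual A, (∃ x ∈ A, ⟪x, p⟫_ℝ = 0) → e - l • p ∈ A ∧ ⟪e - l • p, p⟫_ℝ = 0 := by
  obtain ⟨e, l, hl, h⟩ := hmax.exists_centre hA hc
  refine ⟨e, l, hl, fun p hp hp' => ?_⟩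
  have hclosed : IsClosed {p : EuclideanSpace ℝ (Fin n) | e - l • p ∈ A ∧ ⟪e - l • p, p⟫_ℝ = 0} :=
    (hc.preimage (by fun_prop : Continuous fun p => e - l • p)).inter
      (isClosed_eq (by fun_prop) continuous_const)
  refine hclosed.closure_subset (mem_closure_iff.2 fun U hU hpU => ?_)
  obtain ⟨y, hyU, x, hyx⟩ := exists_isUniqueContact_mem hA hc hb hp hp' hU hpU
  refine ⟨y, hyU, ?_⟩
  have := h y x hyx
  exact ⟨this ▸ hyx.mem, this ▸ hyx.inner_eq_zero⟩

/-- On a segment leaving the interior of the dual cone there is a boundary point. -/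
theorem exists_inner_eq_zero_of_segment {n : ℕ} {A : Set (EuclideanSpace ℝ (Fin n))}
    (hK : IsCompact A) {b q : EuclideanSpace ℝ (Fin n)} (hb : ∀ x ∈ A, 0 ≤ ⟪x, b⟫_ℝ)
    (hq : ∃ x ∈ A, ⟪x, q⟫_ℝ ≤ 0) :
    ∃ α β : ℝ, 0 ≤ α ∧ 0 ≤ β ∧ α + β = 1 ∧ (∀ x ∈ A, 0 ≤ ⟪x, α • b + β • q⟫_ℝ) ∧
      ∃ x ∈ A, ⟪x, α • b + β • q⟫_ℝ = 0 := by
  have hs := isPreconnected_closed_iff.1 (convex_segment (𝕜 := ℝ) b q).isPreconnected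
    {v | ∀ x ∈ A, 0 ≤ ⟪x, v⟫_ℝ} {v | ∀ x ∈ A, 0 < ⟪x, v⟫_ℝ}ᶜ ?_
    (isOpen_setOf_forall_inner_pos hK).isClosed_compl ?_
    ⟨b, left_mem_segment ℝ b q, hb⟩
    ⟨q, right_mem_segment ℝ b q, fun h => ?_⟩
  · obtain ⟨v, ⟨α, β, hα, hβ, hαβ, rfl⟩, hv1, hv2⟩ := hs
    refine ⟨α, β, hα, hβ, hαβ, hv1, ?_⟩
    by_contra! hcon
    exact hv2 fun x hx => lt_of_le_of_ne (hv1 x hx) (hcon x hx).symm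
  · have : {v : EuclideanSpace ℝ (Fin n) | ∀ x ∈ A, 0 ≤ ⟪x, v⟫_ℝ} =
        ⋂ x ∈ A, {v | 0 ≤ ⟪x, v⟫_ℝ} := by ext; simp
    rw [this]
    exact isClosed_biInter fun x _ => isClosed_le continuous_const (by fun_prop)
  · intro v _
    by_cases h : ∀ x ∈ A, 0 < ⟪x, v⟫_ℝ
    · exact Or.inl fun x hx => (h x hx).le
    · exact Or.inr h
  · obtain ⟨x, hx, hxq⟩ := hq
    exact absurd (h x hx) (not_lt.2 hxq)

/-- The normalized form of `exists_inner_eq_zero_of_segment`. -/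
theorem exists_mem_sphericalDual_of_segment {n : ℕ} {A : Set (EuclideanSpace ℝ (Fin n))}
    (hK : IsCompact A) {b q : EuclideanSpace ℝ (Fin n)} (hb : ∀ x ∈ A, 0 ≤ ⟪x, b⟫_ℝ)
    (hq : ∃ x ∈ A, ⟪x, q⟫_ℝ ≤ 0)
    (hne : ∀ α β : ℝ, 0 ≤ α → 0 ≤ β → α + β = 1 → α • b + β • q ≠ 0) :
    ∃ α β : ℝ, 0 ≤ α ∧ 0 ≤ β ∧ α • b + β • q ∈ sphericalDual A ∧
      ∃ x ∈ A, ⟪x, α • b + β • q⟫_ℝ = 0 := by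
  obtain ⟨α, β, hα, hβ, hαβ, h1, x, hx, h2⟩ := exists_inner_eq_zero_of_segment hK hb hq
  set v := α • b + β • q with hv
  have hv0 : 0 < ‖v‖ := norm_pos_iff.2 (hne α β hα hβ hαβ)
  have heq : (‖v‖⁻¹ * α) • b + (‖v‖⁻¹ * β) • q = ‖v‖⁻¹ • v := by
    rw [hv]; module
  refine ⟨‖v‖⁻¹ * α, ‖v‖⁻¹ * β, by positivity, by positivity, ?_⟩
  rw [heq]
  refine ⟨⟨mem_sphere_zero_iff_norm.2 ?_, fun z hz => ?_⟩, x, hx, ?_⟩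
  · rw [norm_smul, norm_inv, norm_norm, inv_mul_cancel₀ hv0.ne']
  · rw [inner_smul_right]
    exact mul_nonneg (by positivity) (h1 z hz)
  · rw [inner_smul_right, h2, mul_zero]

theorem exists_norm_eq_one_inner_eq_zero {n : ℕ} (hn : 2 ≤ n) (b : EuclideanSpace ℝ (Fin n)) :
    ∃ w : EuclideanSpace ℝ (Fin n), ‖w‖ = 1 ∧ ⟪b, w⟫_ℝ = 0 := by
  have h1 := Submodule.finrank_add_finrank_orthogonal (Submodule.span ℝ {b})
  have h2 : Module.finrank ℝ (Submodule.span ℝ {b}) ≤ 1 := by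
    simpa using finrank_span_le_card (R := ℝ) ({b} : Set (EuclideanSpace ℝ (Fin n)))
  rw [finrank_euclideanSpace_fin] at h1
  have : Nontrivial (Submodule.span ℝ {b})ᗮ := Module.nontrivial_of_finrank_pos (R := ℝ) (by omega)
  obtain ⟨⟨v, hv⟩, hv0⟩ := exists_ne (0 : (Submodule.span ℝ {b})ᗮ)
  have hv0 : 0 < ‖v‖ := norm_pos_iff.2 fun h => hv0 (by ext1; exact h)
  refine ⟨‖v‖⁻¹ • v, ?_, ?_⟩
  · rw [norm_smul, norm_inv, norm_norm, inv_mul_cancel₀ hv0.ne']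
  · rw [inner_smul_right, Submodule.mem_orthogonal_singleton_iff_inner_right.1 hv, mul_zero]

theorem exists_mem_sphericalDual_inner_eq_zero {n : ℕ} (hn : 2 ≤ n)
    {A : Set (EuclideanSpace ℝ (Fin n))} (hK : IsCompact A) (hne : A.Nonempty)
    {b : EuclideanSpace ℝ (Fin n)} (hb : ∀ x ∈ A, 0 < ⟪x, b⟫_ℝ) :
    ∃ p ∈ sphericalDual A, ∃ x ∈ A, ⟪x, p⟫_ℝ = 0 := by
  obtain ⟨x, hx⟩ := hne
  obtain ⟨w, hw1, hbw⟩ := exists_norm_eq_one_inner_eq_zero hn b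
  have hxb := hb x hx
  have key := exists_mem_sphericalDual_of_segment hK (b := b)
    (q := w - (⟪x, w⟫_ℝ / ⟪x, b⟫_ℝ) • b) (fun x hx => (hb x hx).le)
    ⟨x, hx, by rw [inner_sub_right, inner_smul_right, div_mul_cancel₀ _ hxb.ne', sub_self]⟩ ?_
  · obtain ⟨α, β, -, -, h⟩ := key
    exact ⟨_, h⟩
  · intro α β _ _ hαβ h0
    have h1 := congrArg (fun v => ⟪w, v⟫_ℝ) h0
    simp only [inner_add_right, inner_smul_right, inner_sub_right, real_inner_comm, hbw,
      real_inner_self_eq_norm_sq, hw1, inner_zero_right] at h1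
    have hβ : β = 0 := by linarith
    rw [hβ, zero_smul, add_zero, show α = 1 by linarith, one_smul] at h0
    rw [h0, inner_zero_right] at hxb
    exact lt_irrefl _ hxb

/-- The spherical dual of a maximizer is a cap contained in a closed hemisphere. -/
theorem IsDualMaximal.exists_sphericalDual_eq {n : ℕ} (hn : 2 ≤ n)
    {A : Set (EuclideanSpace ℝ (Fin n))} (hA : A ⊆ Metric.sphere 0 1) (hc : IsClosed A)
    (hne : A.Nonempty) (hmax : IsDualMaximal A) (hpos : 0 < sphereHaar n (sphericalDual A)) :
    ∃ (e : EuclideanSpace ℝ (Fin n)) (l : ℝ), 0 ≤ l ∧ ‖e‖ ^ 2 = 1 + l ^ 2 ∧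
      sphericalDual A = Metric.sphere 0 1 ∩ {y | l ≤ ⟪e, y⟫_ℝ} := by
  have hK := isCompact_of_isClosed_of_subset_sphere hA hc
  obtain ⟨b, hb⟩ := exists_forall_inner_pos (by omega) hA hpos
  obtain ⟨e, l, hl, hel⟩ := hmax.exists_centre_boundary hA hc hb
  obtain ⟨p₀, hp₀, x₀, hx₀, hxp₀⟩ := exists_mem_sphericalDual_inner_eq_zero hn hK hne hb
  have hinner : ∀ p ∈ sphericalDual A, (∃ x ∈ A, ⟪x, p⟫_ℝ = 0) → ⟪e, p⟫_ℝ = l := by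
    intro p hp hp'
    have := (hel p hp hp').2
    rw [inner_sub_left, real_inner_smul_left, real_inner_self_eq_norm_sq,
      mem_sphere_zero_iff_norm.1 hp.1] at this
    linarith
  have hep₀ := hinner p₀ hp₀ ⟨x₀, hx₀, hxp₀⟩
  have hp₀1 : ‖p₀‖ = 1 := mem_sphere_zero_iff_norm.1 hp₀.1
  obtain ⟨hx₁, hx₁p⟩ := hel p₀ hp₀ ⟨x₀, hx₀, hxp₀⟩
  have he : ‖e‖ ^ 2 = 1 + l ^ 2 := by
    have := mem_sphere_zero_iff_norm.1 (hA hx₁)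
    have : ‖e - l • p₀‖ ^ 2 = 1 := by rw [this]; norm_num
    rw [norm_sub_sq_real, inner_smul_right, norm_smul, hep₀, hp₀1, Real.norm_eq_abs, mul_one,
      sq_abs] at this
    linarith
  refine ⟨e, l, hl, he, Set.Subset.antisymm (fun y hy => ⟨hy.1, ?_⟩) fun y hy => ?_⟩
  · show l ≤ ⟪e, y⟫_ℝ
    by_contra! hlt
    have hy1 : ‖y‖ = 1 := mem_sphere_zero_iff_norm.1 hy.1
    have hsq : ∀ α β : ℝ, ‖α • y + β • (-e)‖ ^ 2 =
        α ^ 2 - 2 * α * β * ⟪e, y⟫_ℝ + β ^ 2 * (1 + l ^ 2) := by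
      intro α β
      rw [norm_add_sq_real, norm_smul, norm_smul, real_inner_smul_left, inner_smul_right,
        inner_neg_right, norm_neg, mul_pow, mul_pow, he, hy1, Real.norm_eq_abs, Real.norm_eq_abs,
        sq_abs, sq_abs, real_inner_comm]
      ring
    have hin : ∀ α β : ℝ, ⟪e, α • y + β • (-e)⟫_ℝ = α * ⟪e, y⟫_ℝ - β * (1 + l ^ 2) := by
      intro α β
      rw [inner_add_right, inner_smul_right, inner_smul_right, inner_neg_right,
        real_inner_self_eq_norm_sq, he]
      ring
    have key := exists_mem_sphericalDual_of_segment hK (b := y) (q := -e)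
      hy.2 ⟨_, hx₁, ?_⟩ ?_
    · obtain ⟨α, β, hα, hβ, hp, hp'⟩ := key
      have h1 := hsq α β
      have h2 := hin α β
      rw [hinner _ hp hp'] at h2
      rw [mem_sphere_zero_iff_norm.1 hp.1] at h1
      have hα2 : α ^ 2 = 1 + 2 * β * l + β ^ 2 * (1 + l ^ 2) := by
        linear_combination -h1 - 2 * β * h2
      have hαpos : 0 < α := by
        refine lt_of_le_of_ne hα fun h0 => ?_
        rw [← h0] at hα2
        have : 0 ≤ β * l := by positivity
        nlinarith [sq_nonneg β, sq_nonneg (β * l)]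
      have h3 : l + β * (1 + l ^ 2) < α * l := by nlinarith
      have h4 : (l + β * (1 + l ^ 2)) ^ 2 < (α * l) ^ 2 := by gcongr
      rw [mul_pow, hα2] at h4
      have : 0 ≤ β * l := by positivity
      nlinarith [sq_nonneg β, sq_nonneg (β * l)]
    · rw [inner_neg_right, inner_sub_left, real_inner_self_eq_norm_sq, real_inner_smul_left,
        real_inner_comm, hep₀, he]
      nlinarith
    · intro α β hα hβ hαβ h0
      have h1 := hsq α β
      have h2 := hin α β
      rw [h0, norm_zero] at h1
      rw [h0, inner_zero_right] at h2
      have hα2 : α ^ 2 = β ^ 2 * (1 + l ^ 2) := by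
        linear_combination -h1 - 2 * β * h2
      have hαpos : 0 < α := by
        refine lt_of_le_of_ne hα fun h0 => ?_
        rw [← h0] at hα2 hαβ
        rw [show β = 1 by linarith] at hα2
        nlinarith
      have h3 : β * (1 + l ^ 2) < α * l := by nlinarith
      have h4 : (β * (1 + l ^ 2)) ^ 2 < (α * l) ^ 2 := by gcongr
      rw [mul_pow α, hα2] at h4
      nlinarith [sq_nonneg β, sq_nonneg (β * l)]
  · have hly : l ≤ ⟪e, y⟫_ℝ := hy.2
    have hy1 : ‖y‖ = 1 := mem_sphere_zero_iff_norm.1 hy.1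
    by_contra hcon
    obtain ⟨x₂, hx₂, hxy₂⟩ : ∃ x ∈ A, ⟪x, y⟫_ℝ < 0 := by
      by_contra! h
      exact hcon ⟨hy.1, h⟩
    obtain ⟨b', hb', hne'⟩ : ∃ b' : EuclideanSpace ℝ (Fin n), (∀ x ∈ A, 0 < ⟪x, b'⟫_ℝ) ∧
        ∀ α β : ℝ, 0 ≤ α → 0 ≤ β → α + β = 1 → α • b' + β • y ≠ 0 := by
      have hy0 : y ≠ 0 := by
        rintro rfl
        simp at hy1
      have hxb := hb x₀ hx₀
      by_cases hpar : ∃ k : ℝ, y = k • b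
      · obtain ⟨k, hk⟩ := hpar
        refine ⟨b + p₀, fun x hx => ?_, fun α β _ _ hαβ h0 => ?_⟩
        · rw [inner_add_right]
          exact add_pos_of_pos_of_nonneg (hb x hx) (hp₀.2 x hx)
        · have h1 := congrArg (fun v => ⟪x₀, v⟫_ℝ) h0
          simp only [hk, inner_add_right, inner_smul_right, hxp₀, inner_zero_right] at h1
          have h2 : α + β * k = 0 := by
            have : (α + β * k) * ⟪x₀, b⟫_ℝ = 0 := by linarith
            exact (mul_eq_zero.1 this).resolve_right hxb.ne'
          have h3 : α • p₀ = 0 := by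
            have : α • (b + p₀) + β • y = (α + β * k) • b + α • p₀ := by rw [hk]; module
            rw [this, h2, zero_smul, zero_add] at h0
            exact h0
          have h4 : α = 0 := (smul_eq_zero.1 h3).resolve_right (by rintro rfl; simp at hp₀1)
          rw [h4, zero_smul, zero_add, show β = 1 by linarith, one_smul] at h0
          exact hy0 h0
      · refine ⟨b, hb, fun α β _ _ hαβ h0 => ?_⟩
        by_cases hβ : β = 0
        · rw [hβ, zero_smul, add_zero, show α = 1 by linarith, one_smul] at h0
          rw [h0, inner_zero_right] at hxb
          exact lt_irrefl _ hxb
        · refine hpar ⟨-(β⁻¹ * α), ?_⟩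
          have : β⁻¹ • (α • b + β • y) = 0 := by rw [h0, smul_zero]
          rw [smul_add, smul_smul, smul_smul, inv_mul_cancel₀ hβ, one_smul] at this
          rw [neg_smul]
          exact (neg_eq_of_add_eq_zero_right this).symm
    obtain ⟨α, β, hα, hβ, hp, hp'⟩ := exists_mem_sphericalDual_of_segment hK
      (fun x hx => (hb' x hx).le) ⟨x₂, hx₂, hxy₂.le⟩ hne'
    obtain ⟨hxA, hxp⟩ := hel _ hp hp'
    have hp1 := mem_sphere_zero_iff_norm.1 hp.1
    have hαpos : 0 < α := by
      refine lt_of_le_of_ne hα fun h0 => hcon ?_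
      rw [← h0, zero_smul, zero_add] at hp hp1
      rw [norm_smul, hy1, mul_one, Real.norm_eq_abs, abs_of_nonneg hβ] at hp1
      rwa [hp1, one_smul] at hp
    have hpy : ⟪α • b' + β • y, y⟫_ℝ ≤ 1 := by
      have := real_inner_le_norm (α • b' + β • y) y
      rwa [hp1, hy1, mul_one] at this
    generalize hpdef : α • b' + β • y = p at *
    have h1 : 0 < α * ⟪e - l • p, b'⟫_ℝ := mul_pos hαpos (hb' _ hxA)
    have h2 : β * ⟪e - l • p, y⟫_ℝ < 0 := by
      have : ⟪e - l • p, α • b' + β • y⟫_ℝ = 0 := by rw [hpdef, hxp]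
      rw [inner_add_right, inner_smul_right, inner_smul_right] at this
      linarith
    have h3 : ⟪e - l • p, y⟫_ℝ < 0 := by
      by_contra! h
      exact absurd h2 (not_lt.2 (mul_nonneg hβ h))
    rw [inner_sub_left, real_inner_smul_left] at h3
    nlinarith

theorem exists_nonemptyCompacts_image_eq {n : ℕ} {A : Set (EuclideanSpace ℝ (Fin n))}
    (hA : A ⊆ Metric.sphere 0 1) (hc : IsClosed A) (hne : A.Nonempty) :
    ∃ K : TopologicalSpace.NonemptyCompacts (Metric.sphere (0 : EuclideanSpace ℝ (Fin n)) 1),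
      Subtype.val '' (K : Set (Metric.sphere (0 : EuclideanSpace ℝ (Fin n)) 1)) = A := by
  obtain ⟨x, hx⟩ := hne
  exact ⟨⟨⟨Subtype.val ⁻¹' A, (hc.preimage continuous_subtype_val).isCompact⟩, ⟨x, hA hx⟩, hx⟩,
    (Subtype.image_preimage_coe _ _).trans (Set.inter_eq_right.2 hA)⟩

theorem upperSemicontinuous_sphereHaar_image {n : ℕ} (hn : 1 ≤ n) :
    UpperSemicontinuous fun K : TopologicalSpace.NonemptyCompacts
      (Metric.sphere (0 : EuclideanSpace ℝ (Fin n)) 1) =>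
        sphereHaar n (Subtype.val '' (K : Set (Metric.sphere (0 : EuclideanSpace ℝ (Fin n)) 1))) := by
  have := isProbabilityMeasure_sphereHaar hn
  intro K r hr
  obtain ⟨U, hKU, hU, hUr⟩ := Set.exists_isOpen_lt_of_lt _ r hr
  have hopen := TopologicalSpace.NonemptyCompacts.isOpen_subsets_of_isOpen
    (hU.preimage (continuous_subtype_val (p := (· ∈ Metric.sphere (0 : EuclideanSpace ℝ (Fin n)) 1))))
  filter_upwards [hopen.mem_nhds (Set.image_subset_iff.1 hKU)] with L hL
  exact (measure_mono (Set.image_subset_iff.2 hL)).trans_lt hUr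

theorem isClosed_setOf_forall_inner_nonneg {n : ℕ} :
    IsClosed {P : TopologicalSpace.NonemptyCompacts
        (Metric.sphere (0 : EuclideanSpace ℝ (Fin n)) 1) ×
        TopologicalSpace.NonemptyCompacts (Metric.sphere (0 : EuclideanSpace ℝ (Fin n)) 1) |
      ∀ x ∈ P.1, ∀ y ∈ P.2, 0 ≤ ⟪x.1, y.1⟫_ℝ} := by
  rw [← isOpen_compl_iff, isOpen_iff_mem_nhds]
  rintro ⟨K, L⟩ hKL
  have hKL : ¬ ∀ x ∈ K, ∀ y ∈ L, 0 ≤ ⟪x.1, y.1⟫_ℝ := hKL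
  push Not at hKL
  obtain ⟨x, hx, y, hy, hxy⟩ := hKL
  have hcont : ContinuousAt (fun p : Metric.sphere (0 : EuclideanSpace ℝ (Fin n)) 1 ×
      Metric.sphere (0 : EuclideanSpace ℝ (Fin n)) 1 => ⟪p.1.1, p.2.1⟫_ℝ) (x, y) := by fun_prop
  have hev := hcont.eventually (gt_mem_nhds hxy)
  rw [nhds_prod_eq, eventually_prod_iff] at hev
  obtain ⟨p, hp, q, hq, hpq⟩ := hev
  obtain ⟨U, hUp, hU, hxU⟩ := eventually_nhds_iff.1 hp
  obtain ⟨V, hVq, hV, hyV⟩ := eventually_nhds_iff.1 hq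
  have h1 := (TopologicalSpace.NonemptyCompacts.isOpen_inter_nonempty_of_isOpen hU).mem_nhds
    (show K ∈ _ from ⟨x, hx, hxU⟩)
  have h2 := (TopologicalSpace.NonemptyCompacts.isOpen_inter_nonempty_of_isOpen hV).mem_nhds
    (show L ∈ _ from ⟨y, hy, hyV⟩)
  filter_upwards [prod_mem_nhds h1 h2] with P hP hcon
  obtain ⟨⟨x', hx', hxU'⟩, ⟨y', hy', hyV'⟩⟩ := hP
  have h3 : ⟪x'.1, y'.1⟫_ℝ < 0 := hpq (hUp _ hxU') (hVq _ hyV')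
  exact absurd (hcon x' hx' y' hy') (not_le.2 h3)

theorem exists_maximal_sphericalDual {n : ℕ} (hn : 1 ≤ n) {C : Set (EuclideanSpace ℝ (Fin n))}
    (hC : C ⊆ Metric.sphere 0 1) (hCc : IsClosed C) (hCne : C.Nonempty)
    (hCd : (sphericalDual C).Nonempty) :
    ∃ A : Set (EuclideanSpace ℝ (Fin n)), A ⊆ Metric.sphere 0 1 ∧ IsClosed A ∧ A.Nonempty ∧
      sphereHaar n C ≤ sphereHaar n A ∧
      ∀ A' : Set (EuclideanSpace ℝ (Fin n)), A' ⊆ Metric.sphere 0 1 → IsClosed A' → A'.Nonempty →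
        sphereHaar n C ≤ sphereHaar n A' →
          sphereHaar n (sphericalDual A') ≤ sphereHaar n (sphericalDual A) := by
  set S := Metric.sphere (0 : EuclideanSpace ℝ (Fin n)) 1 with hS
  have : CompactSpace S := isCompact_iff_compactSpace.1 (isCompact_sphere 0 1)
  have husc := upperSemicontinuous_sphereHaar_image hn
  set F : Set (TopologicalSpace.NonemptyCompacts S × TopologicalSpace.NonemptyCompacts S) :=
    {P | sphereHaar n C ≤ sphereHaar n (Subtype.val '' (P.1 : Set S))} ∩
      {P | ∀ x ∈ P.1, ∀ y ∈ P.2, 0 ≤ ⟪x.1, y.1⟫_ℝ} with hF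
  have hFc : IsCompact F := by
    refine IsClosed.isCompact (IsClosed.inter ?_ isClosed_setOf_forall_inner_nonneg)
    exact (husc.isClosed_preimage (sphereHaar n C)).preimage continuous_fst
  have hmem : ∀ A' : Set (EuclideanSpace ℝ (Fin n)), A' ⊆ S → IsClosed A' → A'.Nonempty →
      sphereHaar n C ≤ sphereHaar n A' → (sphericalDual A').Nonempty →
      ∃ P ∈ F, Subtype.val '' (P.2 : Set S) = sphericalDual A' := by
    intro A' hA' hA'c hA'ne hle hd
    obtain ⟨K, hK⟩ := exists_nonemptyCompacts_image_eq hA' hA'c hA'ne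
    obtain ⟨L, hL⟩ := exists_nonemptyCompacts_image_eq (fun _ h => h.1)
      (isClosed_sphericalDual A') hd
    refine ⟨(K, L), ⟨?_, fun x hx y hy => ?_⟩, hL⟩
    · show _ ≤ sphereHaar n (Subtype.val '' (K : Set S))
      rwa [hK]
    · have h1 : x.1 ∈ A' := hK ▸ Set.mem_image_of_mem _ hx
      have h2 : y.1 ∈ sphericalDual A' := hL ▸ Set.mem_image_of_mem _ hy
      exact h2.2 _ h1
  obtain ⟨P₀, hP₀, -⟩ := hmem C hC hCc hCne le_rfl hCd
  obtain ⟨⟨K, L⟩, hKL, hmax⟩ := ((husc.comp continuous_snd).upperSemicontinuousOn F).exists_isMaxOn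
    ⟨P₀, hP₀⟩ hFc
  refine ⟨Subtype.val '' (K : Set S), ?_, ?_, ?_, hKL.1, fun A' hA' hA'c hA'ne hle => ?_⟩
  · rintro _ ⟨x, -, rfl⟩
    exact x.2
  · exact (K.isCompact.image continuous_subtype_val).isClosed
  · exact K.nonempty.image _
  · rcases (sphericalDual A').eq_empty_or_nonempty with h | h
    · rw [h, measure_empty]
      exact zero_le
    · obtain ⟨P, hP, hPd⟩ := hmem A' hA' hA'c hA'ne hle h
      rw [← hPd]
      have h1 : sphereHaar n (Subtype.val '' (P.2 : Set S)) ≤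
        sphereHaar n (Subtype.val '' (L : Set S)) := hmax hP
      refine h1.trans (measure_mono ?_)
      rintro _ ⟨y, hy, rfl⟩
      refine ⟨y.2, ?_⟩
      rintro _ ⟨x, hx, rfl⟩
      exact hKL.2 x hx y hy

/-- The points of the sphere whose inner product with `u` is at least `c`. -/
def sphereCap {n : ℕ} (u : EuclideanSpace ℝ (Fin n)) (c : ℝ) : Set (EuclideanSpace ℝ (Fin n)) :=
  Metric.sphere 0 1 ∩ {x | c ≤ ⟪u, x⟫_ℝ}

theorem isClosed_sphereCap {n : ℕ} (u : EuclideanSpace ℝ (Fin n)) (c : ℝ) :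
    IsClosed (sphereCap u c) :=
  Metric.isClosed_sphere.inter (isClosed_le continuous_const (by fun_prop))

theorem sphereCap_subset_sphere {n : ℕ} (u : EuclideanSpace ℝ (Fin n)) (c : ℝ) :
    sphereCap u c ⊆ Metric.sphere 0 1 :=
  Set.inter_subset_left

theorem sphereCap_anti {n : ℕ} (u : EuclideanSpace ℝ (Fin n)) {c d : ℝ} (h : c ≤ d) :
    sphereCap u d ⊆ sphereCap u c :=
  fun _ hx => ⟨hx.1, h.trans hx.2⟩

theorem sphereCap_smul {n : ℕ} (u : EuclideanSpace ℝ (Fin n)) (c : ℝ) {r : ℝ} (hr : 0 < r) :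
    sphereCap (r • u) (r * c) = sphereCap u c := by
  ext x
  refine and_congr_right fun _ => ?_
  show r * c ≤ ⟪r • u, x⟫_ℝ ↔ c ≤ ⟪u, x⟫_ℝ
  rw [real_inner_smul_left, mul_le_mul_iff_right₀ hr]

theorem IsSphericalCap.exists_eq_sphereCap {n : ℕ} {C : Set (EuclideanSpace ℝ (Fin n))}
    (hC : IsSphericalCap C) :
    ∃ (u : EuclideanSpace ℝ (Fin n)) (c : ℝ), ‖u‖ = 1 ∧ c ≤ 1 ∧ C = sphereCap u c := by
  obtain ⟨⟨x, hx⟩, u, c, hu, rfl⟩ := hC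
  have hu' : 0 < ‖u‖ := norm_pos_iff.2 hu
  have h1 : ‖‖u‖⁻¹ • u‖ = 1 := by rw [norm_smul, norm_inv, norm_norm, inv_mul_cancel₀ hu'.ne']
  have h2 := sphereCap_smul u c (inv_pos.2 hu')
  refine ⟨‖u‖⁻¹ • u, ‖u‖⁻¹ * c, h1, ?_, h2.symm⟩
  have h3 : x ∈ sphereCap (‖u‖⁻¹ • u) (‖u‖⁻¹ * c) := h2.symm ▸ hx
  have h4 := real_inner_le_norm (‖u‖⁻¹ • u) x
  rw [h1, mem_sphere_zero_iff_norm.1 h3.1, mul_one] at h4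
  exact h3.2.trans h4

theorem mem_sphereCap_self {n : ℕ} {u : EuclideanSpace ℝ (Fin n)} (hu : ‖u‖ = 1) {c : ℝ}
    (hc : c ≤ 1) : u ∈ sphereCap u c :=
  ⟨mem_sphere_zero_iff_norm.2 hu, by
    show c ≤ ⟪u, u⟫_ℝ
    rwa [real_inner_self_eq_norm_sq, hu, one_pow]⟩

theorem isSphericalCap_sphereCap {n : ℕ} {u : EuclideanSpace ℝ (Fin n)} (hu : ‖u‖ = 1) {c : ℝ}
    (hc : c ≤ 1) : IsSphericalCap (sphereCap u c) :=
  ⟨⟨u, mem_sphereCap_self hu hc⟩, u, c, by rintro rfl; simp at hu, rfl⟩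

theorem sphereHaar_sphereCap_congr {n : ℕ} {u v : EuclideanSpace ℝ (Fin n)} (h : ‖u‖ = ‖v‖)
    (c : ℝ) : sphereHaar n (sphereCap u c) = sphereHaar n (sphereCap v c) := by
  obtain ⟨f, rfl⟩ := exists_linearIsometryEquiv_apply_eq h
  rw [← sphereHaar_preimage f (sphereCap (f u) c)]
  congr 1
  ext x
  simp [sphereCap]

theorem exists_norm_eq_one_inner_eq {n : ℕ} (hn : 2 ≤ n) {u : EuclideanSpace ℝ (Fin n)}
    (hu : ‖u‖ = 1) {t : ℝ} (h₁ : -1 ≤ t) (h₂ : t ≤ 1) :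
    ∃ x : EuclideanSpace ℝ (Fin n), ‖x‖ = 1 ∧ ⟪u, x⟫_ℝ = t := by
  obtain ⟨w, hw, huw⟩ := exists_norm_eq_one_inner_eq_zero hn u
  refine ⟨_, norm_cos_smul_add_sin_smul hu hw huw (Real.arccos t), ?_⟩
  rw [inner_add_right, inner_smul_right, inner_smul_right, huw, real_inner_self_eq_norm_sq, hu,
    Real.cos_arccos h₁ h₂]
  ring

theorem sphereHaar_sphereCap_lt {n : ℕ} (hn : 2 ≤ n) {u : EuclideanSpace ℝ (Fin n)}
    (hu : ‖u‖ = 1) {c d : ℝ} (h₁ : -1 ≤ c) (h₂ : c < 1) (hcd : c < d) :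
    sphereHaar n (sphereCap u d) < sphereHaar n (sphereCap u c) := by
  have := isProbabilityMeasure_sphereHaar (n := n) (by omega)
  obtain ⟨t, hct, htd⟩ := exists_between (lt_min hcd h₂)
  obtain ⟨htd, ht1⟩ := lt_min_iff.1 htd
  obtain ⟨x, hx, hux⟩ := exists_norm_eq_one_inner_eq hn hu (h₁.trans hct.le) ht1.le
  have hU : IsOpen {x : EuclideanSpace ℝ (Fin n) | c < ⟪u, x⟫_ℝ ∧ ⟪u, x⟫_ℝ < d} :=
    isOpen_Ioo.preimage (by fun_prop : Continuous fun x => ⟪u, x⟫_ℝ)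
  have hpos := sphereHaar_pos_of_isOpen hU hx ⟨by rwa [hux], by rwa [hux]⟩
  refine (ENNReal.lt_add_right (measure_ne_top _ _) hpos.ne').trans_le ?_
  rw [← sphereHaar_inter_sphere {x | _}, ← measure_union' _ (isClosed_sphereCap u d).measurableSet]
  · refine measure_mono ?_
    rintro y (hy | ⟨hy, hy'⟩)
    · exact sphereCap_anti u hcd.le hy
    · exact ⟨hy', hy.1.le⟩
  · exact Set.disjoint_left.2 fun y hy hy' => absurd hy.2 (not_le.2 hy'.1.2)

theorem sphereHaar_sphereCap_pos {n : ℕ} {u : EuclideanSpace ℝ (Fin n)} (hu : ‖u‖ = 1) {c : ℝ}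
    (hc : c < 1) : 0 < sphereHaar n (sphereCap u c) := by
  have hU : IsOpen {x : EuclideanSpace ℝ (Fin n) | c < ⟪u, x⟫_ℝ} :=
    isOpen_lt continuous_const (by fun_prop)
  have hpos := sphereHaar_pos_of_isOpen hU hu (show c < ⟪u, u⟫_ℝ by
    rwa [real_inner_self_eq_norm_sq, hu, one_pow])
  rw [← sphereHaar_inter_sphere {x | _}] at hpos
  refine hpos.trans_le (measure_mono fun x hx => ⟨hx.2, ?_⟩)
  exact le_of_lt (show c < ⟪u, x⟫_ℝ from hx.1)

theorem sphericalDual_sphereCap {n : ℕ} {u : EuclideanSpace ℝ (Fin n)} (hu : ‖u‖ = 1) {c : ℝ}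
    (hc₀ : 0 ≤ c) (hc₁ : c ≤ 1) :
    sphericalDual (sphereCap u c) = sphereCap u √(1 - c ^ 2) := by
  have hs : √(1 - c ^ 2) ^ 2 = 1 - c ^ 2 := Real.sq_sqrt (by nlinarith)
  have hs0 := Real.sqrt_nonneg (1 - c ^ 2)
  set s := √(1 - c ^ 2)
  have hperp : ∀ x : EuclideanSpace ℝ (Fin n), ‖x‖ = 1 →
      ‖x - ⟪u, x⟫_ℝ • u‖ ^ 2 = 1 - ⟪u, x⟫_ℝ ^ 2 := by
    intro x hx
    rw [norm_sub_sq_real, inner_smul_right, norm_smul, mul_pow, Real.norm_eq_abs, sq_abs, hx, hu,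
      real_inner_comm]
    ring
  ext y
  constructor
  · rintro ⟨hy, hy'⟩
    have hy1 : ‖y‖ = 1 := mem_sphere_zero_iff_norm.1 hy
    refine ⟨hy, ?_⟩
    show s ≤ ⟪u, y⟫_ℝ
    have hb := hy' u (mem_sphereCap_self hu hc₁)
    have hp := hperp y hy1
    set d := ⟪u, y⟫_ℝ with hd
    set v := y - d • u with hv
    have huv : ⟪u, v⟫_ℝ = 0 := by
      rw [hv, inner_sub_right, inner_smul_right, real_inner_self_eq_norm_sq, hu, ← hd]; ring
    have hvy : ⟪v, y⟫_ℝ = ‖v‖ ^ 2 := by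
      rw [hp, hv, inner_sub_left, real_inner_smul_left, real_inner_self_eq_norm_sq, hy1, ← hd]; ring
    by_cases hv0 : ‖v‖ = 0
    · rw [hv0] at hp
      exact abs_le_of_sq_le_sq' (by nlinarith) hb |>.2
    · have hmem : c • u - (s * ‖v‖⁻¹) • v ∈ sphereCap u c := by
        refine ⟨mem_sphere_zero_iff_norm.2 ?_, ?_⟩
        · refine (pow_eq_one_iff_of_nonneg (norm_nonneg _) two_ne_zero).1 ?_
          rw [norm_sub_sq_real, real_inner_smul_left, inner_smul_right, huv, norm_smul, norm_smul,
            hu, mul_pow, mul_pow, Real.norm_eq_abs, Real.norm_eq_abs, sq_abs, sq_abs, mul_pow,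
            inv_pow, mul_assoc (s ^ 2), inv_mul_cancel₀ (pow_ne_zero 2 hv0), hs]
          ring
        · show c ≤ ⟪u, c • u - (s * ‖v‖⁻¹) • v⟫_ℝ
          rw [inner_sub_right, inner_smul_right, inner_smul_right, huv, real_inner_self_eq_norm_sq,
            hu]
          simp
      have h1 := hy' _ hmem
      rw [inner_sub_left, real_inner_smul_left, real_inner_smul_left, hvy, ← hd, pow_two, mul_assoc,
        inv_mul_cancel_left₀ hv0] at h1
      have h2 : (s * ‖v‖) ^ 2 ≤ (c * d) ^ 2 := by
        exact pow_le_pow_left₀ (mul_nonneg hs0 (norm_nonneg v)) (by linarith) 2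
      rw [mul_pow, mul_pow, hp, hs] at h2
      exact abs_le_of_sq_le_sq' (by nlinarith) hb |>.2
  · rintro ⟨hy, hy'⟩
    have hy1 : ‖y‖ = 1 := mem_sphere_zero_iff_norm.1 hy
    have hy' : s ≤ ⟪u, y⟫_ℝ := hy'
    refine ⟨hy, fun x hx => ?_⟩
    have hx1 : ‖x‖ = 1 := mem_sphere_zero_iff_norm.1 hx.1
    have hx' : c ≤ ⟪u, x⟫_ℝ := hx.2
    have hpx := hperp x hx1
    have hpy := hperp y hy1
    set a := ⟪u, x⟫_ℝ with ha
    set d := ⟪u, y⟫_ℝ with hd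
    have h1 : ‖x - a • u‖ ≤ d := by
      refine abs_le_of_sq_le_sq' ?_ (by linarith) |>.2
      nlinarith
    have h2 : ‖y - d • u‖ ≤ a := by
      refine abs_le_of_sq_le_sq' ?_ (by linarith) |>.2
      nlinarith
    have h3 := neg_le_of_abs_le (abs_real_inner_le_norm (x - a • u) (y - d • u))
    have h4 : ‖x - a • u‖ * ‖y - d • u‖ ≤ d * a := by
      gcongr
      exact hs0.trans hy'
    have h5 : ⟪x - a • u, y - d • u⟫_ℝ = ⟪x, y⟫_ℝ - a * d := by
      rw [inner_sub_left, inner_sub_right, inner_sub_right, inner_smul_right, inner_smul_right,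
        real_inner_smul_left, real_inner_smul_left, real_inner_comm u x, ← ha, ← hd,
        real_inner_self_eq_norm_sq, hu]
      ring
    linarith

theorem two_mul_sphereHaar_lt_one {n : ℕ} (hn : 2 ≤ n) {A : Set (EuclideanSpace ℝ (Fin n))}
    (hA : A ⊆ Metric.sphere 0 1) (hpos : 0 < sphereHaar n (sphericalDual A)) :
    2 * sphereHaar n A < 1 := by
  have := isProbabilityMeasure_sphereHaar (n := n) (by omega)
  have hA' : closure A ⊆ Metric.sphere 0 1 := closure_minimal hA Metric.isClosed_sphere
  have hK := isCompact_of_isClosed_of_subset_sphere hA' isClosed_closure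
  rw [← sphericalDual_closure] at hpos
  obtain ⟨b, hb⟩ := exists_forall_inner_pos (by omega) hA' hpos
  obtain ⟨δ, hδ, hbδ⟩ : ∃ δ > 0, ∀ x ∈ closure A, δ ≤ ⟪x, b⟫_ℝ := by
    rcases (closure A).eq_empty_or_nonempty with h | h
    · exact ⟨1, one_pos, by simp [h]⟩
    · obtain ⟨x, hx, hmin⟩ := hK.exists_isMinOn h
        (f := fun x => ⟪x, b⟫_ℝ) (by fun_prop)
      exact ⟨_, hb x hx, fun y hy => hmin hy⟩
  obtain ⟨w, hw, hbw⟩ := exists_norm_eq_one_inner_eq_zero hn b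
  have hU : IsOpen {x : EuclideanSpace ℝ (Fin n) | |⟪x, b⟫_ℝ| < δ} :=
    isOpen_lt (by fun_prop) continuous_const
  have hUpos := sphereHaar_pos_of_isOpen hU hw (show |⟪w, b⟫_ℝ| < δ by
    rwa [real_inner_comm, hbw, abs_zero])
  have hneg : MeasurableSet {x : EuclideanSpace ℝ (Fin n) | -x ∈ closure A} :=
    (isClosed_closure.preimage continuous_neg).measurableSet
  calc 2 * sphereHaar n A
      ≤ sphereHaar n (closure A) + sphereHaar n {x | -x ∈ closure A} := by
        rw [sphereHaar_neg_preimage, two_mul]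
        exact add_le_add (measure_mono subset_closure) (measure_mono subset_closure)
    _ = sphereHaar n (closure A ∪ {x | -x ∈ closure A}) := by
        refine (measure_union (Set.disjoint_left.2 fun x hx hx' => ?_) hneg).symm
        have h1 := hbδ x hx
        have h2 : δ ≤ ⟪-x, b⟫_ℝ := hbδ _ hx'
        rw [inner_neg_left] at h2
        linarith
    _ < sphereHaar n (closure A ∪ {x | -x ∈ closure A}) +
        sphereHaar n {x : EuclideanSpace ℝ (Fin n) | |⟪x, b⟫_ℝ| < δ} :=
        ENNReal.lt_add_right (measure_ne_top _ _) hUpos.ne'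
    _ = sphereHaar n ((closure A ∪ {x | -x ∈ closure A}) ∪ {x | |⟪x, b⟫_ℝ| < δ}) := by
        refine (measure_union (Set.disjoint_left.2 fun x hx hx' => ?_) hU.measurableSet).symm
        have hx' := abs_lt.1 (show |⟪x, b⟫_ℝ| < δ from hx')
        rcases hx with hx | hx
        · have := hbδ x hx
          linarith
        · have h2 : δ ≤ ⟪-x, b⟫_ℝ := hbδ _ hx
          rw [inner_neg_left] at h2
          linarith
    _ ≤ 1 := prob_le_one

theorem pos_of_two_mul_sphereHaar_sphereCap_lt_one {n : ℕ} (hn : 1 ≤ n)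
    {u : EuclideanSpace ℝ (Fin n)} {c : ℝ} (h : 2 * sphereHaar n (sphereCap u c) < 1) : 0 < c := by
  by_contra! hc
  refine absurd h (not_lt.2 ?_)
  rw [← sphereHaar_sphere hn, two_mul]
  nth_rw 3 [← sphereHaar_neg_preimage]
  refine (measure_mono fun x hx => ?_).trans (measure_union_le _ _)
  rcases le_total 0 ⟪u, x⟫_ℝ with h0 | h0
  · exact Or.inl ⟨hx, hc.trans h0⟩
  · refine Or.inr ⟨by simpa using hx, ?_⟩
    show c ≤ ⟪u, -x⟫_ℝ
    rw [inner_neg_right]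
    linarith

theorem IsDualMaximal.exists_sphericalDual_eq_sphereCap {n : ℕ} (hn : 2 ≤ n)
    {A : Set (EuclideanSpace ℝ (Fin n))} (hA : A ⊆ Metric.sphere 0 1) (hc : IsClosed A)
    (hne : A.Nonempty) (hmax : IsDualMaximal A) (hpos : 0 < sphereHaar n (sphericalDual A)) :
    ∃ (e : EuclideanSpace ℝ (Fin n)) (l : ℝ), ‖e‖ = 1 ∧ 0 ≤ l ∧ l < 1 ∧
      sphericalDual A = sphereCap e l ∧ A ⊆ sphereCap e √(1 - l ^ 2) := by
  obtain ⟨e, l, hl, he, hd⟩ := hmax.exists_sphericalDual_eq hn hA hc hne hpos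
  have he0 : 0 < ‖e‖ := by
    refine lt_of_le_of_ne (norm_nonneg _) fun h => ?_
    rw [← h] at he
    nlinarith
  have hle : l < ‖e‖ := lt_of_pow_lt_pow_left₀ 2 he0.le (by linarith)
  have he1 : ‖‖e‖⁻¹ • e‖ = 1 := by rw [norm_smul, norm_inv, norm_norm, inv_mul_cancel₀ he0.ne']
  have h0 : 0 ≤ ‖e‖⁻¹ * l := by positivity
  have h1 : ‖e‖⁻¹ * l < 1 := by rwa [inv_mul_lt_one₀ he0]
  have hd' : sphericalDual A = sphereCap (‖e‖⁻¹ • e) (‖e‖⁻¹ * l) := by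
    rw [sphereCap_smul _ _ (inv_pos.2 he0)]
    exact hd
  refine ⟨_, _, he1, h0, h1, hd', ?_⟩
  rw [← sphericalDual_sphereCap he1 h0 h1.le, ← hd']
  exact fun x hx => ⟨hA hx, fun y hy => by rw [real_inner_comm]; exact hy.2 x hx⟩

theorem sphereHaar_sphericalDual_le {n : ℕ} (hn : 2 ≤ n) {u : EuclideanSpace ℝ (Fin n)}
    (hu : ‖u‖ = 1) {c : ℝ} (hc₀ : 0 < c) (hc₁ : c ≤ 1) {A : Set (EuclideanSpace ℝ (Fin n))}
    (hA : A ⊆ Metric.sphere 0 1) (hc : IsClosed A) (hne : A.Nonempty)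
    (h : sphereHaar n (sphereCap u c) ≤ sphereHaar n A) :
    sphereHaar n (sphericalDual A) ≤ sphereHaar n (sphereCap u √(1 - c ^ 2)) := by
  have hs1 : √(1 - c ^ 2) < 1 := by
    rw [Real.sqrt_lt' one_pos]
    nlinarith
  have hd := sphericalDual_sphereCap hu hc₀.le hc₁
  obtain ⟨A₁, hA₁, hA₁c, hA₁ne, hle, hmax⟩ := exists_maximal_sphericalDual (by omega)
    (sphereCap_subset_sphere u c) (isClosed_sphereCap u c) ⟨u, mem_sphereCap_self hu hc₁⟩
    (hd ▸ ⟨u, mem_sphereCap_self hu hs1.le⟩)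
  refine (hmax A hA hc hne h).trans ?_
  have hpos : 0 < sphereHaar n (sphericalDual A₁) := by
    refine (sphereHaar_sphereCap_pos hu hs1).trans_le ?_
    rw [← hd]
    exact hmax _ (sphereCap_subset_sphere u c) (isClosed_sphereCap u c)
      ⟨u, mem_sphereCap_self hu hc₁⟩ le_rfl
  have hmax' : IsDualMaximal A₁ := fun A' h1 h2 h3 h4 => hmax A' h1 h2 h3 (hle.trans h4)
  obtain ⟨e, l, he, hl₀, hl₁, hdA, hsub⟩ :=
    hmax'.exists_sphericalDual_eq_sphereCap hn hA₁ hA₁c hA₁ne hpos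
  have hue : ‖u‖ = ‖e‖ := by rw [hu, he]
  have h1 : √(1 - l ^ 2) ≤ c := by
    by_contra! hlt
    have h2 : √(1 - l ^ 2) ≤ 1 := Real.sqrt_le_one.2 (by nlinarith)
    refine absurd (hle.trans (measure_mono hsub)) (not_le.2 ?_)
    rw [sphereHaar_sphereCap_congr hue]
    exact sphereHaar_sphereCap_lt hn he (by linarith) (hlt.trans_le h2) hlt
  have h2 : √(1 - c ^ 2) ≤ l := by
    rw [Real.sqrt_le_left hl₀]
    have := (Real.sqrt_le_left hc₀.le).1 h1
    linarith
  rw [hdA, sphereHaar_sphereCap_congr hue]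
  exact measure_mono (sphereCap_anti e h2)

theorem sphereCap_injOn {n : ℕ} (hn : 2 ≤ n) {u v : EuclideanSpace ℝ (Fin n)} (hu : ‖u‖ = 1)
    (hv : ‖v‖ = 1) {c d : ℝ} (hc₀ : 0 ≤ c) (hc₁ : c ≤ 1) (hd₀ : 0 ≤ d) (hd₁ : d ≤ 1)
    (h : sphereHaar n (sphereCap u c) = sphereHaar n (sphereCap v d)) : c = d := by
  rw [sphereHaar_sphereCap_congr (hu.trans hv.symm)] at h
  rcases lt_trichotomy c d with hcd | hcd | hcd
  · exact absurd h (sphereHaar_sphereCap_lt hn hv (by linarith) (by linarith) hcd).ne'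
  · exact hcd
  · exact absurd h (sphereHaar_sphereCap_lt hn hv (by linarith) (by linarith) hcd).ne

theorem exists_mem_isOpen_lt_inner {n : ℕ} {e w : EuclideanSpace ℝ (Fin n)} (he : ‖e‖ = 1)
    {c : ℝ} (hc₀ : 0 < c) (hc₁ : c < 1) (hw : w ∈ sphereCap e c)
    {U : Set (EuclideanSpace ℝ (Fin n))} (hU : IsOpen U) (hwU : w ∈ U) :
    ∃ x ∈ U, ‖x‖ = 1 ∧ c < ⟪e, x⟫_ℝ := by
  have hw1 : ‖w‖ = 1 := mem_sphere_zero_iff_norm.1 hw.1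
  rcases eq_or_lt_of_le (show c ≤ ⟪e, w⟫_ℝ from hw.2) with hcw | hcw
  swap
  · exact ⟨w, hwU, hw1, hcw⟩
  have hcont : ContinuousAt (fun t : ℝ => ‖w + t • e‖⁻¹ • (w + t • e)) 0 := by
    have : ‖w + (0 : ℝ) • e‖ ≠ 0 := by simp [hw1]
    fun_prop (disch := assumption)
  have h1 : ∀ᶠ t in 𝓝[>] (0 : ℝ), ‖w + t • e‖⁻¹ • (w + t • e) ∈ U :=
    (hcont.eventually (hU.mem_nhds (by simpa [hw1] using hwU))).filter_mono nhdsWithin_le_nhds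
  obtain ⟨t, ht, ht0⟩ := (h1.and self_mem_nhdsWithin).exists
  have ht0 : 0 < t := ht0
  have hsq : ‖w + t • e‖ ^ 2 = 1 + 2 * c * t + t ^ 2 := by
    rw [norm_add_sq_real, inner_smul_right, real_inner_comm, ← hcw, norm_smul, he, hw1,
      Real.norm_eq_abs, mul_one, sq_abs]
    ring
  have hpos : 0 < ‖w + t • e‖ := by
    refine lt_of_le_of_ne (norm_nonneg _) fun h0 => ?_
    rw [← h0] at hsq
    have : 0 < c * t := by positivity
    nlinarith
  refine ⟨_, ht, ?_, ?_⟩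
  · rw [norm_smul, norm_inv, norm_norm, inv_mul_cancel₀ hpos.ne']
  · rw [inner_smul_right, inner_add_right, inner_smul_right, real_inner_self_eq_norm_sq, he, ← hcw,
      inv_mul_eq_div, lt_div_iff₀ hpos]
    refine lt_of_pow_lt_pow_left₀ 2 (by positivity) ?_
    rw [mul_pow, hsq]
    have h2 : 0 < 1 - c ^ 2 := by nlinarith
    have h3 : 0 < c * t * (1 - c ^ 2) := by positivity
    have h4 : 0 < t ^ 2 * (1 - c ^ 2) := by positivity
    nlinarith

theorem exists_eq_sphereCap_of_sphereHaar_eq {n : ℕ} (hn : 2 ≤ n) {u : EuclideanSpace ℝ (Fin n)}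
    (hu : ‖u‖ = 1) {c : ℝ} (hc₀ : 0 < c) (hc₁ : c ≤ 1) {A : Set (EuclideanSpace ℝ (Fin n))}
    (hA : A ⊆ Metric.sphere 0 1) (hc : IsClosed A) (hne : A.Nonempty)
    (h : sphereHaar n A = sphereHaar n (sphereCap u c))
    (hd : sphereHaar n (sphericalDual A) = sphereHaar n (sphereCap u √(1 - c ^ 2))) :
    ∃ e : EuclideanSpace ℝ (Fin n), ‖e‖ = 1 ∧ A = sphereCap e c := by
  have := isProbabilityMeasure_sphereHaar (n := n) (by omega)
  have hs1 : √(1 - c ^ 2) < 1 := by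
    rw [Real.sqrt_lt' one_pos]
    nlinarith
  have hmax : IsDualMaximal A := fun A' h1 h2 h3 h4 => by
    rw [hd]
    exact sphereHaar_sphericalDual_le hn hu hc₀ hc₁ h1 h2 h3 (h ▸ h4)
  obtain ⟨e, l, he, hl₀, hl₁, hdA, hsub⟩ := hmax.exists_sphericalDual_eq_sphereCap hn hA hc hne
    (hd ▸ sphereHaar_sphereCap_pos hu hs1)
  have hl : l = √(1 - c ^ 2) := sphereCap_injOn hn he hu hl₀ hl₁.le (Real.sqrt_nonneg _) hs1.le
    (hdA ▸ hd)
  rw [hl, Real.sq_sqrt (by nlinarith), sub_sub_cancel, Real.sqrt_sq hc₀.le] at hsub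
  refine ⟨e, he, hsub.antisymm fun w hw => ?_⟩
  have hw1 : ‖w‖ = 1 := mem_sphere_zero_iff_norm.1 hw.1
  by_contra hwA
  rcases hc₁.eq_or_lt with rfl | hc₁
  · have huniq : ∀ v ∈ sphereCap e 1, v = e := by
      intro v hv
      have hv1 : ‖v‖ = 1 := mem_sphere_zero_iff_norm.1 hv.1
      by_contra hve
      exact absurd ((inner_lt_one_iff_real_of_norm_eq_one he hv1).2 (Ne.symm hve)) (not_lt.2 hv.2)
    obtain ⟨x, hx⟩ := hne
    rw [huniq w hw, ← huniq x (hsub hx)] at hwA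
    exact hwA hx
  · obtain ⟨x, hxA, hx, hcx⟩ := exists_mem_isOpen_lt_inner he hc₀ hc₁ hw hc.isOpen_compl hwA
    have hU : IsOpen (Aᶜ ∩ {x : EuclideanSpace ℝ (Fin n) | c < ⟪e, x⟫_ℝ}) :=
      hc.isOpen_compl.inter (isOpen_lt continuous_const (by fun_prop))
    have hpos := sphereHaar_pos_of_isOpen hU hx ⟨hxA, hcx⟩
    have hle : sphereHaar n A + sphereHaar n (Aᶜ ∩ {x | c < ⟪e, x⟫_ℝ}) ≤ sphereHaar n A := by
      rw [← sphereHaar_inter_sphere (Aᶜ ∩ _), ← measure_union' _ hc.measurableSet]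
      · rw [h, sphereHaar_sphereCap_congr (hu.trans he.symm)]
        refine measure_mono ?_
        rintro y (hy | ⟨⟨-, hy⟩, hy'⟩)
        · exact hsub hy
        · exact ⟨hy', le_of_lt (show c < ⟪e, y⟫_ℝ from hy)⟩
      · exact Set.disjoint_left.2 fun y hy hy' => hy'.1.1 hy
    exact absurd hle (not_le.2 (ENNReal.lt_add_right (measure_ne_top _ _) hpos.ne'))

theorem eq_or_eq_neg_of_norm_eq_one {x y : EuclideanSpace ℝ (Fin 1)} (hx : ‖x‖ = 1)
    (hy : ‖y‖ = 1) : x = y ∨ x = -y := by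
  have h : ∀ z : EuclideanSpace ℝ (Fin 1), ‖z‖ = |z 0| := fun z => by
    rw [EuclideanSpace.norm_eq]
    simp [Real.sqrt_sq_eq_abs]
  rw [h] at hx hy
  rcases abs_eq_abs.1 (hx.trans hy.symm) with h | h
  · left
    ext i
    rw [Subsingleton.elim i 0, h]
  · right
    ext i
    rw [Subsingleton.elim i 0, h]
    rfl

theorem sphereHaar_singleton_neg {n : ℕ} (p : EuclideanSpace ℝ (Fin n)) :
    sphereHaar n {-p} = sphereHaar n {p} := by
  rw [← sphereHaar_neg_preimage {p}]
  congr 1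
  ext x
  exact neg_eq_iff_eq_neg.symm

theorem one_le_two_mul_sphereHaar_one {A : Set (EuclideanSpace ℝ (Fin 1))}
    {p : EuclideanSpace ℝ (Fin 1)} (hp : ‖p‖ = 1) (hpA : p ∈ A) : 1 ≤ 2 * sphereHaar 1 A := by
  calc 1 = sphereHaar 1 (Metric.sphere 0 1) := (sphereHaar_sphere le_rfl).symm
    _ ≤ sphereHaar 1 ({p} ∪ {-p}) :=
        measure_mono fun x hx => eq_or_eq_neg_of_norm_eq_one (mem_sphere_zero_iff_norm.1 hx) hp
    _ ≤ sphereHaar 1 {p} + sphereHaar 1 {-p} := measure_union_le _ _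
    _ = 2 * sphereHaar 1 {p} := by rw [sphereHaar_singleton_neg, two_mul]
    _ ≤ 2 * sphereHaar 1 A := by gcongr; simpa using hpA

theorem sphereHaar_sphericalDual_le_one {A C : Set (EuclideanSpace ℝ (Fin 1))}
    (hA : A ⊆ Metric.sphere 0 1) (hAne : A.Nonempty) (hC : IsSphericalCap C)
    (hAC : sphereHaar 1 A = sphereHaar 1 C) :
    sphereHaar 1 (sphericalDual A) ≤ sphereHaar 1 (sphericalDual C) := by
  have := isProbabilityMeasure_sphereHaar (n := 1) le_rfl
  obtain ⟨p, hp⟩ := hAne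
  have hp1 : ‖p‖ = 1 := mem_sphere_zero_iff_norm.1 (hA hp)
  have hpp : ⟪p, p⟫_ℝ = 1 := by rw [real_inner_self_eq_norm_sq, hp1, one_pow]
  have hdual : sphericalDual A ⊆ {p} := by
    rintro y ⟨hy, hy'⟩
    rcases eq_or_eq_neg_of_norm_eq_one (mem_sphere_zero_iff_norm.1 hy) hp1 with h | h
    · exact h
    · have := hy' p hp
      rw [h, inner_neg_right, hpp] at this
      linarith
  by_cases hneg : -p ∈ A
  · have : sphericalDual A = ∅ := by
      refine Set.eq_empty_of_forall_notMem fun y hy => ?_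
      have h1 := hy.2 _ hneg
      rw [hdual hy, inner_neg_left, hpp] at h1
      linarith
    rw [this, measure_empty]
    exact zero_le
  have hAp : A = {p} := by
    refine Set.Subset.antisymm (fun x hx => ?_) (by simpa using hp)
    rcases eq_or_eq_neg_of_norm_eq_one (mem_sphere_zero_iff_norm.1 (hA hx)) hp1 with h | h
    · exact h
    · exact absurd (h ▸ hx) hneg
  obtain ⟨q, c, hq, hc, rfl⟩ := hC.exists_eq_sphereCap
  have hqC := mem_sphereCap_self hq hc
  have hqneg : -q ∉ sphereCap q c := by
    intro hmem
    have h1 : sphereHaar 1 {p} = 1 := by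
      refine le_antisymm prob_le_one ?_
      rw [← hAp, hAC, ← sphereHaar_sphere (n := 1) le_rfl]
      refine measure_mono fun x hx => ?_
      rcases eq_or_eq_neg_of_norm_eq_one (mem_sphere_zero_iff_norm.1 hx) hq with h | h
      · exact h ▸ hqC
      · exact h ▸ hmem
    have h2 : sphereHaar 1 ({p} ∪ {-p}) = sphereHaar 1 {p} + sphereHaar 1 {-p} := by
      refine measure_union ?_ (measurableSet_singleton _)
      rw [Set.disjoint_singleton]
      intro h
      exact hneg (h ▸ hp)
    rw [sphereHaar_singleton_neg, h1] at h2
    have h3 : (1 : ℝ≥0∞) + 1 ≤ 1 := h2 ▸ prob_le_one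
    norm_num at h3
  have hqdual : q ∈ sphericalDual (sphereCap q c) := by
    refine ⟨hqC.1, fun x hx => ?_⟩
    rcases eq_or_eq_neg_of_norm_eq_one (mem_sphere_zero_iff_norm.1 hx.1) hq with h | h
    · rw [h]
      exact real_inner_self_nonneg
    · exact absurd (h ▸ hx) hqneg
  have hpq : sphereHaar 1 {p} = sphereHaar 1 {q} := by
    rcases eq_or_eq_neg_of_norm_eq_one hp1 hq with rfl | rfl
    · rfl
    · exact sphereHaar_singleton_neg q
  calc sphereHaar 1 (sphericalDual A) ≤ sphereHaar 1 {p} := measure_mono hdual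
    _ = sphereHaar 1 {q} := hpq
    _ ≤ _ := measure_mono (by simpa using hqdual)

/-- Gao–Hug–Schneider spherical Blaschke–Santaló inequality: if `A ⊆ S^{n-1}` is nonempty
and measurable and `C` is a spherical cap with `σ(A) = σ(C)`, then `σ(A°) ≤ σ(C°)`;
if moreover `A` is closed and `σ(A) < 1/2`, equality holds iff `A` is a spherical cap. -/
theorem spherical_blaschke_santalo (n : ℕ) (A C : Set (EuclideanSpace ℝ (Fin n)))
    (hA : A ⊆ Metric.sphere (0 : EuclideanSpace ℝ (Fin n)) 1)
    (hAne : A.Nonempty) (hAm : MeasurableSet A)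
    (hC : IsSphericalCap C) (hAC : sphereHaar n A = sphereHaar n C) :
    sphereHaar n (sphericalPolar A) ≤ sphereHaar n (sphericalPolar C) ∧
    (IsClosed A → sphereHaar n A < 1 / 2 →
      (sphereHaar n (sphericalPolar A) = sphereHaar n (sphericalPolar C) ↔
        IsSphericalCap A)) := by
  rw [sphereHaar_sphericalPolar, sphereHaar_sphericalPolar]
  have hhalf : ∀ {t : ℝ≥0∞}, t < 1 / 2 → 2 * t < 1 := fun ht => by
    rw [mul_comm]
    exact ENNReal.mul_lt_of_lt_div ht
  obtain ⟨p, hp⟩ := hAne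
  have hp1 : ‖p‖ = 1 := mem_sphere_zero_iff_norm.1 (hA hp)
  obtain rfl | rfl | hn : n = 0 ∨ n = 1 ∨ 2 ≤ n := by omega
  · simp [Subsingleton.elim p 0] at hp1
  · exact ⟨sphereHaar_sphericalDual_le_one hA ⟨p, hp⟩ hC hAC, fun _ h =>
      absurd (hhalf h) (not_lt.2 (one_le_two_mul_sphereHaar_one hp1 hp))⟩
  obtain ⟨u, c, hu, hc₁, rfl⟩ := hC.exists_eq_sphereCap
  by_cases hlt : 2 * sphereHaar n (sphereCap u c) < 1
  · have hc₀ := pos_of_two_mul_sphereHaar_sphereCap_lt_one (by omega) hlt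
    rw [sphericalDual_sphereCap hu hc₀.le hc₁]
    refine ⟨?_, fun hcl _ => ⟨fun h => ?_, fun h => ?_⟩⟩
    · rw [← sphericalDual_closure]
      exact sphereHaar_sphericalDual_le hn hu hc₀ hc₁ (closure_minimal hA Metric.isClosed_sphere)
        isClosed_closure ⟨p, subset_closure hp⟩ (hAC ▸ measure_mono subset_closure)
    · obtain ⟨e, he, rfl⟩ := exists_eq_sphereCap_of_sphereHaar_eq hn hu hc₀ hc₁ hA hcl ⟨p, hp⟩ hAC h
      exact isSphericalCap_sphereCap he hc₁
    · obtain ⟨v, d, hv, hd₁, rfl⟩ := h.exists_eq_sphereCap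
      have hd₀ := pos_of_two_mul_sphereHaar_sphereCap_lt_one (by omega) (hAC ▸ hlt)
      obtain rfl := sphereCap_injOn hn hv hu hd₀.le hd₁ hc₀.le hc₁ hAC
      rw [sphericalDual_sphereCap hv hd₀.le hd₁]
      exact sphereHaar_sphereCap_congr (hv.trans hu.symm) _
  · refine ⟨?_, fun _ h => absurd (hhalf h) (hAC ▸ hlt)⟩
    have : sphereHaar n (sphericalDual A) = 0 := by
      by_contra h
      exact hlt (hAC ▸ two_mul_sphereHaar_lt_one hn hA (pos_iff_ne_zero.2 h))
    rw [this]
    exact zero_le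
end
end

section
/- Bourgain–Milman inequality: there exists a universal constant c > 0 such that for every n ≥ 1 and every centrally symmetric convex body K in ℝⁿ, one has (vol(K)·vol(K*))^{1/n} ≥ c/n; equivalently vol(K)·vol(K*) ≥ (c/n)ⁿ. -/
open MeasureTheory Filter
open scoped InnerProductSpace Pointwise NNReal ENNReal Topology

noncomputable section

/-- The polar of a set `K` in Euclidean space: `{y | ⟨x,y⟩ ≤ 1 for all x ∈ K}`. -/
def polarSet {n : ℕ} (K : Set (EuclideanSpace ℝ (Fin n))) : Set (EuclideanSpace ℝ (Fin n)) :=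
  {y | ∀ x ∈ K, ⟪x, y⟫_ℝ ≤ 1}

/-- A convex body: a compact convex set with nonempty interior. -/
structure IsConvexBody {n : ℕ} (K : Set (EuclideanSpace ℝ (Fin n))) : Prop where
  convex : Convex ℝ K
  isCompact : IsCompact K
  nonempty_interior : (interior K).Nonempty

section ChangeOfVariables

variable {V : Type*} [NormedAddCommGroup V] [NormedSpace ℝ V] [FiniteDimensional ℝ V]
  [MeasurableSpace V] [BorelSpace V]

/-- A Lipschitz self-map of a finite-dimensional space sends null sets to null sets. -/
lemma LipschitzWith.addHaar_image_eq_zero (μ : Measure V) [μ.IsAddHaarMeasure] {C : ℝ≥0}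
    {F : V → V} (hF : LipschitzWith C F) {s : Set V} (hs : μ s = 0) : μ (F '' s) = 0 := by
  have h1 : (μH[Module.finrank ℝ V] : Measure V) ≪ μ :=
    Measure.absolutelyContinuous_isAddHaarMeasure _ _
  have h2 : μ ≪ (μH[Module.finrank ℝ V] : Measure V) :=
    Measure.absolutelyContinuous_isAddHaarMeasure _ _
  refine h2 (le_antisymm ?_ (zero_le))
  refine (hF.hausdorffMeasure_image_le (Nat.cast_nonneg _) s).trans ?_
  rw [h1 hs, mul_zero]

/-- Change of variables along a Lipschitz bijection. -/
lemma integral_eq_integral_abs_det_smul_of_lipschitz (μ : Measure V) [μ.IsAddHaarMeasure]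
    {C : ℝ≥0} {F : V → V} (hF : LipschitzWith C F) (hbij : F.Bijective) {F' : V → V →L[ℝ] V}
    (hF' : ∀ᵐ x ∂μ, HasFDerivAt F (F' x) x) (g : V → ℂ) :
    ∫ w, g w ∂μ = ∫ x, |(F' x).det| • g (F x) ∂μ := by
  obtain ⟨t, ht, htm, ht0⟩ := exists_measurable_superset_of_null (ae_iff.1 hF')
  have hd : ∀ x ∈ tᶜ, HasFDerivAt F (F' x) x := fun x hx => by
    by_contra h
    exact hx (ht h)
  have h := integral_image_eq_integral_abs_det_fderiv_smul μ htm.compl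
    (fun x hx => (hd x hx).hasFDerivWithinAt) hbij.1.injOn g
  have hi : μ (F '' tᶜ)ᶜ = 0 := by
    rw [Set.image_compl_eq hbij, compl_compl]
    exact hF.addHaar_image_eq_zero μ ht0
  have ht' : μ tᶜᶜ = 0 := by rwa [compl_compl]
  have h1 : ∀ᵐ x ∂μ, x ∈ F '' tᶜ := mem_ae_iff.2 hi
  have h2 : ∀ᵐ x ∂μ, x ∈ tᶜ := mem_ae_iff.2 ht'
  rwa [Measure.restrict_eq_self_of_ae_mem h1, Measure.restrict_eq_self_of_ae_mem h2] at h

end ChangeOfVariables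

section PairMap

variable {E : Type*} [NormedAddCommGroup E] [InnerProductSpace ℝ E]

/-- The map `(z, z') ↦ (z + R z', z' + R z)` on `E × E`. -/
def pairMap (R : E → E) (p : E × E) : E × E := (p.1 + R p.2, p.2 + R p.1)

lemma approximatesLinearOn_pairMap {R : E → E} {r : ℝ≥0} (hR : LipschitzWith r R) :
    ApproximatesLinearOn (pairMap R) (ContinuousLinearEquiv.refl ℝ (E × E) : E × E →L[ℝ] E × E)
      Set.univ r := by
  intro p _ q _
  have h : pairMap R p - pairMap R q -
      (ContinuousLinearEquiv.refl ℝ (E × E) : E × E →L[ℝ] E × E) (p - q)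
      = (R p.2 - R q.2, R p.1 - R q.1) := by
    ext <;> simp [pairMap] <;> abel
  rw [h, Prod.norm_def, Prod.norm_def, max_comm]
  have h1 := hR.norm_sub_le p.1 q.1
  have h2 := hR.norm_sub_le p.2 q.2
  refine max_le (h1.trans ?_) (h2.trans ?_)
  · exact mul_le_mul_of_nonneg_left (le_max_left _ _) r.2
  · exact mul_le_mul_of_nonneg_left (le_max_right _ _) r.2

/-- If `R` is a contraction then `pairMap R` is a homeomorphism. -/
def pairHomeo [CompleteSpace E] [Nontrivial E] {R : E → E} {r : ℝ≥0} (hR : LipschitzWith r R)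
    (hr : r < 1) : E × E ≃ₜ E × E :=
  (approximatesLinearOn_pairMap hR).toHomeomorph _ (Or.inr (by
    have : ‖((ContinuousLinearEquiv.refl ℝ (E × E)).symm : E × E →L[ℝ] E × E)‖₊ = 1 :=
      ContinuousLinearMap.nnnorm_id
    rw [this]
    simpa using hr))

/-- The hyperbolic scaling `(z, z') ↦ (l z, l⁻¹ z')`. -/
def hypScale (E : Type*) [NormedAddCommGroup E] [InnerProductSpace ℝ E] (l : ℝ) :
    E × E →L[ℝ] E × E :=
  (l • ContinuousLinearMap.id ℝ E).prodMap (l⁻¹ • ContinuousLinearMap.id ℝ E)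

lemma hypScale_apply (l : ℝ) (p : E × E) : hypScale E l p = (l • p.1, l⁻¹ • p.2) := rfl

lemma det_hypScale [FiniteDimensional ℝ E] {l : ℝ} (hl : l ≠ 0) : (hypScale E l).det = 1 := by
  have h : (hypScale E l : E × E →ₗ[ℝ] E × E) =
      (l • LinearMap.id : E →ₗ[ℝ] E).prodMap (l⁻¹ • LinearMap.id) := rfl
  rw [ContinuousLinearMap.det, h, LinearMap.det_prodMap, LinearMap.det_smul, LinearMap.det_smul,
    LinearMap.det_id, mul_one, mul_one, ← mul_pow, mul_inv_cancel₀ hl, one_pow]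

lemma bijective_hypScale {l : ℝ} (hl : l ≠ 0) : Function.Bijective (hypScale E l) := by
  refine Function.bijective_iff_has_inverse.2 ⟨hypScale E l⁻¹, fun p => ?_, fun p => ?_⟩ <;>
    simp [hypScale_apply, smul_smul, hl]

variable [FiniteDimensional ℝ E] [MeasurableSpace E] [BorelSpace E]

/-- Conjugating the hyperbolic scaling by `pairMap R` preserves integrals. -/
lemma integral_pairHomeo_hypScale [Nontrivial E] {R : E → E} {r : ℝ≥0} (hR : LipschitzWith r R)
    (hr : r < 1) (hhom : ∀ t : ℝ, 0 < t → ∀ z, R (t • z) = t • R z) {l : ℝ} (hl : 0 < l)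
    (g : E × E → ℂ) :
    ∫ w, g (pairMap R (hypScale E l ((pairHomeo hR hr).symm w))) = ∫ w, g w := by
  have hR' : ∀ᵐ z : E, HasFDerivAt R (fderiv ℝ R z) z := by
    filter_upwards [hR.ae_differentiableAt (μ := volume)] with z hz using hz.hasFDerivAt
  let DF : E × E → E × E →L[ℝ] E × E := fun p =>
    (ContinuousLinearMap.fst ℝ E E + (fderiv ℝ R p.2).comp (ContinuousLinearMap.snd ℝ E E)).prod
      (ContinuousLinearMap.snd ℝ E E + (fderiv ℝ R p.1).comp (ContinuousLinearMap.fst ℝ E E))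
  have hae : ∀ᵐ p : E × E, HasFDerivAt R (fderiv ℝ R p.1) p.1 ∧
      HasFDerivAt R (fderiv ℝ R p.2) p.2 :=
    (Measure.quasiMeasurePreserving_fst.ae hR').and (Measure.quasiMeasurePreserving_snd.ae hR')
  have hD : ∀ᵐ p : E × E, HasFDerivAt (pairMap R) (DF p) p := by
    filter_upwards [hae] with p ⟨h1, h2⟩
    exact (hasFDerivAt_fst.add (h2.comp p hasFDerivAt_snd)).prodMk
      (hasFDerivAt_snd.add (h1.comp p hasFDerivAt_fst))
  have hscale : ∀ p, pairMap R (hypScale E l p) =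
      (l • p.1 + l⁻¹ • R p.2, l⁻¹ • p.2 + l • R p.1) := fun p => by
    simp [pairMap, hypScale_apply, hhom l hl, hhom l⁻¹ (inv_pos.2 hl)]
  have hD2 : ∀ᵐ p : E × E, HasFDerivAt (pairMap R ∘ hypScale E l)
      ((DF p).comp (hypScale E l)) p := by
    filter_upwards [hae] with p ⟨h1, h2⟩
    have h := ((hasFDerivAt_fst.const_smul l).add
      ((h2.comp p hasFDerivAt_snd).const_smul l⁻¹)).prodMk
      ((hasFDerivAt_snd.const_smul l⁻¹).add ((h1.comp p hasFDerivAt_fst).const_smul l))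
    have e1 : (pairMap R ∘ hypScale E l) =
        fun p => (l • p.1 + l⁻¹ • R p.2, l⁻¹ • p.2 + l • R p.1) := funext hscale
    rw [e1]
    convert! h using 1
    ext <;> simp [DF, hypScale_apply]
  have hLip : LipschitzWith (1 + r) (pairMap R) := by
    refine LipschitzWith.of_dist_le_mul fun p q => ?_
    have h2 := approximatesLinearOn_pairMap hR p trivial q trivial
    simp only [ContinuousLinearEquiv.coe_refl, ContinuousLinearMap.coe_id', id_eq] at h2
    rw [dist_eq_norm, dist_eq_norm]
    calc ‖pairMap R p - pairMap R q‖ = ‖(pairMap R p - pairMap R q - (p - q)) + (p - q)‖ := by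
          rw [sub_add_cancel]
      _ ≤ r * ‖p - q‖ + ‖p - q‖ := (norm_add_le _ _).trans (by gcongr)
      _ = _ := by push_cast; ring
  have hbij : (pairMap R).Bijective := (pairHomeo hR hr).bijective
  have hvol : (volume : Measure (E × E)).IsAddHaarMeasure :=
    Measure.prod.instIsAddHaarMeasure volume volume
  rw [integral_eq_integral_abs_det_smul_of_lipschitz volume hLip hbij hD,
    integral_eq_integral_abs_det_smul_of_lipschitz volume
      (hLip.comp (hypScale E l).lipschitz) (hbij.comp (bijective_hypScale hl.ne')) hD2 g]
  refine integral_congr_ae (Eventually.of_forall fun p => ?_)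
  have h1 : (pairHomeo hR hr).symm (pairMap R p) = p := (pairHomeo hR hr).symm_apply_apply p
  have h2 : ((DF p).comp (hypScale E l)).det = (DF p).det := by
    have := det_hypScale (E := E) hl.ne'
    rw [ContinuousLinearMap.det] at this ⊢
    rw [ContinuousLinearMap.toLinearMap_comp, LinearMap.det_comp, this, mul_one,
      ContinuousLinearMap.det]
  simp only [h1, h2, Function.comp]

end PairMap

section Analytic

/-- Analyticity in `ζ` of the integral of `exp (-(A ζ + B ζ⁻¹ + C))`, for functions `A`, `B` of
quadratic growth, at a point where the exponent is coercive. -/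
lemma analyticAt_integral_cexp {V : Type*} [NormedAddCommGroup V] [MeasurableSpace V]
    [BorelSpace V] [SecondCountableTopology V] (μ : Measure V)
    (hμ : ∀ c : ℝ, 0 < c → Integrable (fun w : V => Real.exp (-(c * ‖w‖ ^ 2))) μ)
    {A B C : V → ℂ} (hA : Continuous A) (hB : Continuous B) (hC : Continuous C) {M : ℝ}
    (hAM : ∀ w, ‖A w‖ ≤ M * ‖w‖ ^ 2) (hBM : ∀ w, ‖B w‖ ≤ M * ‖w‖ ^ 2) {δ : ℝ} (hδ : 0 < δ)
    {z : ℂ} (hz : z ≠ 0) (hre : ∀ w, δ * ‖w‖ ^ 2 ≤ (A w * z + B w * z⁻¹ + C w).re) :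
    AnalyticAt ℂ (fun ζ => ∫ w, Complex.exp (-(A w * ζ + B w * ζ⁻¹ + C w)) ∂μ) z := by
  let P : ℂ → Prop := fun ζ => ζ ≠ 0 ∧ |M| * ‖ζ - z‖ ≤ δ / 4 ∧ |M| * ‖ζ⁻¹ - z⁻¹‖ ≤ δ / 4 ∧
    ‖ζ⁻¹‖ ≤ ‖z⁻¹‖ + 1
  have hP : ∀ᶠ ζ in 𝓝 z, P ζ := by
    have hinv : ContinuousAt (fun ζ : ℂ => ζ⁻¹) z := continuousAt_inv₀ hz
    have t1 : Tendsto (fun ζ : ℂ => |M| * ‖ζ - z‖) (𝓝 z) (𝓝 0) := by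
      have : ContinuousAt (fun ζ : ℂ => |M| * ‖ζ - z‖) z := by fun_prop
      simpa [ContinuousAt] using this
    have t2 : Tendsto (fun ζ : ℂ => |M| * ‖ζ⁻¹ - z⁻¹‖) (𝓝 z) (𝓝 0) := by
      have : ContinuousAt (fun ζ : ℂ => |M| * ‖ζ⁻¹ - z⁻¹‖) z := by fun_prop (disch := exact hz)
      simpa [ContinuousAt] using this
    have t3 : Tendsto (fun ζ : ℂ => ‖ζ⁻¹‖) (𝓝 z) (𝓝 ‖z⁻¹‖) := hinv.norm
    filter_upwards [isOpen_ne.mem_nhds hz, t1.eventually_le_const (by positivity : 0 < δ / 4),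
      t2.eventually_le_const (by positivity : 0 < δ / 4),
      t3.eventually_le_const (lt_add_one _)] with ζ h1 h2 h3 h4 using ⟨h1, h2, h3, h4⟩
  have hPre : ∀ ζ, P ζ → ∀ w, δ / 2 * ‖w‖ ^ 2 ≤ (A w * ζ + B w * ζ⁻¹ + C w).re := by
    rintro ζ ⟨-, h1, h2, -⟩ w
    have hM : M ≤ |M| := le_abs_self M
    have e : A w * ζ + B w * ζ⁻¹ + C w = (A w * z + B w * z⁻¹ + C w) +
        (A w * (ζ - z) + B w * (ζ⁻¹ - z⁻¹)) := by ring
    have b1 : ‖A w * (ζ - z)‖ ≤ δ / 4 * ‖w‖ ^ 2 := by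
      rw [norm_mul]
      calc ‖A w‖ * ‖ζ - z‖ ≤ (|M| * ‖w‖ ^ 2) * ‖ζ - z‖ := by
            gcongr; exact (hAM w).trans (by gcongr)
        _ = (|M| * ‖ζ - z‖) * ‖w‖ ^ 2 := by ring
        _ ≤ _ := by gcongr
    have b2 : ‖B w * (ζ⁻¹ - z⁻¹)‖ ≤ δ / 4 * ‖w‖ ^ 2 := by
      rw [norm_mul]
      calc ‖B w‖ * ‖ζ⁻¹ - z⁻¹‖ ≤ (|M| * ‖w‖ ^ 2) * ‖ζ⁻¹ - z⁻¹‖ := by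
            gcongr; exact (hBM w).trans (by gcongr)
        _ = (|M| * ‖ζ⁻¹ - z⁻¹‖) * ‖w‖ ^ 2 := by ring
        _ ≤ _ := by gcongr
    have b3 := (abs_le.1 ((Complex.abs_re_le_norm _).trans b1)).1
    have b4 := (abs_le.1 ((Complex.abs_re_le_norm _).trans b2)).1
    rw [e, Complex.add_re, Complex.add_re (A w * (ζ - z))]
    linarith [hre w]
  rw [Complex.analyticAt_iff_eventually_differentiableAt]
  filter_upwards [hP.eventually_nhds] with ζ hζ
  have hcont : ∀ ξ : ℂ, Continuous fun w => Complex.exp (-(A w * ξ + B w * ξ⁻¹ + C w)) := by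
    intro ξ; fun_prop
  have hnorm : ∀ ξ, P ξ → ∀ w, ‖Complex.exp (-(A w * ξ + B w * ξ⁻¹ + C w))‖ ≤
      Real.exp (-(δ / 2 * ‖w‖ ^ 2)) := by
    intro ξ hξ w
    rw [Complex.norm_exp, Complex.neg_re]
    exact Real.exp_le_exp.2 (neg_le_neg (hPre ξ hξ w))
  set L : ℝ := 1 + (‖z⁻¹‖ + 1) ^ 2
  refine (hasDerivAt_integral_of_dominated_loc_of_deriv_le (𝕜 := ℂ) (s := {ξ | P ξ})
    (F := fun ξ w => Complex.exp (-(A w * ξ + B w * ξ⁻¹ + C w)))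
    (F' := fun ξ w => Complex.exp (-(A w * ξ + B w * ξ⁻¹ + C w)) *
      (-(A w * 1 + B w * (-(ξ ^ 2)⁻¹))))
    (bound := fun w => |M| * L * (4 / δ) * Real.exp (-(δ / 4 * ‖w‖ ^ 2)))
    hζ (Eventually.of_forall fun ξ => (hcont ξ).aestronglyMeasurable) ?_ ?_ ?_ ?_ ?_).2.differentiableAt
  · exact (hμ (δ / 2) (by positivity)).mono' (hcont ζ).aestronglyMeasurable
      (Eventually.of_forall (hnorm ζ hζ.self_of_nhds))
  · exact Continuous.aestronglyMeasurable ((hcont ζ).mul (by fun_prop))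
  · refine Eventually.of_forall fun w ξ hξ => ?_
    have b1 : ‖-(A w * 1 + B w * (-(ξ ^ 2)⁻¹))‖ ≤ |M| * L * ‖w‖ ^ 2 := by
      have hM : M ≤ |M| := le_abs_self M
      rw [norm_neg]
      calc _ ≤ ‖A w * 1‖ + ‖B w * (-(ξ ^ 2)⁻¹)‖ := norm_add_le _ _
        _ = ‖A w‖ + ‖B w‖ * ‖ξ⁻¹‖ ^ 2 := by simp
        _ ≤ |M| * ‖w‖ ^ 2 + |M| * ‖w‖ ^ 2 * (‖z⁻¹‖ + 1) ^ 2 := by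
            have := hξ.2.2.2
            gcongr
            · exact (hAM w).trans (by gcongr)
            · exact (hBM w).trans (by gcongr)
        _ = _ := by simp only [L]; ring
    have b2 : ‖w‖ ^ 2 ≤ 4 / δ * Real.exp (δ / 4 * ‖w‖ ^ 2) := by
      have := Real.add_one_le_exp (δ / 4 * ‖w‖ ^ 2)
      calc ‖w‖ ^ 2 = 4 / δ * (δ / 4 * ‖w‖ ^ 2) := by field_simp
        _ ≤ _ := by gcongr; linarith
    have hL : 0 ≤ L := by positivity
    rw [norm_mul]
    calc _ ≤ Real.exp (-(δ / 2 * ‖w‖ ^ 2)) *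
          (|M| * L * (4 / δ * Real.exp (δ / 4 * ‖w‖ ^ 2))) := by
          gcongr
          · exact hnorm ξ hξ w
          · exact b1.trans (by gcongr)
      _ = |M| * L * (4 / δ) *
          (Real.exp (-(δ / 2 * ‖w‖ ^ 2)) * Real.exp (δ / 4 * ‖w‖ ^ 2)) := by ring
      _ = _ := by rw [← Real.exp_add]; congr 2; ring
  · exact (hμ (δ / 4) (by positivity)).const_mul _
  · refine Eventually.of_forall fun w ξ hξ => ?_
    have h := (((hasDerivAt_id ξ).const_mul (A w)).add
      ((hasDerivAt_inv hξ.1).const_mul (B w))).add_const (C w)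
    exact h.neg.cexp

variable {E : Type*} [NormedAddCommGroup E] [InnerProductSpace ℝ E] [FiniteDimensional ℝ E]
  [MeasurableSpace E] [BorelSpace E]

lemma integrable_exp_neg_mul_sq_norm {c : ℝ} (hc : 0 < c) :
    Integrable (fun v : E => Real.exp (-(c * ‖v‖ ^ 2))) := by
  have h := (GaussianFourier.integrable_cexp_neg_mul_sq_norm_add (V := E) (b := (c : ℂ))
    (by simpa using hc) 0 0).norm
  refine h.congr (Eventually.of_forall fun v => ?_)
  simp only [Complex.norm_exp]
  norm_cast
  simp

lemma integrable_exp_neg_mul_sq_norm_prod {c : ℝ} (hc : 0 < c) :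
    Integrable (fun w : E × E => Real.exp (-(c * ‖w‖ ^ 2))) := by
  have h := (integrable_exp_neg_mul_sq_norm (E := E) (half_pos hc)).mul_prod
    (integrable_exp_neg_mul_sq_norm (E := E) (half_pos hc))
  refine Integrable.mono' h (by fun_prop) (Eventually.of_forall fun w => ?_)
  rw [Real.norm_of_nonneg (Real.exp_nonneg _), ← Real.exp_add, Real.exp_le_exp]
  have h1 : ‖w.1‖ ^ 2 ≤ ‖w‖ ^ 2 := by gcongr; exact norm_fst_le w
  have h2 : ‖w.2‖ ^ 2 ≤ ‖w‖ ^ 2 := by gcongr; exact norm_snd_le w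
  nlinarith

lemma norm_integral_gaussian_prod {s t : ℂ} (hs : 0 < s.re) (ht : 0 < t.re) :
    ‖∫ w : E × E, Complex.exp (-(s * ‖w.1‖ ^ 2 + t * ‖w.2‖ ^ 2))‖ =
      (Real.pi / ‖s‖) ^ (Module.finrank ℝ E / 2 : ℝ) *
        (Real.pi / ‖t‖) ^ (Module.finrank ℝ E / 2 : ℝ) := by
  have key : ∀ u : ℂ, 0 < u.re → ‖∫ v : E, Complex.exp (-u * ‖v‖ ^ 2)‖ =
      (Real.pi / ‖u‖) ^ (Module.finrank ℝ E / 2 : ℝ) := fun u hu => by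
    have hu0 : u ≠ 0 := fun h => by simp [h] at hu
    rw [GaussianFourier.integral_cexp_neg_mul_sq_norm hu]
    have : ((Module.finrank ℝ E : ℂ) / 2) = ((Module.finrank ℝ E / 2 : ℝ) : ℂ) := by
      push_cast; rfl
    rw [this, Complex.norm_cpow_of_ne_zero (by
      simp [hu0, Real.pi_ne_zero])]
    simp [abs_of_pos Real.pi_pos]
  rw [← key s hs, ← key t ht, ← norm_mul, ← integral_prod_mul]
  congr 2
  ext w
  rw [← Complex.exp_add]
  congr 1; ring

end Analytic

section GaussianBound

variable {E : Type*} [NormedAddCommGroup E] [InnerProductSpace ℝ E] [FiniteDimensional ℝ E]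
  [MeasurableSpace E] [BorelSpace E]

lemma tendsto_ofReal_sq_nhdsNE_one :
    Tendsto (fun t : ℝ => ((t ^ 2 : ℝ) : ℂ)) (𝓝[>] 1) (𝓝[≠] 1) := by
  refine tendsto_nhdsWithin_iff.2 ⟨?_, ?_⟩
  · have h : Continuous fun t : ℝ => ((t ^ 2 : ℝ) : ℂ) := by fun_prop
    have h1 := h.tendsto 1
    simp only [one_pow, Complex.ofReal_one] at h1
    exact h1.mono_left nhdsWithin_le_nhds
  · filter_upwards [self_mem_nhdsWithin] with t (ht : 1 < t)
    have : (1 : ℝ) < t ^ 2 := by nlinarith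
    exact fun h : ((t ^ 2 : ℝ) : ℂ) = 1 => this.ne' (by exact_mod_cast h)

/-- For a homogeneous contraction `R`, a function on `E × E` dominated along `pairMap R` by
half of `‖z‖² - ‖R z‖² + ‖z'‖² - ‖R z'‖²` has a large Gaussian-type integral. -/
theorem two_pow_le_lintegral_exp_neg [Nontrivial E] {R : E → E} {r : ℝ≥0}
    (hR : LipschitzWith r R) (hr : r < 1) (hhom : ∀ t : ℝ, 0 < t → ∀ z, R (t • z) = t • R z)
    {h : E × E → ℝ}
    (hh : ∀ z z', h (pairMap R (z, z')) ≤
      (‖z‖ ^ 2 - ‖R z‖ ^ 2 + (‖z'‖ ^ 2 - ‖R z'‖ ^ 2)) / 2) :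
    (2 : ℝ≥0∞) ^ Module.finrank ℝ E ≤ ∫⁻ w, ENNReal.ofReal (Real.exp (-h w)) := by
  have hr0 : (0 : ℝ) ≤ r := r.2
  have hr1 : (r : ℝ) < 1 := by exact_mod_cast hr
  have hR0 : R 0 = 0 := by
    have h2 := hhom 2 two_pos 0
    rw [smul_zero, two_smul] at h2
    simpa using h2
  have hRn : ∀ z, ‖R z‖ ≤ r * ‖z‖ := fun z => by
    simpa [hR0] using hR.norm_sub_le z 0
  have hRn2 : ∀ z, ‖R z‖ ^ 2 ≤ r ^ 2 * ‖z‖ ^ 2 := fun z => by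
    rw [← mul_pow]; gcongr; exact hRn z
  have hRn1 : ∀ z, ‖R z‖ ^ 2 ≤ ‖z‖ ^ 2 := fun z => by
    gcongr; exact (hRn z).trans (mul_le_of_le_one_left (norm_nonneg _) hr1.le)
  set ε : ℝ := (1 - r ^ 2) / 4 with hε
  have hε0 : 0 < ε := by rw [hε]; nlinarith
  have hε1 : ε ≤ 1 / 4 := by rw [hε]; nlinarith
  set σ : ℂ := ⟨ε, -1⟩
  set τ : ℂ := ⟨ε, 1⟩
  have hσn : ‖σ‖ ^ 2 = ε ^ 2 + 1 := by rw [Complex.sq_norm, Complex.normSq_apply]; simp [σ]; ring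
  have hτn : ‖τ‖ ^ 2 = ε ^ 2 + 1 := by rw [Complex.sq_norm, Complex.normSq_apply]; simp [τ]; ring
  have hσ2 : ‖σ‖ ≤ 3 / 2 := by nlinarith [norm_nonneg σ]
  have hτ2 : ‖τ‖ ≤ 3 / 2 := by nlinarith [norm_nonneg τ]
  let e := pairHomeo hR hr
  let q : E × E → E × E := e.symm
  have hq : Continuous q := e.symm.continuous
  have hqF : ∀ w, pairMap R (q w) = w := e.apply_symm_apply
  have hq1 : ∀ w, (q w).1 + R (q w).2 = w.1 := fun w => congrArg Prod.fst (hqF w)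
  have hq2 : ∀ w, (q w).2 + R (q w).1 = w.2 := fun w => congrArg Prod.snd (hqF w)
  have hqn : ∀ w, ‖q w‖ ^ 2 ≤ (1 / (1 - r) ^ 2) * ‖w‖ ^ 2 := fun w => by
    have h1 := approximatesLinearOn_pairMap hR (q w) trivial 0 trivial
    have h0 : pairMap R 0 = 0 := by simp [pairMap, hR0]
    simp only [ContinuousLinearEquiv.coe_refl, ContinuousLinearMap.coe_id', id_eq, hqF, h0,
      sub_zero] at h1
    have h2 := norm_sub_norm_le (q w) w
    rw [norm_sub_rev] at h2
    have h3 : (1 - r) * ‖q w‖ ≤ ‖w‖ := by linarith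
    have h4 : 0 < 1 - (r : ℝ) := by linarith
    rw [one_div, inv_mul_eq_div, le_div_iff₀ (by positivity), ← mul_pow, mul_comm]
    gcongr
  have hRc : Continuous R := hR.continuous
  let A : E × E → ℂ := fun w => σ * (‖(q w).1‖ ^ 2 : ℝ) + τ * (‖R (q w).1‖ ^ 2 : ℝ)
  let B : E × E → ℂ := fun w => τ * (‖(q w).2‖ ^ 2 : ℝ) + σ * (‖R (q w).2‖ ^ 2 : ℝ)
  let C : E × E → ℂ := fun w => σ * (2 * ⟪(q w).1, R (q w).2⟫_ℝ : ℝ) +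
    τ * (2 * ⟪(q w).2, R (q w).1⟫_ℝ : ℝ)
  have hA : Continuous A := by fun_prop
  have hB : Continuous B := by fun_prop
  have hC : Continuous C := by fun_prop
  have bound : ∀ (s t : ℂ) (x : E), ‖s‖ ≤ 3 / 2 → ‖t‖ ≤ 3 / 2 →
      ‖s * (‖x‖ ^ 2 : ℝ) + t * (‖R x‖ ^ 2 : ℝ)‖ ≤ 3 * ‖x‖ ^ 2 := fun s t x hs ht => by
    refine (norm_add_le _ _).trans ?_
    rw [norm_mul, norm_mul, Complex.norm_real, Complex.norm_real,
      Real.norm_of_nonneg (by positivity), Real.norm_of_nonneg (by positivity)]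
    calc _ ≤ 3 / 2 * ‖x‖ ^ 2 + 3 / 2 * ‖x‖ ^ 2 := by
          gcongr
          exact (hRn x).trans (mul_le_of_le_one_left (norm_nonneg _) hr1.le)
      _ = _ := by ring
  have hAM : ∀ w, ‖A w‖ ≤ (3 * (1 / (1 - r) ^ 2)) * ‖w‖ ^ 2 := fun w => by
    refine (bound σ τ _ hσ2 hτ2).trans ?_
    rw [mul_assoc]
    gcongr
    refine le_trans ?_ (hqn w)
    gcongr
    exact norm_fst_le _
  have hBM : ∀ w, ‖B w‖ ≤ (3 * (1 / (1 - r) ^ 2)) * ‖w‖ ^ 2 := fun w => by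
    refine (bound τ σ _ hτ2 hσ2).trans ?_
    rw [mul_assoc]
    gcongr
    refine le_trans ?_ (hqn w)
    gcongr
    exact norm_snd_le _
  have hexp_inv : ∀ θ : ℝ, (Complex.exp (θ * Complex.I))⁻¹ = Complex.exp ((-θ : ℝ) * Complex.I) :=
    fun θ => by rw [← Complex.exp_neg]; congr 1; push_cast; ring
  have hre_eq : ∀ (θ : ℝ) (w : E × E), (A w * Complex.exp (θ * Complex.I) +
      B w * (Complex.exp (θ * Complex.I))⁻¹ + C w).re =
      Real.sin θ * (‖(q w).1‖ ^ 2 - ‖R (q w).1‖ ^ 2 + (‖(q w).2‖ ^ 2 - ‖R (q w).2‖ ^ 2)) +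
      ε * (Real.cos θ * (‖(q w).1‖ ^ 2 + ‖R (q w).1‖ ^ 2 + (‖(q w).2‖ ^ 2 + ‖R (q w).2‖ ^ 2)) +
        2 * ⟪(q w).1, R (q w).2⟫_ℝ + 2 * ⟪(q w).2, R (q w).1⟫_ℝ) := by
    intro θ w
    rw [hexp_inv]
    simp only [A, B, C, Complex.add_re, Complex.mul_re, Complex.add_im, Complex.mul_im,
      Complex.ofReal_re, Complex.ofReal_im, Complex.exp_ofReal_mul_I_re,
      Complex.exp_ofReal_mul_I_im, Real.cos_neg, Real.sin_neg, σ, τ]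
    ring
  have hsq1 : ∀ w, ‖w.1‖ ^ 2 = ‖(q w).1‖ ^ 2 + 2 * ⟪(q w).1, R (q w).2⟫_ℝ + ‖R (q w).2‖ ^ 2 :=
    fun w => by rw [← norm_add_sq_real, hq1]
  have hsq2 : ∀ w, ‖w.2‖ ^ 2 = ‖(q w).2‖ ^ 2 + 2 * ⟪(q w).2, R (q w).1⟫_ℝ + ‖R (q w).1‖ ^ 2 :=
    fun w => by rw [← norm_add_sq_real, hq2]
  have hcoer : ∀ θ ∈ Set.Icc (0 : ℝ) (Real.pi / 2), ∀ w, ε * ‖w‖ ^ 2 ≤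
      (A w * Complex.exp (θ * Complex.I) + B w * (Complex.exp (θ * Complex.I))⁻¹ + C w).re := by
    intro θ hθ w
    rw [hre_eq]
    have hs : 0 ≤ Real.sin θ := Real.sin_nonneg_of_nonneg_of_le_pi hθ.1
      (by linarith [hθ.2, Real.pi_pos])
    have hc : 0 ≤ Real.cos θ := Real.cos_nonneg_of_neg_pi_div_two_le_of_le
      (by linarith [hθ.1, Real.pi_pos]) hθ.2
    have hsc : 1 - Real.cos θ ≤ Real.sin θ := by
      nlinarith [Real.sin_sq_add_cos_sq θ]
    have hc1 := Real.cos_le_one θ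
    have hw : ‖w‖ ^ 2 ≤ ‖w.1‖ ^ 2 + ‖w.2‖ ^ 2 := by
      rcases max_choice ‖w.1‖ ‖w.2‖ with hm | hm <;> rw [Prod.norm_def, hm] <;> nlinarith
    have g1 := hRn2 (q w).1
    have g2 := hRn2 (q w).2
    have g3 := hRn1 (q w).1
    have g4 := hRn1 (q w).2
    have g5 := hsq1 w
    have g6 := hsq2 w
    set a := ‖(q w).1‖ ^ 2
    set a' := ‖R (q w).1‖ ^ 2
    set b := ‖(q w).2‖ ^ 2
    set b' := ‖R (q w).2‖ ^ 2
    have ha : 0 ≤ a := by positivity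
    have hb : 0 ≤ b := by positivity
    have k1 : 4 * ε * (a + b) ≤ a - a' + (b - b') := by rw [hε]; nlinarith
    have k2 : Real.sin θ * (4 * ε * (a + b)) ≤ Real.sin θ * (a - a' + (b - b')) := by gcongr
    have k3 : ε * ((1 - Real.cos θ) * (a + a' + (b + b'))) ≤
        ε * (Real.sin θ * (2 * (a + b))) := by
      gcongr
      · linarith
    have k4 : 0 ≤ ε * (Real.sin θ * (a + b)) := by positivity
    have k5 : ε * ‖w‖ ^ 2 ≤ ε * (‖w.1‖ ^ 2 + ‖w.2‖ ^ 2) := by gcongr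
    rw [g5, g6] at k5
    linarith
  let J : ℂ → ℂ := fun ζ => ∫ w, Complex.exp (-(A w * ζ + B w * ζ⁻¹ + C w))
  let J₀ : ℂ := ∫ w : E × E, Complex.exp (-(σ * ‖w.1‖ ^ 2 + τ * ‖w.2‖ ^ 2))
  have hflow : ∀ l : ℝ, 0 < l → J ((l ^ 2 : ℝ) : ℂ) = J₀ := by
    intro l hl
    have hl' : l ≠ 0 := hl.ne'
    simp only [J₀]
    rw [← integral_pairHomeo_hypScale hR hr hhom hl]
    refine integral_congr_ae (Eventually.of_forall fun w => ?_)
    have e1 : ∀ x y : E, ‖l • x + R (l⁻¹ • y)‖ ^ 2 =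
        l ^ 2 * ‖x‖ ^ 2 + 2 * ⟪x, R y⟫_ℝ + (l ^ 2)⁻¹ * ‖R y‖ ^ 2 := fun x y => by
      rw [hhom _ (inv_pos.2 hl), norm_add_sq_real, norm_smul, norm_smul, inner_smul_left,
        inner_smul_right, mul_pow, mul_pow, Real.norm_eq_abs, Real.norm_eq_abs, sq_abs, sq_abs,
        inv_pow]
      simp only [conj_trivial]
      field_simp
    have e2 : ∀ x y : E, ‖l⁻¹ • x + R (l • y)‖ ^ 2 =
        (l ^ 2)⁻¹ * ‖x‖ ^ 2 + 2 * ⟪x, R y⟫_ℝ + l ^ 2 * ‖R y‖ ^ 2 := fun x y => by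
      rw [hhom _ hl, norm_add_sq_real, norm_smul, norm_smul, inner_smul_left,
        inner_smul_right, mul_pow, mul_pow, Real.norm_eq_abs, Real.norm_eq_abs, sq_abs, sq_abs,
        inv_pow]
      simp only [conj_trivial]
      field_simp
    simp only [pairMap, hypScale_apply]
    rw [← Complex.ofReal_pow, ← Complex.ofReal_pow, e1, e2]
    simp only [A, B, C, q, e]
    congr 2
    push_cast
    ring
  have hana : ∀ θ ∈ Set.Icc (0 : ℝ) (Real.pi / 2), AnalyticAt ℂ J (Complex.exp (θ * Complex.I)) :=
    fun θ hθ => by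
      have : SecondCountableTopology E := inferInstance
      have : SecondCountableTopology (E × E) := inferInstance
      have : BorelSpace (E × E) := inferInstance
      have hint : ∀ c : ℝ, 0 < c →
          Integrable (fun w : E × E => Real.exp (-(c * ‖w‖ ^ 2))) volume :=
        fun c hc => integrable_exp_neg_mul_sq_norm_prod hc
      exact analyticAt_integral_cexp volume hint hA hB hC hAM hBM hε0
        (Complex.exp_ne_zero _) (hcoer θ hθ)
  let U : Set ℂ := (fun θ : ℝ => Complex.exp (θ * Complex.I)) '' Set.Icc 0 (Real.pi / 2)
  have hU : IsPreconnected U := isPreconnected_Icc.image _ (by fun_prop)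
  have h1U : (1 : ℂ) ∈ U := ⟨0, ⟨le_rfl, by positivity⟩, by simp⟩
  have hfreq : ∃ᶠ ζ in 𝓝[≠] (1 : ℂ), J ζ = J₀ := by
    refine tendsto_ofReal_sq_nhdsNE_one.frequently (Eventually.frequently ?_)
    filter_upwards [self_mem_nhdsWithin] with t (ht : 1 < t) using hflow t (by linarith)
  have hJana : AnalyticOnNhd ℂ J U := by
    rintro _ ⟨θ, hθ, rfl⟩
    exact hana θ hθ
  have hJ := hJana.eqOn_of_preconnected_of_frequently_eq analyticOnNhd_const hU h1U hfreq
  have hJI : J (Complex.exp ((Real.pi / 2 : ℝ) * Complex.I)) = J₀ :=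
    hJ ⟨Real.pi / 2, ⟨by positivity, le_rfl⟩, rfl⟩
  have hlow : (2 : ℝ) ^ Module.finrank ℝ E ≤ ‖J₀‖ := by
    have hb : ∀ s : ℂ, 0 < s.re → ‖s‖ ≤ 3 / 2 → (2 : ℝ) ^ (Module.finrank ℝ E / 2 : ℝ) ≤
        (Real.pi / ‖s‖) ^ (Module.finrank ℝ E / 2 : ℝ) := fun s hs hs2 => by
      have : 0 < ‖s‖ := norm_pos_iff.2 fun h0 => by simp [h0] at hs
      refine Real.rpow_le_rpow two_pos.le ?_ (by positivity)
      rw [le_div_iff₀ this]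
      linarith [Real.pi_gt_three]
    rw [norm_integral_gaussian_prod (E := E) (s := σ) (t := τ) hε0 hε0]
    calc (2 : ℝ) ^ Module.finrank ℝ E =
        2 ^ (Module.finrank ℝ E / 2 : ℝ) * 2 ^ (Module.finrank ℝ E / 2 : ℝ) := by
          rw [← Real.rpow_add two_pos, add_halves, Real.rpow_natCast]
      _ ≤ _ := mul_le_mul (hb σ hε0 hσ2) (hb τ hε0 hτ2) (by positivity) (by positivity)
  calc (2 : ℝ≥0∞) ^ Module.finrank ℝ E = ENNReal.ofReal (2 ^ Module.finrank ℝ E) := by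
        rw [ENNReal.ofReal_pow two_pos.le]; simp
    _ ≤ ENNReal.ofReal ‖J₀‖ := ENNReal.ofReal_le_ofReal hlow
    _ = ‖J (Complex.exp ((Real.pi / 2 : ℝ) * Complex.I))‖ₑ := by rw [hJI, ofReal_norm]
    _ ≤ ∫⁻ w, ‖Complex.exp (-(A w * Complex.exp ((Real.pi / 2 : ℝ) * Complex.I) +
          B w * (Complex.exp ((Real.pi / 2 : ℝ) * Complex.I))⁻¹ + C w))‖ₑ :=
        enorm_integral_le_lintegral_enorm _
    _ ≤ _ := by
        refine lintegral_mono fun w => ?_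
        rw [← ofReal_norm, Complex.norm_exp, Complex.neg_re, hre_eq]
        refine ENNReal.ofReal_le_ofReal (Real.exp_le_exp.2 (neg_le_neg ?_))
        have h1 := hh (q w).1 (q w).2
        rw [Prod.mk.eta, hqF] at h1
        refine h1.trans ?_
        rw [Real.sin_pi_div_two, Real.cos_pi_div_two]
        have g1 := hRn2 (q w).1
        have g2 := hRn2 (q w).2
        have g3 := hRn1 (q w).1
        have g4 := hRn1 (q w).2
        have g5 : 0 ≤ ‖(q w).1 + R (q w).2‖ ^ 2 := by positivity
        have g6 : 0 ≤ ‖(q w).2 + R (q w).1‖ ^ 2 := by positivity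
        rw [norm_add_sq_real] at g5 g6
        set a := ‖(q w).1‖ ^ 2
        set a' := ‖R (q w).1‖ ^ 2
        set b := ‖(q w).2‖ ^ 2
        set b' := ‖R (q w).2‖ ^ 2
        have k1 : 4 * ε * (a + b) ≤ a - a' + (b - b') := by rw [hε]; nlinarith
        have k2 : ε * (2 * ⟪(q w).1, R (q w).2⟫_ℝ + 2 * ⟪(q w).2, R (q w).1⟫_ℝ) ≥
            ε * (-(2 * (a + b))) := by
          gcongr
          linarith
        nlinarith

end GaussianBound

section ConeSplit

variable {E : Type*} [NormedAddCommGroup E] [InnerProductSpace ℝ E]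

/-- `x` is the `E`-component of the projection of `(x + y, 0)` to the cone
`{(x, t) | p x ≤ t}` in `E × ℝ`, and `t` is its last coordinate. -/
structure ConeSplit (p : Seminorm ℝ E) (x y : E) (t : ℝ) : Prop where
  le : p x ≤ t
  inner_eq : ⟪y, x⟫_ℝ = t ^ 2
  inner_le : ∀ c, ⟪y, c⟫_ℝ ≤ t * p c

namespace ConeSplit

variable {p : Seminorm ℝ E} {x y x' y' : E} {t t' : ℝ}

lemma nonneg (h : ConeSplit p x y t) : 0 ≤ t := (apply_nonneg p x).trans h.le

lemma smul (h : ConeSplit p x y t) {s : ℝ} (hs : 0 ≤ s) :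
    ConeSplit p (s • x) (s • y) (s * t) where
  le := by
    rw [map_smul_eq_mul, Real.norm_of_nonneg hs]
    exact mul_le_mul_of_nonneg_left h.le hs
  inner_eq := by rw [real_inner_smul_left, real_inner_smul_right, h.inner_eq]; ring
  inner_le c := by
    rw [real_inner_smul_left, mul_assoc]
    exact mul_le_mul_of_nonneg_left (h.inner_le c) hs

lemma norm_sub_le (h : ConeSplit p x y t) (h' : ConeSplit p x' y' t') :
    ‖(y - x) - (y' - x')‖ ≤ ‖(x + y) - (x' + y')‖ := by
  have h1 : ⟪y, x'⟫_ℝ ≤ t * t' :=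
    (h.inner_le x').trans (mul_le_mul_of_nonneg_left h'.le h.nonneg)
  have h2 : ⟪y', x⟫_ℝ ≤ t' * t :=
    (h'.inner_le x).trans (mul_le_mul_of_nonneg_left h.le h'.nonneg)
  have h3 : 0 ≤ ⟪y - y', x - x'⟫_ℝ := by
    rw [inner_sub_left, inner_sub_right, inner_sub_right, h.inner_eq, h'.inner_eq]
    nlinarith [sq_nonneg (t - t')]
  have e1 : (y - x) - (y' - x') = (y - y') - (x - x') := by abel
  have e2 : (x + y) - (x' + y') = (y - y') + (x - x') := by abel
  rw [e1, e2]
  refine (sq_le_sq₀ (norm_nonneg _) (norm_nonneg _)).1 ?_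
  rw [norm_sub_sq_real, norm_add_sq_real]
  linarith

lemma norm_sq_sub (h : ConeSplit p x y t) : ‖x + y‖ ^ 2 - ‖y - x‖ ^ 2 = 4 * t ^ 2 := by
  rw [norm_sub_sq_real, norm_add_sq_real, real_inner_comm y x, h.inner_eq]
  ring

end ConeSplit

lemma exists_coneSplit [CompleteSpace E] {p : Seminorm ℝ E} (hp : Continuous p) (z : E) :
    ∃ x y t, ConeSplit p x y t ∧ x + y = z := by
  let C : Set (WithLp 2 (E × ℝ)) := {w | p w.fst ≤ w.snd}
  have h0 : (0 : WithLp 2 (E × ℝ)) ∈ C := by simp [C]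
  have hclosed : IsClosed C := isClosed_le (by fun_prop) (by fun_prop)
  have hconv : Convex ℝ C := by
    intro a ha b hb s t hs ht _
    simp only [C, Set.mem_ofPred_eq, WithLp.add_fst, WithLp.add_snd, WithLp.smul_fst,
      WithLp.smul_snd, smul_eq_mul] at ha hb ⊢
    refine (map_add_le_add p _ _).trans ?_
    rw [map_smul_eq_mul, map_smul_eq_mul, Real.norm_of_nonneg hs, Real.norm_of_nonneg ht]
    gcongr
  obtain ⟨v, hv, hmin⟩ := exists_norm_eq_iInf_of_complete_convex ⟨0, h0⟩ hclosed.isComplete hconv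
    (WithLp.toLp 2 (z, (0 : ℝ)))
  rw [norm_eq_iInf_iff_real_inner_le_zero hconv hv] at hmin
  have key : ∀ w ∈ C, ⟪z - v.fst, w.fst - v.fst⟫_ℝ - v.snd * (w.snd - v.snd) ≤ 0 := by
    intro w hw
    have := hmin w hw
    simp only [WithLp.prod_inner_apply] at this
    simpa [mul_comm, sub_eq_add_neg] using this
  have k0 := key 0 h0
  have k2 := key ((2 : ℝ) • v) (by
    simp only [C, Set.mem_ofPred_eq, WithLp.smul_fst, WithLp.smul_snd, smul_eq_mul] at hv ⊢
    rw [map_smul_eq_mul, Real.norm_two]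
    linarith)
  have e2 : (2 : ℝ) • v.fst - v.fst = v.fst := by rw [two_smul]; abel
  simp only [WithLp.zero_fst, WithLp.zero_snd, zero_sub, inner_neg_right, WithLp.smul_fst,
    WithLp.smul_snd, smul_eq_mul, e2] at k0 k2
  refine ⟨v.fst, z - v.fst, v.snd, ⟨hv, by linarith, fun c => ?_⟩, by abel⟩
  have kc : ⟪z - v.fst, (v + WithLp.toLp 2 (c, p c)).fst - v.fst⟫_ℝ -
      v.snd * ((v + WithLp.toLp 2 (c, p c)).snd - v.snd) ≤ 0 := key _ (by
    simp only [C, Set.mem_ofPred_eq, WithLp.add_fst, WithLp.add_snd] at hv ⊢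
    exact (map_add_le_add p _ _).trans (add_le_add hv le_rfl))
  simp only [WithLp.add_fst, WithLp.add_snd, add_sub_cancel_left] at kc
  change ⟪z - v.fst, c⟫_ℝ - v.snd * p c ≤ 0 at kc
  linarith

/-- The reflection associated with the cone over a seminorm is nonexpansive and homogeneous. -/
lemma exists_lipschitzWith_coneSplit [CompleteSpace E] {p : Seminorm ℝ E} (hp : Continuous p) :
    ∃ R : E → E, LipschitzWith 1 R ∧ (∀ s : ℝ, 0 < s → ∀ z, R (s • z) = s • R z) ∧
      ∀ z, ∃ x y t, ConeSplit p x y t ∧ x + y = z ∧ y - x = R z := by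
  choose x y t h hz using exists_coneSplit hp
  refine ⟨fun z => y z - x z, LipschitzWith.of_dist_le_mul fun z z' => ?_, fun s hs z => ?_,
    fun z => ⟨x z, y z, t z, h z, hz z, rfl⟩⟩
  · have := (h z).norm_sub_le (h z')
    rw [hz, hz] at this
    simpa [dist_eq_norm] using this
  · have := (h (s • z)).norm_sub_le ((h z).smul hs.le)
    rw [hz, ← smul_add, hz, sub_self, norm_zero, ← smul_sub] at this
    exact sub_eq_zero.1 (norm_le_zero_iff.1 this)

end ConeSplit

section GaussianSeminorm

variable {E : Type*} [NormedAddCommGroup E] [InnerProductSpace ℝ E] [FiniteDimensional ℝ E]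
  [MeasurableSpace E] [BorelSpace E]

lemma two_pow_le_lintegral_exp_seminorm [Nontrivial E] {p q : Seminorm ℝ E} (hp : Continuous p)
    (hpq : ∀ y t, 0 ≤ t → (∀ c, ⟪y, c⟫_ℝ ≤ t * p c) → q y ≤ t) {C : ℝ}
    (hpC : ∀ x, p x ≤ C * q x) (hqC : ∀ x, q x ≤ C * p x) :
    (2 : ℝ≥0∞) ^ Module.finrank ℝ E ≤ ∫⁻ w : E × E, ENNReal.ofReal (Real.exp
      (-((p ((2 : ℝ)⁻¹ • (w.1 - w.2)) ^ 2 + q ((2 : ℝ)⁻¹ • (w.1 + w.2)) ^ 2) / 8))) := by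
  obtain ⟨R, hR, hhom, hsplit⟩ := exists_lipschitzWith_coneSplit hp
  obtain ⟨D, hD1, hCD⟩ : ∃ D : ℝ, 1 ≤ D ∧ C ≤ D := ⟨max 1 C, le_max_left _ _, le_max_right _ _⟩
  have hD0 : 0 < D := by linarith
  have hDi : D⁻¹ ≤ 1 := inv_le_one_of_one_le₀ hD1
  obtain ⟨r, hr⟩ : ∃ r : ℝ≥0, (r : ℝ) = 1 - D⁻¹ := ⟨⟨1 - D⁻¹, by linarith⟩, rfl⟩
  have hr1 : r < 1 := by
    rw [← NNReal.coe_lt_coe, hr, NNReal.coe_one]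
    linarith [inv_pos.2 hD0]
  have hpD : ∀ x, D⁻¹ * p x ≤ q x := fun x => by
    rw [inv_mul_le_iff₀ hD0]
    exact (hpC x).trans (mul_le_mul_of_nonneg_right hCD (apply_nonneg q x))
  have hqD : ∀ x, D⁻¹ * q x ≤ p x := fun x => by
    rw [inv_mul_le_iff₀ hD0]
    exact (hqC x).trans (mul_le_mul_of_nonneg_right hCD (apply_nonneg p x))
  have hbound : ∀ z, ∃ t, ‖z‖ ^ 2 - ‖(r : ℝ) • R z‖ ^ 2 ≥ 4 * t ^ 2 ∧ 0 ≤ t ∧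
      p ((2 : ℝ)⁻¹ • (z - (r : ℝ) • R z)) ≤ 2 * t ∧
      q ((2 : ℝ)⁻¹ • (z + (r : ℝ) • R z)) ≤ 2 * t := by
    intro z
    obtain ⟨x, y, t, h, hz, hRz⟩ := hsplit z
    have hpx := h.le
    have hqy := hpq y t h.nonneg h.inner_le
    have hpy := (hpD y).trans hqy
    have hqx := (hqD x).trans hpx
    have c1 : 0 ≤ (1 + (r : ℝ)) / 2 := by positivity
    have c2 : 0 ≤ (1 - (r : ℝ)) / 2 := by rw [hr]; linarith [inv_pos.2 hD0]
    have combine : ∀ (s : Seminorm ℝ E) (a b : E), s a ≤ t → D⁻¹ * s b ≤ t →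
        s (((1 + (r : ℝ)) / 2) • a + ((1 - (r : ℝ)) / 2) • b) ≤ 2 * t := by
      intro s a b ha hb
      refine (map_add_le_add s _ _).trans ?_
      rw [map_smul_eq_mul, map_smul_eq_mul, Real.norm_of_nonneg c1, Real.norm_of_nonneg c2]
      have := apply_nonneg s a
      have hi := inv_pos.2 hD0
      rw [hr]
      nlinarith [h.nonneg]
    refine ⟨t, ?_, h.nonneg, ?_, ?_⟩
    · rw [← h.norm_sq_sub, hz, hRz, norm_smul, NNReal.norm_eq, ge_iff_le, sub_le_sub_iff_left]
      gcongr
      exact mul_le_of_le_one_left (norm_nonneg _) (by exact_mod_cast hr1.le)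
    · convert combine p x y hpx hpy using 2
      rw [← hRz, ← hz]
      module
    · convert combine q y x hqy hqx using 2
      rw [← hRz, ← hz]
      module
  have hRr : LipschitzWith r fun z => (r : ℝ) • R z := LipschitzWith.of_dist_le_mul fun z z' => by
    rw [dist_smul₀, NNReal.norm_eq]
    gcongr
    simpa using hR.dist_le_mul z z'
  refine two_pow_le_lintegral_exp_neg hRr hr1 (fun s hs z => ?_)
    (h := fun w => (p ((2 : ℝ)⁻¹ • (w.1 - w.2)) ^ 2 + q ((2 : ℝ)⁻¹ • (w.1 + w.2)) ^ 2) / 8)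
    fun z z' => ?_
  · rw [hhom s hs, smul_comm]
  · obtain ⟨t, h1, ht, h2, h3⟩ := hbound z
    obtain ⟨t', h1', ht', h2', h3'⟩ := hbound z'
    have k1 : p ((2 : ℝ)⁻¹ • (z + (r : ℝ) • R z' - (z' + (r : ℝ) • R z))) ≤ 2 * t + 2 * t' := by
      have e : (2 : ℝ)⁻¹ • (z + (r : ℝ) • R z' - (z' + (r : ℝ) • R z)) =
        (2 : ℝ)⁻¹ • (z - (r : ℝ) • R z) - (2 : ℝ)⁻¹ • (z' - (r : ℝ) • R z') := by module
      rw [e]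
      exact (map_sub_le_add p _ _).trans (add_le_add h2 h2')
    have k2 : q ((2 : ℝ)⁻¹ • (z + (r : ℝ) • R z' + (z' + (r : ℝ) • R z))) ≤ 2 * t + 2 * t' := by
      have e : (2 : ℝ)⁻¹ • (z + (r : ℝ) • R z' + (z' + (r : ℝ) • R z)) =
        (2 : ℝ)⁻¹ • (z + (r : ℝ) • R z) + (2 : ℝ)⁻¹ • (z' + (r : ℝ) • R z') := by module
      rw [e]
      exact (map_add_le_add q _ _).trans (add_le_add h3 h3')
    have k1' := pow_le_pow_left₀ (apply_nonneg p _) k1 2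
    have k2' := pow_le_pow_left₀ (apply_nonneg q _) k2 2
    simp only [pairMap]
    nlinarith [sq_nonneg (t - t')]

/-- In the coordinates `(w.1 - w.2, w.2)` the integral of a product of functions of `w.1 - w.2`
and `w.1 + w.2` decouples. -/
lemma lintegral_prod_sub_add {F G : E → ℝ≥0∞} (hF : Measurable F) (hG : Measurable G) :
    ∫⁻ w : E × E, F (w.1 - w.2) * G ((2 : ℝ)⁻¹ • (w.1 + w.2)) =
      (∫⁻ x, F x) * ∫⁻ x, G x := by
  have : SecondCountableTopology E := inferInstance
  have hsmul : Measurable fun x : E => (2 : ℝ)⁻¹ • x := measurable_const_smul _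
  rw [Measure.volume_eq_prod, lintegral_prod_symm _ (by fun_prop)]
  have h1 : ∀ b : E, ∫⁻ a : E, F (a - b) * G ((2 : ℝ)⁻¹ • (a + b)) =
      ∫⁻ a : E, F a * G ((2 : ℝ)⁻¹ • a + b) := fun b => by
    rw [← lintegral_add_right_eq_self _ b]
    refine lintegral_congr fun a => ?_
    rw [add_sub_cancel_right]
    congr 2
    module
  simp only [h1]
  rw [lintegral_lintegral_swap (by fun_prop), ← lintegral_mul_const _ hF]
  refine lintegral_congr fun a => ?_
  rw [lintegral_const_mul _ (by fun_prop), lintegral_add_left_eq_self]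

end GaussianSeminorm

section ConvexBody

lemma Convex.balanced_of_neg_mem {E : Type*} [AddCommGroup E] [Module ℝ E] {K : Set E}
    (hK : Convex ℝ K) (hneg : ∀ x ∈ K, -x ∈ K) : Balanced ℝ K := by
  rw [balanced_iff_smul_mem]
  intro a ha x hx
  rw [Real.norm_eq_abs, abs_le] at ha
  have := hK hx (hneg x hx) (a := (1 + a) / 2) (b := (1 - a) / 2) (by linarith) (by linarith)
    (by ring)
  convert this using 1
  module

lemma Convex.mem_nhds_zero_of_neg_mem {E : Type*} [AddCommGroup E] [Module ℝ E]
    [TopologicalSpace E] [IsTopologicalAddGroup E] [ContinuousSMul ℝ E] {K : Set E}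
    (hK : Convex ℝ K) (hneg : ∀ x ∈ K, -x ∈ K) (hint : (interior K).Nonempty) : K ∈ 𝓝 0 := by
  obtain ⟨x, hx⟩ := hint
  have := hK.combo_interior_self_mem_interior hx (hneg x (interior_subset hx))
    (a := 1 / 2) (b := 1 / 2) (by norm_num) (by norm_num) (by norm_num)
  rw [smul_neg, add_neg_cancel] at this
  exact mem_interior_iff_mem_nhds.1 this

lemma lintegral_exp_neg_sq_gauge_le {E : Type*} [NormedAddCommGroup E] [InnerProductSpace ℝ E]
    [FiniteDimensional ℝ E] [MeasurableSpace E] [BorelSpace E] {K : Set E} (hK : Convex ℝ K)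
    (hbal : Balanced ℝ K) (h0 : K ∈ 𝓝 0) (hbdd : Bornology.IsBounded K) {k : ℝ} (hk : 0 < k) :
    ∫⁻ x, ENNReal.ofReal (Real.exp (-(k * gauge K x) ^ 2)) ≤
      ENNReal.ofReal (Real.Gamma (Module.finrank ℝ E / 2 + 1)) *
        (ENNReal.ofReal k⁻¹ ^ Module.finrank ℝ E * volume K) := by
  have habs := absorbent_nhds_zero (𝕜 := ℝ) h0
  have hvon := (NormedSpace.isVonNBounded_iff ℝ).2 hbdd
  have hcont := continuous_gauge hK h0
  have hint : Integrable fun x => Real.exp (-(k * gauge K x) ^ 2) := by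
    obtain ⟨M, hM, hKM⟩ := hbdd.subset_closedBall_lt 0 0
    refine (integrable_exp_neg_mul_sq_norm (E := E) (c := (k / M) ^ 2) (by positivity)).mono'
      (by fun_prop : Continuous _).aestronglyMeasurable (Eventually.of_forall fun x => ?_)
    rw [Real.norm_of_nonneg (Real.exp_pos _).le, Real.exp_le_exp, neg_le_neg_iff, ← mul_pow]
    have := le_gauge_of_subset_closedBall habs hM.le hKM (x := x)
    refine pow_le_pow_left₀ (by positivity) ?_ 2
    calc k / M * ‖x‖ = k * (‖x‖ / M) := by ring
      _ ≤ _ := by gcongr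
  have hvol := measure_lt_one_eq_integral_div_gamma (volume : Measure E)
    (g := fun x => k * gauge K x) (by simp)
    (fun x => by rw [gauge_neg fun y hy => hbal.neg_mem_iff.2 hy])
    (fun x y => by rw [← mul_add]; gcongr; exact gauge_add_le hK habs x y)
    (fun {x} hx => (gauge_eq_zero habs hvon).1 ((mul_eq_zero.1 hx).resolve_left hk.ne'))
    (fun r x => by rw [gauge_smul hbal, Real.norm_eq_abs]; exact (mul_left_comm _ _ _).le)
    two_pos
  simp only [Real.rpow_two] at hvol
  have hG : 0 < Real.Gamma (Module.finrank ℝ E / 2 + 1) := Real.Gamma_pos_of_pos (by positivity)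
  rw [← ofReal_integral_eq_lintegral_ofReal hint (Eventually.of_forall fun x => (Real.exp_pos _).le),
    ← mul_div_cancel₀ (∫ x, Real.exp (-(k * gauge K x) ^ 2)) hG.ne',
    ENNReal.ofReal_mul hG.le, ← hvol]
  gcongr
  rw [← ENNReal.ofReal_pow (by positivity), ← Measure.addHaar_smul_of_nonneg _ (by positivity)]
  refine measure_mono fun x (hx : k * gauge K x < 1) => ?_
  rw [← Set.preimage_smul_inv₀ (inv_pos.2 hk).ne', inv_inv]
  refine setOfPred_gauge_lt_one_subset_self hK (mem_of_mem_nhds h0) habs ?_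
  simpa [gauge_smul_of_nonneg hk.le] using hx

lemma Gamma_half_add_one_sq_le (n : ℕ) : Real.Gamma (n / 2 + 1) ^ 2 ≤ (n : ℝ) ^ n := by
  have h := Real.Gamma_mul_add_mul_le_rpow_Gamma_mul_rpow_Gamma (s := 1) (t := n + 1)
    (a := 1 / 2) (b := 1 / 2) one_pos (by positivity) (by norm_num) (by norm_num) (by norm_num)
  rw [Real.Gamma_one, Real.one_rpow, one_mul, Real.Gamma_nat_eq_factorial,
    ← Real.sqrt_eq_rpow] at h
  have e : (1 / 2 * 1 + 1 / 2 * (n + 1) : ℝ) = n / 2 + 1 := by ring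
  rw [e] at h
  calc _ ≤ √(n.factorial : ℝ) ^ 2 := by
        gcongr
    _ = n.factorial := Real.sq_sqrt (by positivity)
    _ ≤ _ := by exact_mod_cast n.factorial_le_pow

variable {n : ℕ} {K : Set (EuclideanSpace ℝ (Fin n))}

lemma convex_polarSet : Convex ℝ (polarSet K) := by
  intro y hy z hz a b ha hb hab x hx
  rw [inner_add_right, real_inner_smul_right, real_inner_smul_right]
  nlinarith [hy x hx, hz x hx]

lemma neg_mem_polarSet (hneg : ∀ x ∈ K, -x ∈ K) : ∀ y ∈ polarSet K, -y ∈ polarSet K := by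
  intro y hy x hx
  simpa using hy (-x) (hneg x hx)

lemma polarSet_mem_nhds_zero (hK : Bornology.IsBounded K) : polarSet K ∈ 𝓝 0 := by
  obtain ⟨M, hM, hKM⟩ := hK.subset_closedBall_lt 0 0
  refine mem_of_superset (Metric.closedBall_mem_nhds 0 (inv_pos.2 hM)) fun y hy x hx => ?_
  have hx' : ‖x‖ ≤ M := by simpa using hKM hx
  have hy' : ‖y‖ ≤ M⁻¹ := by simpa using hy
  calc ⟪x, y⟫_ℝ ≤ ‖x‖ * ‖y‖ := real_inner_le_norm _ _
    _ ≤ M * M⁻¹ := by gcongr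
    _ = 1 := mul_inv_cancel₀ hM.ne'

lemma isBounded_polarSet (hK : K ∈ 𝓝 0) : Bornology.IsBounded (polarSet K) := by
  obtain ⟨ε, hε, hεK⟩ := Metric.nhds_basis_closedBall.mem_iff.1 hK
  refine (Metric.isBounded_closedBall (x := 0) (r := ε⁻¹)).subset fun y hy => ?_
  rw [mem_closedBall_zero_iff]
  rcases eq_or_ne y 0 with rfl | h0
  · simpa using hε.le
  have hy0 := norm_pos_iff.2 h0
  have h := hy ((ε / ‖y‖) • y) (hεK (by
    rw [mem_closedBall_zero_iff, norm_smul, Real.norm_of_nonneg (by positivity),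
      div_mul_cancel₀ _ hy0.ne']))
  rw [real_inner_smul_left, real_inner_self_eq_norm_sq] at h
  rw [← one_div, le_div_iff₀ hε]
  calc ‖y‖ * ε = ε / ‖y‖ * ‖y‖ ^ 2 := by field_simp
    _ ≤ 1 := h

lemma gauge_polarSet_le {y : EuclideanSpace ℝ (Fin n)} {t : ℝ} (ht : 0 ≤ t)
    (h : ∀ c, ⟪y, c⟫_ℝ ≤ t * gauge K c) : gauge (polarSet K) y ≤ t := by
  refine le_of_forall_gt_imp_ge_of_dense fun s hs => gauge_le_of_mem (ht.trans hs.le) ?_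
  have hs0 := ht.trans_lt hs
  rw [Set.mem_smul_set_iff_inv_smul_mem₀ hs0.ne']
  intro x hx
  rw [real_inner_smul_right, real_inner_comm, inv_mul_le_iff₀ hs0, mul_one]
  calc _ ≤ t * gauge K x := h x
    _ ≤ t * 1 := by gcongr; exact gauge_le_one_of_mem hx
    _ ≤ s := by linarith

lemma exists_gauge_le_mul_gauge {E : Type*} [NormedAddCommGroup E] [NormedSpace ℝ E]
    {K L : Set E} (hK : K ∈ 𝓝 0) (hL : L ∈ 𝓝 0) (hbdd : Bornology.IsBounded L) :
    ∃ C, ∀ x, gauge K x ≤ C * gauge L x := by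
  obtain ⟨ε, hε, hεK⟩ := Metric.nhds_basis_ball.mem_iff.1 hK
  obtain ⟨M, hM, hLM⟩ := hbdd.subset_closedBall_lt 0 0
  refine ⟨M / ε, fun x => ?_⟩
  have h1 := mul_gauge_le_norm hεK (x := x)
  have h2 := le_gauge_of_subset_closedBall (absorbent_nhds_zero hL) hM.le hLM (x := x)
  rw [div_le_iff₀ hM] at h2
  rw [div_mul_eq_mul_div, le_div_iff₀ hε]
  linarith

lemma two_pow_le_volume_mul_volume_polarSet (hn : 1 ≤ n) (hK : IsConvexBody K)
    (hneg : ∀ x ∈ K, -x ∈ K) :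
    (2 : ℝ≥0∞) ^ n ≤ ENNReal.ofReal (16 * n) ^ n * (volume K * volume (polarSet K)) := by
  have : Nonempty (Fin n) := ⟨⟨0, hn⟩⟩
  have h0 : K ∈ 𝓝 0 := hK.convex.mem_nhds_zero_of_neg_mem hneg hK.nonempty_interior
  have hb := hK.isCompact.isBounded
  have h0' := polarSet_mem_nhds_zero hb
  have hb' := isBounded_polarSet h0
  have hbal := hK.convex.balanced_of_neg_mem hneg
  have hbal' := (convex_polarSet (K := K)).balanced_of_neg_mem (neg_mem_polarSet hneg)
  obtain ⟨C, hC⟩ := exists_gauge_le_mul_gauge h0 h0' hb'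
  obtain ⟨D, hD⟩ := exists_gauge_le_mul_gauge h0' h0 hb
  let p := gaugeSeminorm hbal hK.convex (absorbent_nhds_zero h0)
  let q := gaugeSeminorm hbal' convex_polarSet (absorbent_nhds_zero h0')
  have hpc : Continuous p := continuous_gauge hK.convex h0
  have hqc : Continuous q := continuous_gauge convex_polarSet h0'
  have main := two_pow_le_lintegral_exp_seminorm hpc (q := q)
    (fun y t ht h => gauge_polarSet_le ht h) (C := max C D)
    (fun x => (hC x).trans (mul_le_mul_of_nonneg_right (le_max_left _ _) (gauge_nonneg x)))
    (fun x => (hD x).trans (mul_le_mul_of_nonneg_right (le_max_right _ _) (gauge_nonneg x)))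
  let F : EuclideanSpace ℝ (Fin n) → ℝ≥0∞ :=
    fun x => ENNReal.ofReal (Real.exp (-((√32)⁻¹ * gauge K x) ^ 2))
  let G : EuclideanSpace ℝ (Fin n) → ℝ≥0∞ :=
    fun x => ENNReal.ofReal (Real.exp (-((√8)⁻¹ * gauge (polarSet K) x) ^ 2))
  have hF : Measurable F := by
    have := (continuous_gauge hK.convex h0).measurable
    fun_prop
  have hG : Measurable G := by
    have := (continuous_gauge (convex_polarSet (K := K)) h0').measurable
    fun_prop
  have hFG : ∀ w : EuclideanSpace ℝ (Fin n) × EuclideanSpace ℝ (Fin n), ENNReal.ofReal (Real.exp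
      (-((p ((2 : ℝ)⁻¹ • (w.1 - w.2)) ^ 2 + q ((2 : ℝ)⁻¹ • (w.1 + w.2)) ^ 2) / 8))) =
      F (w.1 - w.2) * G ((2 : ℝ)⁻¹ • (w.1 + w.2)) := fun w => by
    simp only [F, G]
    rw [← ENNReal.ofReal_mul (Real.exp_pos _).le, ← Real.exp_add, map_smul_eq_mul,
      Real.norm_of_nonneg (by norm_num)]
    congr 2
    rw [mul_pow _ (gauge K _), mul_pow _ (gauge (polarSet K) _), inv_pow, inv_pow,
      Real.sq_sqrt (by norm_num), Real.sq_sqrt (by norm_num)]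
    change -((((2 : ℝ)⁻¹ * gauge K (w.1 - w.2)) ^ 2 +
      gauge (polarSet K) ((2 : ℝ)⁻¹ • (w.1 + w.2)) ^ 2) / 8) = _
    ring
  simp only [hFG] at main
  rw [lintegral_prod_sub_add hF hG] at main
  have b1 := lintegral_exp_neg_sq_gauge_le hK.convex hbal h0 hb (k := (√32)⁻¹) (by positivity)
  have b2 := lintegral_exp_neg_sq_gauge_le convex_polarSet hbal' h0' hb' (k := (√8)⁻¹)
    (by positivity)
  rw [finrank_euclideanSpace_fin] at main b1 b2
  rw [inv_inv] at b1 b2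
  have hΓ : 0 ≤ Real.Gamma (n / 2 + 1) := (Real.Gamma_pos_of_pos (by positivity)).le
  have hsqrt : √32 * √8 = 16 := by
    rw [← Real.sqrt_mul (by norm_num), show (32 * 8 : ℝ) = 16 ^ 2 by norm_num,
      Real.sqrt_sq (by norm_num)]
  calc (2 : ℝ≥0∞) ^ n ≤ _ := main
    _ ≤ _ := mul_le_mul' b1 b2
    _ = ENNReal.ofReal (Real.Gamma (n / 2 + 1) ^ 2 * 16 ^ n) *
        (volume K * volume (polarSet K)) := by
      rw [← hsqrt, mul_pow, ENNReal.ofReal_mul (by positivity), ENNReal.ofReal_mul (by positivity),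
        ENNReal.ofReal_pow hΓ, ENNReal.ofReal_pow (by positivity),
        ENNReal.ofReal_pow (by positivity)]
      ring
    _ ≤ ENNReal.ofReal ((16 * n) ^ n) * (volume K * volume (polarSet K)) := by
      gcongr
      rw [mul_pow, mul_comm]
      gcongr
      exact Gamma_half_add_one_sq_le n
    _ = _ := by rw [ENNReal.ofReal_pow (by positivity)]

end ConvexBody

/-- Bourgain–Milman inequality: there is a universal constant `c > 0` such that every
centrally symmetric convex body `K ⊆ ℝⁿ` (for every `n ≥ 1`) satisfies
`vol(K)·vol(K*) ≥ (c/n)ⁿ`. -/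
theorem bourgain_milman :
    ∃ c : ℝ, 0 < c ∧ ∀ n : ℕ, 1 ≤ n → ∀ K : Set (EuclideanSpace ℝ (Fin n)),
      IsConvexBody K → K = -K →
      ENNReal.ofReal (c / n) ^ n ≤ volume K * volume (polarSet K) := by
  refine ⟨1 / 8, by norm_num, fun n hn K hK hsymm => ?_⟩
  have h := two_pow_le_volume_mul_volume_polarSet hn hK
    (fun x hx => by rw [hsymm] at hx; exact hx)
  have hn0 : (0 : ℝ) < n := by exact_mod_cast hn
  have e : ENNReal.ofReal (1 / 8 / n) = ENNReal.ofReal (16 * n)⁻¹ * 2 := by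
    rw [← ENNReal.ofReal_ofNat 2, ← ENNReal.ofReal_mul (by positivity)]
    congr 1
    field_simp
    norm_num
  calc ENNReal.ofReal (1 / 8 / n) ^ n = ENNReal.ofReal (16 * n)⁻¹ ^ n * 2 ^ n := by rw [e, mul_pow]
    _ ≤ ENNReal.ofReal (16 * n)⁻¹ ^ n *
        (ENNReal.ofReal (16 * n) ^ n * (volume K * volume (polarSet K))) := by gcongr
    _ = volume K * volume (polarSet K) := by
      rw [← mul_assoc, ← mul_pow, ← ENNReal.ofReal_mul (by positivity),
        inv_mul_cancel₀ (by positivity), ENNReal.ofReal_one, one_pow, one_mul]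
end
end
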